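/- arXiv:2302.01750 — 3 statements merged into one kernel-verified Lean document; each statement's English description precedes it below -/
import Mathlib

section
/- For all integers n ≥ 0, A_{5,4}(125n + 121) ≡ 0 (mod 15625). -/
/-- Hook length of the cell in row `i`, column `j` (0-indexed) of the
Ferrers–Young diagram of the partition `p` (rows sorted in decreasing order). -/
def hookLength {n : ℕ} (p : n.Partition) (i j : ℕ) : ℕ :=
  (((p.parts.sort (· ≤ ·)).reverse.getD i 0 - j) +
    ((p.parts.filter (fun x => j < x)).card - i)) - 1

/-- A partition is a `t`-core if no hook number of its Ferrers–Young diagram is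
divisible by `t`. -/
def IsTCore (t : ℕ) {n : ℕ} (p : n.Partition) : Prop :=
  ∀ i j : ℕ, j < (p.parts.sort (· ≤ ·)).reverse.getD i 0 → ¬ t ∣ hookLength p i j

/-- `numA t k n` is the number of `k`-tuples of `t`-core partitions whose sizes sum to `n`. -/
noncomputable def numA (t k n : ℕ) : ℕ :=
  Nat.card { f : Fin k → Σ m : Fin (n + 1), Nat.Partition (m : ℕ) //
    (∑ i, ((f i).1 : ℕ)) = n ∧ ∀ i, IsTCore t (f i).2 }

theorem two_mul_choose_two (n : ℕ) : 2 * ((n.choose 2 : ℕ) : ℤ) = n * (n - 1) := by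
  rw [Nat.choose_two_right]
  have hev : (2 : ℕ) ∣ n * (n - 1) := (Nat.even_mul_pred_self n).two_dvd
  have : 2 * (n * (n - 1) / 2) = n * (n - 1) := Nat.mul_div_cancel' hev
  cases n with
  | zero => simp
  | succ n =>
    have := congrArg (Nat.cast : ℕ → ℤ) this
    push_cast at this ⊢
    simpa using this

/-- The finite `q`-Pochhammer product `∏_{i=1}^{n} (1 - b ^ i)`. -/
def qPoch {R : Type*} [CommRing R] (b : R) (n : ℕ) : R :=
  ∏ i ∈ Finset.range n, (1 - b ^ (i + 1))

/-- The Gaussian binomial coefficient with base `b`. -/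
def gaussBinom {R : Type*} [CommRing R] (b : R) : ℕ → ℕ → R
  | _, 0 => 1
  | 0, _ + 1 => 0
  | L + 1, N + 1 => gaussBinom b L (N + 1) + b ^ (L - N) * gaussBinom b L N

section GaussBinom

variable {R : Type*} [CommRing R]

theorem qPoch_succ (b : R) (n : ℕ) : qPoch b (n + 1) = qPoch b n * (1 - b ^ (n + 1)) :=
  Finset.prod_range_succ _ _

theorem map_qPoch {S : Type*} [CommRing S] (f : R →+* S) (b : R) (n : ℕ) :
    f (qPoch b n) = qPoch (f b) n := by
  simp [qPoch, map_prod]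

theorem gaussBinom_zero_right (b : R) (L : ℕ) : gaussBinom b L 0 = 1 := by
  cases L <;> rfl

theorem gaussBinom_of_lt (b : R) {L N : ℕ} (h : L < N) : gaussBinom b L N = 0 := by
  induction L generalizing N with
  | zero => obtain ⟨N, rfl⟩ := Nat.exists_eq_succ_of_ne_zero (by omega : N ≠ 0); rfl
  | succ L ih =>
    obtain ⟨N, rfl⟩ := Nat.exists_eq_succ_of_ne_zero (by omega : N ≠ 0)
    simp [gaussBinom, ih (by omega : L < N + 1), ih (by omega : L < N)]

theorem map_gaussBinom {S : Type*} [CommRing S] (f : R →+* S) (b : R) (L N : ℕ) :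
    f (gaussBinom b L N) = gaussBinom (f b) L N := by
  induction L generalizing N with
  | zero => cases N <;> simp [gaussBinom]
  | succ L ih => cases N <;> simp [gaussBinom, ih]

theorem gaussBinom_mul_qPoch (b : R) {L N : ℕ} (h : N ≤ L) :
    gaussBinom b L N * qPoch b N * qPoch b (L - N) = qPoch b L := by
  induction L generalizing N with
  | zero => obtain rfl : N = 0 := by omega
            simp [gaussBinom, qPoch]
  | succ L ih =>
    cases N with
    | zero => simp [gaussBinom, qPoch]
    | succ N =>
      have h2 := ih (by omega : N ≤ L)
      rw [gaussBinom, Nat.add_sub_add_right, qPoch_succ b L, qPoch_succ b N]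
      rcases Nat.lt_or_ge N L with hN | hN
      · have h1 := ih (by omega : N + 1 ≤ L)
        obtain ⟨k, rfl⟩ := Nat.exists_eq_add_of_lt hN
        rw [show N + k + 1 - (N + 1) = k by omega] at h1
        rw [show N + k + 1 - N = k + 1 by omega] at h2 ⊢
        rw [qPoch_succ b N] at h1
        rw [qPoch_succ b k] at h2 ⊢
        linear_combination (1 - b ^ (k + 1)) * h1 + b ^ (k + 1) * (1 - b ^ (N + 1)) * h2
      · obtain rfl : N = L := by omega
        rw [gaussBinom_of_lt b (by omega)]
        simp only [Nat.sub_self, pow_zero, zero_add, one_mul] at h2 ⊢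
        linear_combination (1 - b ^ (N + 1)) * h2

/-- The homogeneous `q`-binomial theorem. -/
theorem prod_add_mul_pow (b x y : R) (L : ℕ) :
    ∏ s ∈ Finset.range L, (y + x * b ^ s) =
      ∑ N ∈ Finset.range (L + 1),
        b ^ (N.choose 2) * gaussBinom b L N * x ^ N * y ^ (L - N) := by
  induction L with
  | zero => simp [gaussBinom]
  | succ L ih =>
    rw [Finset.prod_range_succ, ih, Finset.sum_range_succ' _ (L + 1), mul_add, Finset.sum_mul,
      Finset.sum_mul]
    have h1 : ∑ N ∈ Finset.range (L + 1),
        b ^ (N.choose 2) * gaussBinom b L N * x ^ N * y ^ (L - N) * y =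
        ∑ N ∈ Finset.range (L + 1),
          b ^ ((N + 1).choose 2) * gaussBinom b L (N + 1) * x ^ (N + 1) * y ^ (L - N)
          + y ^ (L + 1) := by
      rw [Finset.sum_range_succ', Finset.sum_range_succ (fun N => b ^ ((N + 1).choose 2) *
        gaussBinom b L (N + 1) * x ^ (N + 1) * y ^ (L - N)), gaussBinom_of_lt b (Nat.lt_succ_self L)]
      simp only [gaussBinom_zero_right]
      simp only [Nat.choose_zero_succ, pow_zero, Nat.sub_zero, mul_zero, zero_mul, add_zero,
        one_mul, ← pow_succ]
      congr 1
      refine Finset.sum_congr rfl fun N hN => ?_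
      rw [Finset.mem_range] at hN
      rw [mul_assoc, ← pow_succ, show L - (N + 1) + 1 = L - N by omega]
    rw [h1]
    simp only [gaussBinom_zero_right, Nat.choose_zero_succ, pow_zero, Nat.sub_zero, one_mul]
    rw [add_right_comm, ← Finset.sum_add_distrib]
    congr 1
    refine Finset.sum_congr rfl fun N hN => ?_
    rw [Finset.mem_range] at hN
    obtain ⟨k, rfl⟩ := Nat.exists_eq_add_of_le (by omega : N ≤ L)
    rw [gaussBinom, Nat.add_sub_add_right, show N + k - N = k by omega,
      Nat.choose_succ_succ N 1, Nat.choose_one_right]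
    ring

end GaussBinom

/-- The derivative at `w = 1` of the finite Jacobi triple product, before clearing powers. -/
theorem sum_mul_gaussBinom_eq {R : Type*} [CommRing R] (b : R) (m : ℕ) :
    ∑ N ∈ Finset.range (m + 1 + (m + 1) + 1), (-1) ^ N * (N : R) *
      (b ^ (N.choose 2 + (m + 1) * (m + 1 + (m + 1) - N)) *
        gaussBinom b (m + 1 + (m + 1)) N) =
    (-1) ^ m * b ^ ((m + 1).choose 2 + (m + 1) * (m + 1)) * qPoch b (m + 1) * qPoch b m := by
  open Polynomial in
  have h := prod_add_mul_pow (C b) (-X) (C (b ^ (m + 1))) (m + 1 + (m + 1))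
  have h2 := congrArg (fun p => (Polynomial.derivative p).eval 1) h
  have hl : ∏ s ∈ Finset.range (m + 1 + (m + 1)), (Polynomial.C (b ^ (m + 1)) +
      -Polynomial.X * Polynomial.C b ^ s) = (1 - Polynomial.X) *
      (Polynomial.C (b ^ (m + 1)) *
      ((∏ s ∈ Finset.range (m + 1), (Polynomial.C (b ^ (m + 1)) - Polynomial.X * Polynomial.C b ^ s)) *
      (∏ i ∈ Finset.range m, (Polynomial.C (b ^ (m + 1)) -
        Polynomial.X * Polynomial.C b ^ (m + 1 + (i + 1)))))) := by
    rw [Finset.prod_range_add, Finset.prod_range_succ' (fun i => Polynomial.C (b ^ (m + 1)) +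
      -Polynomial.X * Polynomial.C b ^ (m + 1 + i)) m]
    simp only [neg_mul, ← sub_eq_add_neg, add_zero, map_pow]
    ring
  have e1 : ∏ s ∈ Finset.range (m + 1), (b ^ (m + 1) - b ^ s) =
      (-1) ^ (m + 1) * b ^ ((m + 1).choose 2) * qPoch b (m + 1) := by
    have hq : qPoch b (m + 1) = ∏ s ∈ Finset.range (m + 1), (1 - b ^ (m + 1 - s)) := by
      rw [qPoch, ← Finset.prod_range_reflect]
      refine Finset.prod_congr rfl fun s hs => ?_
      rw [Finset.mem_range] at hs
      rw [show m + 1 - 1 - s + 1 = m + 1 - s by omega]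
    have hs : (m + 1).choose 2 = ∑ i ∈ Finset.range (m + 1), i := by
      rw [Finset.sum_range_id, Nat.choose_two_right]
    have hf : ∀ s ∈ Finset.range (m + 1),
        b ^ (m + 1) - b ^ s = (-1) * b ^ s * (1 - b ^ (m + 1 - s)) := by
      intro s hs
      rw [Finset.mem_range] at hs
      have : b ^ (m + 1) = b ^ s * b ^ (m + 1 - s) := by rw [← pow_add]; congr 1; omega
      rw [this]; ring
    rw [hq, hs, Finset.prod_congr rfl hf, Finset.prod_mul_distrib, Finset.prod_mul_distrib,
      Finset.prod_const, Finset.prod_pow_eq_pow_sum, Finset.card_range]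
  have e2 : ∏ i ∈ Finset.range m, (b ^ (m + 1) - b ^ (m + 1 + (i + 1))) =
      b ^ ((m + 1) * m) * qPoch b m := by
    rw [qPoch, pow_mul, ← Finset.card_range m, ← Finset.prod_const, Finset.card_range,
      ← Finset.prod_mul_distrib]
    refine Finset.prod_congr rfl fun s hs => ?_
    rw [pow_add]; ring
  have h3 : ∀ N ∈ Finset.range (m + 1 + (m + 1) + 1), Polynomial.eval 1 (Polynomial.derivative
      (Polynomial.C b ^ N.choose 2 * gaussBinom (Polynomial.C b) (m + 1 + (m + 1)) N *
      (-Polynomial.X) ^ N * Polynomial.C (b ^ (m + 1)) ^ (m + 1 + (m + 1) - N))) =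
      (-1) ^ N * (N : R) * (b ^ (N.choose 2 + (m + 1) * (m + 1 + (m + 1) - N)) *
        gaussBinom b (m + 1 + (m + 1)) N) := by
    intro N _
    have : Polynomial.C b ^ N.choose 2 * gaussBinom (Polynomial.C b) (m + 1 + (m + 1)) N *
      (-Polynomial.X) ^ N * Polynomial.C (b ^ (m + 1)) ^ (m + 1 + (m + 1) - N) =
      Polynomial.C ((-1) ^ N * (b ^ (N.choose 2 + (m + 1) * (m + 1 + (m + 1) - N)) *
        gaussBinom b (m + 1 + (m + 1)) N)) * Polynomial.X ^ N := by
      rw [neg_pow (Polynomial.X : Polynomial R)]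
      simp only [map_mul, map_pow, map_neg, map_one, map_gaussBinom, pow_add, pow_mul]
      ring
    rw [this]
    simp only [Polynomial.derivative_C_mul, Polynomial.derivative_X_pow, Polynomial.eval_mul,
      Polynomial.eval_C, Polynomial.eval_pow, Polynomial.eval_X, one_pow, mul_one]
    ring
  simp only [Polynomial.derivative_sum, Polynomial.eval_finsetSum] at h2
  rw [Finset.sum_congr rfl h3, hl] at h2
  simp only [Polynomial.derivative_mul, Polynomial.eval_add, Polynomial.eval_mul,
    Polynomial.derivative_sub, Polynomial.derivative_one, Polynomial.derivative_X,
    Polynomial.eval_sub, Polynomial.eval_one, Polynomial.eval_X, Polynomial.eval_neg,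
    Polynomial.eval_C, Polynomial.eval_prod, Polynomial.eval_pow, one_mul, sub_self, zero_mul,
    add_zero, zero_sub, e1, e2] at h2
  rw [← h2]
  ring

open PowerSeries

theorem X_pow_dvd_qPoch_sub {K n : ℕ} (h : K ≤ n) :
    (X : ℤ⟦X⟧) ^ K ∣ qPoch X n - pentagonalSeries ℤ := by
  have step : ∀ m, n ≤ m → (X : ℤ⟦X⟧) ^ K ∣ qPoch X m - qPoch X n := by
    intro m hm
    induction m, hm using Nat.le_induction with
    | base => simp
    | succ m hm ih =>
      rw [qPoch_succ]
      have : (X : ℤ⟦X⟧) ^ K ∣ X ^ (m + 1) := pow_dvd_pow _ (by omega)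
      have h2 := dvd_sub ih (this.mul_left (qPoch X m))
      convert h2 using 1
      ring
  rw [X_pow_dvd_iff]
  intro d hd
  have hev := coeff_prod_one_sub_X_pow_eventually_eq ℤ d
  have hev2 := Filter.tendsto_finset_range.eventually hev
  obtain ⟨m, hm1, hm2⟩ := (hev2.and (Filter.eventually_ge_atTop n)).exists
  have h3 := X_pow_dvd_iff.1 (step m hm2) d hd
  rw [map_sub, sub_eq_zero] at h3
  rw [map_sub, ← h3, sub_eq_zero]
  exact hm1

theorem constantCoeff_pentagonalSeries : constantCoeff (pentagonalSeries ℤ) = 1 := by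
  have h := coeff_pentagonalSeries_pentagonal ℤ 0
  simpa [pentagonal] using h

theorem isUnit_pentagonalSeries : IsUnit (pentagonalSeries ℤ) := by
  rw [isUnit_iff_constantCoeff, constantCoeff_pentagonalSeries]
  exact isUnit_one

theorem X_pow_dvd_gaussBinom_mul_sub_one {K N L : ℕ} (h1 : K ≤ N) (h2 : N + K ≤ L) :
    (X : ℤ⟦X⟧) ^ K ∣ gaussBinom X L N * pentagonalSeries ℤ - 1 := by
  have e := gaussBinom_mul_qPoch (X : ℤ⟦X⟧) (by omega : N ≤ L)
  rw [← Ideal.mem_span_singleton, ← Ideal.Quotient.eq]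
  have c : ∀ {n : ℕ}, K ≤ n → Ideal.Quotient.mk (Ideal.span {(X : ℤ⟦X⟧) ^ K}) (qPoch X n) =
      Ideal.Quotient.mk _ (pentagonalSeries ℤ) := fun h => by
    rw [Ideal.Quotient.eq, Ideal.mem_span_singleton]
    exact X_pow_dvd_qPoch_sub h
  have e2 := congrArg (Ideal.Quotient.mk (Ideal.span {(X : ℤ⟦X⟧) ^ K})) e
  rw [map_mul, map_mul, c h1, c (by omega : K ≤ L - N), c (by omega : K ≤ L)] at e2
  have hu := isUnit_pentagonalSeries.map (Ideal.Quotient.mk (Ideal.span {(X : ℤ⟦X⟧) ^ K}))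
  apply hu.mul_right_cancel
  rw [map_mul, e2, map_one, one_mul]

/-- A weak form of Jacobi's identity for the cube of Euler's function: modulo `X ^ K` the cube is
a combination of powers `X ^ t` with `t` a triangular number. -/
theorem exists_X_pow_dvd_cube_sub (K : ℕ) : ∃ (S : Finset ℕ) (a : ℕ → ℤ⟦X⟧) (t : ℕ → ℕ),
    (∀ N, ∃ c : ℤ, a N = C c) ∧
    (X : ℤ⟦X⟧) ^ K ∣ pentagonalSeries ℤ ^ 3 - ∑ N ∈ S, a N * X ^ t N ∧
    ∀ N ∈ S, ∃ d : ℤ, 2 * (t N : ℤ) = d * (d - 1) := by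
  obtain ⟨m, hm⟩ : ∃ m, m = 2 * K := ⟨_, rfl⟩
  set t : ℕ → ℕ := fun N => (((N : ℤ) - (m + 1)) * (N - (m + 1) - 1) / 2).toNat with ht
  have ht2 : ∀ N, 2 * (t N : ℤ) = ((N : ℤ) - (m + 1)) * (N - (m + 1) - 1) := by
    intro N
    have h0 : 0 ≤ ((N : ℤ) - (m + 1)) * (N - (m + 1) - 1) := by
      rcases le_or_gt (N : ℤ) (m + 1) with h | h
      · nlinarith
      · exact mul_nonneg (by omega) (by omega)
    have hev : (2 : ℤ) ∣ ((N : ℤ) - (m + 1)) * (N - (m + 1) - 1) :=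
      (Int.even_mul_pred_self _).two_dvd
    simp only [ht]
    rw [Int.toNat_of_nonneg (by omega)]
    omega
  refine ⟨Finset.range (m + 1 + (m + 1) + 1), fun N => (-1) ^ m * ((-1) ^ N * (N : ℤ⟦X⟧)), t,
    fun N => ⟨(-1) ^ m * ((-1) ^ N * (N : ℤ)), by simp⟩, ?_, fun N _ => ⟨_, ht2 N⟩⟩
  have hexp : ∀ N ∈ Finset.range (m + 1 + (m + 1) + 1),
      N.choose 2 + (m + 1) * (m + 1 + (m + 1) - N) =
        (m + 1).choose 2 + (m + 1) * (m + 1) + t N := by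
    intro N hN
    rw [Finset.mem_range] at hN
    have h1 := two_mul_choose_two N
    have h2 := two_mul_choose_two (m + 1)
    have h3 := ht2 N
    obtain ⟨k, hk⟩ := Nat.exists_eq_add_of_le (by omega : N ≤ m + 1 + (m + 1))
    rw [show m + 1 + (m + 1) - N = k by omega]
    have hk' : (k : ℤ) = 2 * (m + 1) - N := by omega
    zify
    rw [hk']
    push_cast at h1 h2 h3 ⊢
    linarith
  have key := sum_mul_gaussBinom_eq (X : ℤ⟦X⟧) m
  have key2 : ∑ N ∈ Finset.range (m + 1 + (m + 1) + 1), (-1) ^ N * (N : ℤ⟦X⟧) *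
      (X ^ t N * gaussBinom X (m + 1 + (m + 1)) N) = (-1) ^ m * qPoch X (m + 1) * qPoch X m := by
    apply mul_left_cancel₀ (pow_ne_zero ((m + 1).choose 2 + (m + 1) * (m + 1)) X_ne_zero)
    rw [Finset.mul_sum]
    refine Eq.trans (Finset.sum_congr rfl fun N hN => ?_) (key.trans (by ring))
    rw [hexp N hN, pow_add _ _ (t N)]
    ring
  rw [← Ideal.mem_span_singleton, ← Ideal.Quotient.eq]
  set π := Ideal.Quotient.mk (Ideal.span {(X : ℤ⟦X⟧) ^ K}) with hπ
  have c : ∀ {n : ℕ}, K ≤ n → π (qPoch X n) = π (pentagonalSeries ℤ) := fun h => by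
    rw [Ideal.Quotient.eq, Ideal.mem_span_singleton]
    exact X_pow_dvd_qPoch_sub h
  have hterm : ∀ N ∈ Finset.range (m + 1 + (m + 1) + 1),
      π (X ^ t N * gaussBinom X (m + 1 + (m + 1)) N * pentagonalSeries ℤ) = π (X ^ t N) := by
    intro N hN
    rw [Finset.mem_range] at hN
    rw [Ideal.Quotient.eq, Ideal.mem_span_singleton]
    rcases le_or_gt K (t N) with h | h
    · have : (X : ℤ⟦X⟧) ^ K ∣ X ^ t N := pow_dvd_pow _ h
      exact dvd_sub ((this.mul_right _).mul_right _) this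
    · have h3 := ht2 N
      have h4 : K ≤ N := by
        by_contra hlt
        have : (N : ℤ) - (m + 1) ≤ - (K + 1) := by omega
        nlinarith
      have h5 : N + K ≤ m + 1 + (m + 1) := by
        by_contra hlt
        have : (N : ℤ) - (m + 1) - 1 ≥ K := by omega
        nlinarith
      have := (X_pow_dvd_gaussBinom_mul_sub_one h4 h5).mul_left (X ^ t N)
      convert this using 1
      ring
  have key3 := congrArg (fun z => π ((-1) ^ m * pentagonalSeries ℤ * z)) key2
  simp only [map_mul, c (by omega : K ≤ m + 1), c (by omega : K ≤ m), Finset.mul_sum,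
    map_sum] at key3
  have e1 : π ((-1) ^ m) * π ((-1) ^ m) = 1 := by
    rw [← map_mul, ← pow_add, Even.neg_one_pow ⟨m, rfl⟩, map_one]
  have e2 : π (pentagonalSeries ℤ ^ 3) = π ((-1) ^ m) * π (pentagonalSeries ℤ) *
      (π ((-1) ^ m) * π (pentagonalSeries ℤ) * π (pentagonalSeries ℤ)) := by
    rw [map_pow]
    linear_combination -π (pentagonalSeries ℤ) ^ 3 * e1
  rw [e2, ← key3, map_sum]
  refine Finset.sum_congr rfl fun N hN => ?_
  have := hterm N hN
  simp only [map_mul] at this ⊢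
  linear_combination π ((-1) ^ m) * π ((-1) ^ N) * π (N : ℤ⟦X⟧) * this

theorem coeff_pentagonalSeries_cube_eq_zero {n : ℕ} (h : n % 5 = 2 ∨ n % 5 = 4) :
    coeff n (pentagonalSeries ℤ ^ 3) = 0 := by
  obtain ⟨S, a, t, ha, hd, ht⟩ := exists_X_pow_dvd_cube_sub (n + 1)
  have h1 := X_pow_dvd_iff.1 hd n (Nat.lt_succ_self n)
  rw [map_sub, sub_eq_zero] at h1
  rw [h1, map_sum]
  refine Finset.sum_eq_zero fun N hN => ?_
  obtain ⟨c, hc⟩ := ha N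
  rw [hc, coeff_C_mul, coeff_X_pow, if_neg, mul_zero]
  rintro rfl
  obtain ⟨d, hd⟩ := ht N hN
  have h2 : (2 * (t N : ℤ)) % 5 = (d * (d - 1)) % 5 := by rw [hd]
  rw [Int.mul_emod d, Int.sub_emod d] at h2
  have : d % 5 = 0 ∨ d % 5 = 1 ∨ d % 5 = 2 ∨ d % 5 = 3 ∨ d % 5 = 4 := by omega
  rcases this with h | h | h | h | h <;> rw [h] at h2 <;> norm_num at h2 <;> omega

/-- The part of a power series supported on exponents congruent to `r` modulo `5`. -/
noncomputable def residuePart (r : ZMod 5) : PowerSeries ℤ →+ PowerSeries ℤ where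
  toFun f := PowerSeries.mk fun n => if (n : ZMod 5) = r then PowerSeries.coeff n f else 0
  map_zero' := by ext n; simp
  map_add' f g := by ext n; by_cases h : (n : ZMod 5) = r <;> simp [h]

theorem coeff_residuePart (r : ZMod 5) (f : ℤ⟦X⟧) (n : ℕ) :
    coeff n (residuePart r f) = if (n : ZMod 5) = r then coeff n f else 0 := by
  simp [residuePart]

theorem residuePart_eq_self_iff {r : ZMod 5} {f : ℤ⟦X⟧} :
    residuePart r f = f ↔ ∀ n : ℕ, (n : ZMod 5) ≠ r → coeff n f = 0 := by
  rw [PowerSeries.ext_iff]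
  simp only [coeff_residuePart]
  refine forall_congr' fun n => ?_
  by_cases h : (n : ZMod 5) = r <;> simp [h, eq_comm]

theorem residuePart_residuePart (r : ZMod 5) (f : ℤ⟦X⟧) :
    residuePart r (residuePart r f) = residuePart r f := by
  rw [residuePart_eq_self_iff]
  intro n hn
  rw [coeff_residuePart, if_neg hn]

theorem residuePart_of_ne {r s : ZMod 5} {f : ℤ⟦X⟧} (hf : residuePart r f = f) (h : s ≠ r) :
    residuePart s f = 0 := by
  ext n
  rw [coeff_residuePart, map_zero]
  split_ifs with hn
  · exact residuePart_eq_self_iff.1 hf n (by rwa [hn])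
  · rfl

theorem residuePart_mul {r s u : ZMod 5} {a : ℤ⟦X⟧} (ha : residuePart r a = a) (hu : r + s = u)
    (f : ℤ⟦X⟧) : residuePart u (a * f) = a * residuePart s f := by
  subst hu
  ext n
  rw [coeff_residuePart, coeff_mul, coeff_mul]
  have key : ∀ p ∈ Finset.HasAntidiagonal.antidiagonal n, (if (n : ZMod 5) = r + s then
      coeff p.1 a * coeff p.2 f else 0) = coeff p.1 a * coeff p.2 (residuePart s f) := by
    intro p hp
    rw [Finset.HasAntidiagonal.mem_antidiagonal] at hp
    by_cases hr : (p.1 : ZMod 5) = r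
    · have : (n : ZMod 5) = r + s ↔ (p.2 : ZMod 5) = s := by
        rw [← hp, Nat.cast_add, hr, add_right_inj]
      rw [coeff_residuePart, mul_ite, mul_zero]
      simp only [this]
    · rw [residuePart_eq_self_iff.1 ha _ hr]
      simp
  rw [← Finset.sum_congr rfl key]
  split_ifs <;> simp

theorem residuePart_mul_self {r s u : ZMod 5} {a b : ℤ⟦X⟧} (ha : residuePart r a = a)
    (hb : residuePart s b = b) (hu : r + s = u) : residuePart u (a * b) = a * b := by
  rw [residuePart_mul ha hu, hb]

theorem residuePart_pow_self {r u : ZMod 5} {a : ℤ⟦X⟧} (ha : residuePart r a = a) (k : ℕ)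
    (hu : k * r = u) : residuePart u (a ^ k) = a ^ k := by
  subst hu
  induction k with
  | zero =>
    rw [residuePart_eq_self_iff]
    intro n hn
    rw [pow_zero, coeff_one, if_neg]
    rintro rfl
    simp at hn
  | succ k ih =>
    rw [pow_succ]
    exact residuePart_mul_self ih ha (by push_cast; ring)

theorem residuePart_expand (f : ℤ⟦X⟧) :
    residuePart 0 (expand 5 (by norm_num) f) = expand 5 (by norm_num) f := by
  rw [residuePart_eq_self_iff]
  intro n hn
  apply coeff_expand_of_not_dvd
  rwa [← ZMod.natCast_eq_zero_iff]

theorem residuePart_X : residuePart 1 (X : ℤ⟦X⟧) = X := by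
  rw [residuePart_eq_self_iff]
  intro n hn
  rw [coeff_X, if_neg]
  rintro rfl
  simp at hn

theorem sum_residuePart (f : ℤ⟦X⟧) : f = residuePart 0 f + residuePart 1 f + residuePart 2 f +
    residuePart 3 f + residuePart 4 f := by
  ext n
  simp only [map_add, coeff_residuePart]
  have : ∀ z : ZMod 5, z = 0 ∨ z = 1 ∨ z = 2 ∨ z = 3 ∨ z = 4 := by decide
  rcases this n with h | h | h | h | h <;> simp +decide [h]

theorem expand_twentyFive (f : ℤ⟦X⟧) :
    expand 5 (by norm_num) (expand 5 (by norm_num) f) = expand 25 (by norm_num) f := by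
  rw [← expand_mul]

theorem two_mul_pentagonal_zmod (k : ℤ) :
    2 * ((pentagonal k : ℕ) : ZMod 5) = k * (3 * k - 1) := by
  have h := congrArg (Int.cast : ℤ → ZMod 5) (two_mul_natCast_pentagonal k)
  push_cast at h
  exact h

theorem residuePart_pentagonalSeries_of_two_lt {r : ZMod 5} (hr : r = 3 ∨ r = 4) :
    residuePart r (pentagonalSeries ℤ) = 0 := by
  ext n
  rw [coeff_residuePart, map_zero]
  split_ifs with hn
  · apply coeff_pentagonalSeries_eq_zero
    rintro ⟨k, rfl⟩
    have h := two_mul_pentagonal_zmod k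
    rw [hn] at h
    generalize (k : ZMod 5) = z at h
    rcases hr with rfl | rfl <;> revert z <;> decide
  · rfl

theorem residuePart_one_pentagonalSeries :
    residuePart 1 (pentagonalSeries ℤ) =
      -(X * expand 25 (by norm_num) (pentagonalSeries ℤ)) := by
  have hpent : ∀ j : ℤ, pentagonal (5 * j + 1) = 25 * pentagonal (-j) + 1 := by
    intro j
    have h1 := two_mul_natCast_pentagonal (5 * j + 1)
    have h2 := two_mul_natCast_pentagonal (-j)
    zify
    linarith
  have hsign : ∀ j : ℤ, ((Int.negOnePow (5 * j + 1) : ℤˣ) : ℤ) =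
      -((Int.negOnePow (-j) : ℤˣ) : ℤ) := by
    intro j
    rw [Int.negOnePow_succ, Int.negOnePow_neg, show 5 * j = j + 2 * (2 * j) by ring,
      Int.negOnePow_add, Int.negOnePow_two_mul]
    simp
  ext n
  rw [coeff_residuePart, map_neg]
  cases n with
  | zero =>
    rw [if_neg (by decide), coeff_zero_X_mul, neg_zero]
  | succ n =>
    rw [coeff_succ_X_mul, coeff_expand]
    by_cases hd : 25 ∣ n
    · obtain ⟨m, rfl⟩ := hd
      have : ((25 * m + 1 : ℕ) : ZMod 5) = 1 := by
        push_cast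
        rw [show (25 : ZMod 5) = 0 by decide]
        ring
      rw [if_pos this, if_pos (dvd_mul_right _ _), Nat.mul_div_cancel_left _ (by norm_num)]
      by_cases hm : m ∈ Set.range pentagonal
      · obtain ⟨j, rfl⟩ := hm
        have h1 := hpent (-j)
        rw [neg_neg] at h1
        rw [← h1, coeff_pentagonalSeries_pentagonal, coeff_pentagonalSeries_pentagonal]
        have := hsign (-j)
        rw [neg_neg] at this
        exact this
      · rw [coeff_pentagonalSeries_eq_zero ℤ hm, neg_zero]
        apply coeff_pentagonalSeries_eq_zero
        rintro ⟨k, hk⟩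
        have h := two_mul_pentagonal_zmod k
        rw [hk, this] at h
        have hk1 : ((k - 1 : ℤ) : ZMod 5) = 0 := by
          push_cast
          generalize (k : ZMod 5) = z at h
          revert z
          decide
        obtain ⟨j, hj⟩ := (ZMod.intCast_zmod_eq_zero_iff_dvd _ 5).1 hk1
        have hj' : k = 5 * j + 1 := by push_cast at hj; omega
        rw [hj', hpent] at hk
        exact hm ⟨-j, by omega⟩
    · rw [if_neg hd, neg_zero]
      split_ifs with hn
      · apply coeff_pentagonalSeries_eq_zero
        rintro ⟨k, hk⟩
        have h := two_mul_pentagonal_zmod k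
        rw [hk, hn] at h
        have hk1 : ((k - 1 : ℤ) : ZMod 5) = 0 := by
          push_cast
          generalize (k : ZMod 5) = z at h
          revert z
          decide
        obtain ⟨j, hj⟩ := (ZMod.intCast_zmod_eq_zero_iff_dvd _ 5).1 hk1
        have hj' : k = 5 * j + 1 := by push_cast at hj; omega
        rw [hj', hpent] at hk
        exact hd ⟨pentagonal (-j), by omega⟩
      · rfl

/-- The `5`-dissection of Euler's function. -/
theorem exists_dissection : ∃ a c : ℤ⟦X⟧,
    residuePart 0 a = a ∧ residuePart 2 c = c ∧
    a * c = -(X * expand 25 (by norm_num) (pentagonalSeries ℤ)) ^ 2 ∧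
    pentagonalSeries ℤ = a - X * expand 25 (by norm_num) (pentagonalSeries ℤ) + c := by
  set y : ℤ⟦X⟧ := X * expand 25 (by norm_num) (pentagonalSeries ℤ) with hy
  have h1 := residuePart_one_pentagonalSeries
  rw [← hy] at h1
  have hs := sum_residuePart (pentagonalSeries ℤ)
  rw [h1, residuePart_pentagonalSeries_of_two_lt (Or.inl rfl),
    residuePart_pentagonalSeries_of_two_lt (Or.inr rfl)] at hs
  have ha := residuePart_residuePart 0 (pentagonalSeries ℤ)
  have hc := residuePart_residuePart 2 (pentagonalSeries ℤ)
  have hy1 : residuePart 1 y = y := by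
    have := residuePart_residuePart 1 (pentagonalSeries ℤ)
    rwa [h1, map_neg, neg_inj] at this
  have ha0 : residuePart 0 (pentagonalSeries ℤ) ≠ 0 := by
    intro h
    have := congrArg (coeff 0) h
    rw [coeff_residuePart, coeff_zero_eq_constantCoeff, constantCoeff_pentagonalSeries] at this
    simp at this
  set a := residuePart 0 (pentagonalSeries ℤ) with hadef
  set c := residuePart 2 (pentagonalSeries ℤ) with hcdef
  refine ⟨a, c, ha, hc, ?_, by rw [hs]; ring⟩
  have hcube : residuePart 2 (pentagonalSeries ℤ ^ 3) = 0 := by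
    ext n
    rw [coeff_residuePart, map_zero]
    split_ifs with hn
    · apply coeff_pentagonalSeries_cube_eq_zero
      left
      exact (ZMod.natCast_eq_natCast_iff' n 2 5).1 hn
    · rfl
  have hexp : pentagonalSeries ℤ ^ 3 = a ^ 3 + 3 • (a ^ 2 * c) + 3 • (a * c ^ 2) + c ^ 3
      - 3 • (a ^ 2 * y) - 6 • (a * c * y) - 3 • (c ^ 2 * y) + 3 • (a * y ^ 2) + 3 • (c * y ^ 2)
      - y ^ 3 := by
    rw [hs]
    simp only [nsmul_eq_mul]
    push_cast
    ring
  have m {i j k : ℕ} {r : ZMod 5} (hr : (j : ZMod 5) * 1 + k * 2 = r) :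
      residuePart r (a ^ i * y ^ j * c ^ k) = a ^ i * y ^ j * c ^ k :=
    residuePart_mul_self (residuePart_mul_self (residuePart_pow_self ha i rfl)
      (residuePart_pow_self hy1 j rfl) rfl) (residuePart_pow_self hc k rfl)
      (by rw [mul_zero, zero_add]; exact hr)
  have e1 : residuePart 2 (a ^ 3) = 0 := by
    simpa using residuePart_of_ne (m (i := 3) (j := 0) (k := 0) rfl) (s := 2) (by decide)
  have e2 : residuePart 2 (a ^ 2 * c) = a ^ 2 * c := by
    simpa using m (i := 2) (j := 0) (k := 1) (r := 2) (by decide)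
  have e3 : residuePart 2 (a * c ^ 2) = 0 := by
    simpa using residuePart_of_ne (m (i := 1) (j := 0) (k := 2) rfl) (s := 2) (by decide)
  have e4 : residuePart 2 (c ^ 3) = 0 := by
    simpa using residuePart_of_ne (m (i := 0) (j := 0) (k := 3) rfl) (s := 2) (by decide)
  have e5 : residuePart 2 (a ^ 2 * y) = 0 := by
    simpa using residuePart_of_ne (m (i := 2) (j := 1) (k := 0) rfl) (s := 2) (by decide)
  have e6 : residuePart 2 (a * c * y) = 0 := by
    simpa [mul_right_comm] using
      residuePart_of_ne (m (i := 1) (j := 1) (k := 1) rfl) (s := 2) (by decide)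
  have e7 : residuePart 2 (c ^ 2 * y) = 0 := by
    simpa [mul_comm] using
      residuePart_of_ne (m (i := 0) (j := 1) (k := 2) rfl) (s := 2) (by decide)
  have e8 : residuePart 2 (a * y ^ 2) = a * y ^ 2 := by
    simpa using m (i := 1) (j := 2) (k := 0) (r := 2) (by decide)
  have e9 : residuePart 2 (c * y ^ 2) = 0 := by
    simpa [mul_comm] using
      residuePart_of_ne (m (i := 0) (j := 2) (k := 1) rfl) (s := 2) (by decide)
  have e10 : residuePart 2 (y ^ 3) = 0 := by
    simpa using residuePart_of_ne (m (i := 0) (j := 3) (k := 0) rfl) (s := 2) (by decide)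
  rw [hexp] at hcube
  simp only [map_add, map_sub, map_nsmul, e1, e2, e3, e4, e5, e6, e7, e8, e9, e10] at hcube
  have h3 : (3 : ℤ⟦X⟧) * a * (a * c + y ^ 2) = 0 := by
    simp only [nsmul_eq_mul] at hcube
    push_cast at hcube
    linear_combination hcube
  have h30 : (3 : ℤ⟦X⟧) ≠ 0 := by
    intro h
    have := congrArg constantCoeff h
    rw [map_ofNat, map_zero] at this
    norm_num at this
  rcases mul_eq_zero.1 h3 with h | h
  · exact absurd h (mul_ne_zero h30 ha0)
  · linear_combination h

/-- The ring homomorphism `u(X) ↦ u(w X)` into complex power series. -/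
noncomputable def twist (w : ℂ) : ℤ⟦X⟧ →+* ℂ⟦X⟧ :=
  (rescale w).comp (PowerSeries.map (Int.castRingHom ℂ))

theorem twist_X (w : ℂ) : twist w X = C w * X := by
  simp [twist, rescale_X]

theorem X_pow_dvd_twist {K : ℕ} {u : ℤ⟦X⟧} (w : ℂ) (h : X ^ K ∣ u) : X ^ K ∣ twist w u := by
  obtain ⟨v, rfl⟩ := h
  rw [map_mul, map_pow, twist_X, mul_pow, mul_right_comm]
  exact dvd_mul_left _ _

theorem twist_of_residuePart {w : ℂ} (hw : w ^ 5 = 1) (r : ℕ) {u : ℤ⟦X⟧}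
    (hu : residuePart (r : ZMod 5) u = u) : twist w u = C (w ^ r) * twist 1 u := by
  ext n
  simp only [twist, RingHom.comp_apply, coeff_C_mul, coeff_rescale, coeff_map, one_pow, one_mul]
  by_cases hn : (n : ZMod 5) = r
  · have h5 : n % 5 = r % 5 := (ZMod.natCast_eq_natCast_iff' n r 5).1 hn
    rw [pow_eq_pow_mod n hw, pow_eq_pow_mod r hw, h5]
  · rw [residuePart_eq_self_iff.1 hu n hn]
    simp

theorem twist_injective : Function.Injective (twist 1) := by
  have : twist 1 = PowerSeries.map (Int.castRingHom ℂ) := by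
    simp [twist]
  rw [this]
  exact PowerSeries.map_injective _ Int.cast_injective

theorem prod_linear_eq {R : Type*} [CommRing R] {w : R} (hw : w ^ 4 + w ^ 3 + w ^ 2 + w + 1 = 0)
    (a b c : R) :
    ∏ j ∈ Finset.range 5, (a + w ^ j * b + (w ^ j) ^ 2 * c) =
      a ^ 5 + b ^ 5 + c ^ 5 - 5 * (a * b ^ 3 * c) + 5 * (a ^ 2 * b * c ^ 2) := by
  have h5 : w ^ 5 = 1 := by linear_combination (w - 1) * hw
  obtain ⟨s, hs⟩ : ∃ s, s = w + w ^ 4 := ⟨_, rfl⟩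
  obtain ⟨t, ht⟩ : ∃ t, t = w ^ 2 + w ^ 3 := ⟨_, rfl⟩
  have hst : s + t = -1 := by rw [hs, ht]; linear_combination hw
  have hst' : s * t = -1 := by rw [hs, ht]; linear_combination hw + (w + w ^ 2) * h5
  have p1 : (a + w * b + w ^ 2 * c) * (a + w ^ 4 * b + w ^ 8 * c) =
      a ^ 2 + b ^ 2 + c ^ 2 + s * (a * b + b * c) + t * (a * c) := by
    rw [hs, ht]
    linear_combination (b ^ 2 + c ^ 2 * (w ^ 5 + 1) + w ^ 4 * b * c + w * b * c
      + w ^ 3 * a * c) * h5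
  have p2 : (a + w ^ 2 * b + w ^ 4 * c) * (a + w ^ 3 * b + w ^ 6 * c) =
      a ^ 2 + b ^ 2 + c ^ 2 + t * (a * b + b * c) + s * (a * c) := by
    rw [hs, ht]
    linear_combination (b ^ 2 + c ^ 2 * (w ^ 5 + 1) + w ^ 3 * b * c + w ^ 2 * b * c
      + w * a * c) * h5
  simp only [Finset.prod_range_succ, Finset.prod_range_zero]
  have : 1 * (a + w ^ 0 * b + (w ^ 0) ^ 2 * c) * (a + w ^ 1 * b + (w ^ 1) ^ 2 * c) *
      (a + w ^ 2 * b + (w ^ 2) ^ 2 * c) * (a + w ^ 3 * b + (w ^ 3) ^ 2 * c) *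
      (a + w ^ 4 * b + (w ^ 4) ^ 2 * c) = (a + b + c) *
      ((a + w * b + w ^ 2 * c) * (a + w ^ 4 * b + w ^ 8 * c)) *
      ((a + w ^ 2 * b + w ^ 4 * c) * (a + w ^ 3 * b + w ^ 6 * c)) := by ring
  rw [this, p1, p2]
  have hts : t = -1 - s := by linear_combination hst
  subst hts
  linear_combination (a + b + c) * ((a * b + b * c) ^ 2 + (a * c) ^ 2
    - 2 * (a * b + b * c) * (a * c)) * hst'

theorem prod_twist_one_sub {w : ℂ} (hw : w ^ 4 + w ^ 3 + w ^ 2 + w + 1 = 0) (n : ℕ) :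
    ∏ j ∈ Finset.range 5, twist (w ^ j) (1 - X ^ n) =
      if 5 ∣ n then (1 - X ^ n) ^ 5 else 1 - X ^ (5 * n) := by
  have h5 : w ^ 5 = 1 := by linear_combination (w - 1) * hw
  have e : ∀ j, twist (w ^ j) (1 - X ^ n) = 1 + C (w ^ n) ^ j * (-X ^ n) + (C (w ^ n) ^ j) ^ 2 * 0 := by
    intro j
    rw [map_sub, map_one, map_pow, twist_X, mul_pow, ← map_pow, ← map_pow, ← pow_mul, ← pow_mul,
      mul_comm n j]
    ring
  rw [Finset.prod_congr rfl fun j _ => e j]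
  split_ifs with h
  · obtain ⟨k, rfl⟩ := h
    simp only [pow_mul w, h5, one_pow, map_one, one_mul, mul_zero, add_zero, ← sub_eq_add_neg]
    simp
  · have hn : (w ^ n) ^ 4 + (w ^ n) ^ 3 + (w ^ n) ^ 2 + w ^ n + 1 = 0 := by
      rw [pow_eq_pow_mod n h5]
      have : n % 5 = 1 ∨ n % 5 = 2 ∨ n % 5 = 3 ∨ n % 5 = 4 := by omega
      rcases this with h | h | h | h <;> rw [h]
      · linear_combination hw
      · linear_combination hw + (w ^ 3 + w) * h5
      · linear_combination hw + (w ^ 7 + w ^ 4 + w ^ 2 + w) * h5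
      · linear_combination hw + (w ^ 11 + w ^ 7 + w ^ 6 + w ^ 3 + w ^ 2 + w) * h5
    have hC : C (w ^ n) ^ 4 + C (w ^ n) ^ 3 + C (w ^ n) ^ 2 + C (w ^ n) + 1 = (0 : ℂ⟦X⟧) := by
      simp only [← map_pow, ← map_add, ← map_one (C (R := ℂ)), hn, map_zero]
    rw [prod_linear_eq hC]
    ring

theorem prod_twist_qPoch {w : ℂ} (hw : w ^ 4 + w ^ 3 + w ^ 2 + w + 1 = 0) (K : ℕ) :
    (∏ j ∈ Finset.range 5, twist (w ^ j) (qPoch X (5 * K))) * qPoch (X ^ 25) K =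
      qPoch (X ^ 5) (5 * K) * qPoch (X ^ 5) K ^ 5 := by
  induction K with
  | zero => simp [qPoch]
  | succ K ih =>
    have d (i : ℕ) (hi : ¬ 5 ∣ i) := (prod_twist_one_sub hw (5 * K + i)).trans (if_neg (by omega))
    have d5 := (prod_twist_one_sub hw (5 * K + 4 + 1)).trans (if_pos (by omega))
    rw [show 5 * (K + 1) = 5 * K + 4 + 1 by ring]
    simp only [qPoch_succ, map_mul, Finset.prod_mul_distrib]
    rw [d5, d 1 (by decide), d 2 (by decide), d 3 (by decide), d 4 (by decide)]
    linear_combination (1 - X ^ (5 * (5 * K + 1))) * (1 - X ^ (5 * (5 * K + 2)))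
      * (1 - X ^ (5 * (5 * K + 3))) * (1 - X ^ (5 * (5 * K + 4)))
      * (1 - X ^ (5 * K + 5)) ^ 5 * (1 - X ^ (25 * (K + 1))) * ih

theorem X_pow_dvd_expand {K m : ℕ} (hm : m ≠ 0) {u : ℤ⟦X⟧} (h : X ^ K ∣ u) :
    X ^ K ∣ expand m hm u := by
  obtain ⟨v, rfl⟩ := h
  rw [map_mul, map_pow, expand_X, ← pow_mul]
  exact (pow_dvd_pow _ (Nat.le_mul_of_pos_left _ (Nat.pos_of_ne_zero hm))).mul_right _

theorem prod_twist_pentagonalSeries {w : ℂ} (hw : w ^ 4 + w ^ 3 + w ^ 2 + w + 1 = 0) :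
    (∏ j ∈ Finset.range 5, twist (w ^ j) (pentagonalSeries ℤ)) *
      twist 1 (expand 25 (by norm_num) (pentagonalSeries ℤ)) =
      twist 1 (expand 5 (by norm_num) (pentagonalSeries ℤ)) ^ 6 := by
  rw [← sub_eq_zero]
  ext K
  rw [map_zero]
  refine X_pow_dvd_iff.1 (?_ : X ^ (K + 1) ∣ _) K (Nat.lt_succ_self K)
  rw [← Ideal.mem_span_singleton, ← Ideal.Quotient.eq]
  set π := Ideal.Quotient.mk (Ideal.span {(X : ℂ⟦X⟧) ^ (K + 1)}) with hπ
  have c {n : ℕ} (w : ℂ) (h : K + 1 ≤ n) : π (twist w (pentagonalSeries ℤ)) =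
      π (twist w (qPoch X n)) := by
    rw [eq_comm, Ideal.Quotient.eq, Ideal.mem_span_singleton, ← map_sub]
    exact X_pow_dvd_twist w (X_pow_dvd_qPoch_sub h)
  have c' {n : ℕ} (m : ℕ) (hm : m ≠ 0) (h : K + 1 ≤ n) :
      π (twist 1 (expand m hm (pentagonalSeries ℤ))) = π (qPoch (X ^ m) n) := by
    have : qPoch (X ^ m) n = twist 1 (expand m hm (qPoch X n)) := by
      have := map_qPoch ((twist 1).comp (expand m hm (R := ℤ)).toRingHom) X n
      simp only [RingHom.comp_apply, AlgHom.toRingHom_eq_coe, RingHom.coe_coe, expand_X, map_pow,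
        twist_X, map_one, one_mul] at this
      exact this.symm
    rw [this, eq_comm, Ideal.Quotient.eq, Ideal.mem_span_singleton, ← map_sub, ← map_sub]
    exact X_pow_dvd_twist 1 (X_pow_dvd_expand hm (X_pow_dvd_qPoch_sub h))
  have := congrArg π (prod_twist_qPoch hw (K + 1))
  simp only [map_mul, map_prod, map_pow] at this ⊢
  rw [c' 25 _ le_rfl, Finset.prod_congr rfl fun j _ => c (w ^ j) (by omega : K + 1 ≤ 5 * (K + 1)),
    this, ← c' 5 (by norm_num) (by omega), ← c' 5 (by norm_num) le_rfl]
  ring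

/-- The data extracted from the `5`-dissection of Euler's function `f`: the norm `τ` of `f` over
the series in `X ^ 5`, the degree five equation of `f`, and residue parts of small powers. -/
theorem exists_norm {f y : ℤ⟦X⟧} (hf : f = pentagonalSeries ℤ)
    (hy : y = X * expand 25 (by norm_num) (pentagonalSeries ℤ)) : ∃ τ : ℤ⟦X⟧,
    residuePart 0 τ = τ ∧ residuePart 1 y = y ∧
    expand 25 (by norm_num) (pentagonalSeries ℤ) * τ =
      expand 5 (by norm_num) (pentagonalSeries ℤ) ^ 6 ∧
    f ^ 5 + 5 * y * f ^ 4 + 15 * y ^ 2 * f ^ 3 + 25 * y ^ 3 * f ^ 2 + 25 * y ^ 4 * f = τ ∧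
    residuePart 1 f = -y ∧ residuePart 2 (f ^ 2) = -y ^ 2 ∧ residuePart 3 (f ^ 3) = 5 * y ^ 3 ∧
    residuePart 4 (f ^ 4) = -5 * y ^ 4 := by
  obtain ⟨a, c, ha, hc, hac, hfd⟩ := exists_dissection
  rw [← hy] at hac hfd
  rw [← hf] at hfd
  have hy1 : residuePart 1 y = y := by
    rw [hy]
    exact residuePart_mul_self residuePart_X
      (by rw [← expand_twentyFive]; exact residuePart_expand _) (by decide)
  have m (i j k : ℕ) (r : ZMod 5) : residuePart r (a ^ i * y ^ j * c ^ k) =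
      if (j : ZMod 5) + k * 2 = r then a ^ i * y ^ j * c ^ k else 0 := by
    have h : residuePart ((j : ZMod 5) + k * 2) (a ^ i * y ^ j * c ^ k) = a ^ i * y ^ j * c ^ k :=
      residuePart_mul_self (residuePart_mul_self (residuePart_pow_self ha i rfl)
        (residuePart_pow_self hy1 j rfl) rfl) (residuePart_pow_self hc k rfl)
        (by ring)
    split_ifs with hr
    · rw [← hr, h]
    · exact residuePart_of_ne h (Ne.symm hr)
  refine ⟨a ^ 5 + c ^ 5 - 11 * y ^ 5, ?_, hy1, ?_, ?_, ?_, ?_, ?_, ?_⟩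
  · have e : a ^ 5 + c ^ 5 - 11 * y ^ 5 = a ^ 5 * y ^ 0 * c ^ 0 + a ^ 0 * y ^ 0 * c ^ 5
        - 11 • (a ^ 0 * y ^ 5 * c ^ 0) := by simp
    rw [e, map_sub, map_add, map_nsmul, m, m, m]
    rw [if_pos (by decide), if_pos (by decide), if_pos (by decide)]
  · obtain ⟨w, hw⟩ : ∃ w : ℂ, w ^ 4 + w ^ 3 + w ^ 2 + w + 1 = 0 := by
      have h := (Complex.isPrimitiveRoot_exp 5 (by norm_num)).geom_sum_eq_zero (by norm_num)
      simp only [Finset.sum_range_succ, Finset.sum_range_zero] at h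
      exact ⟨_, by linear_combination h⟩
    have h5 : w ^ 5 = 1 := by linear_combination (w - 1) * hw
    have hN := prod_twist_pentagonalSeries hw
    have e : ∀ j, twist (w ^ j) f = twist 1 a + C w ^ j * (-twist 1 y) + (C w ^ j) ^ 2 * twist 1 c := by
      intro j
      have hj : (w ^ j) ^ 5 = 1 := by rw [pow_right_comm, h5, one_pow]
      rw [hfd, map_add, map_sub, twist_of_residuePart hj 0 (by simpa using ha),
        twist_of_residuePart hj 1 (by simpa using hy1),
        twist_of_residuePart hj 2 (by simpa using hc)]
      simp only [map_pow, pow_zero, pow_one, map_one]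
      ring
    have hC : C w ^ 4 + C w ^ 3 + C w ^ 2 + C w + 1 = (0 : ℂ⟦X⟧) := by
      simp only [← map_pow, ← map_add, ← map_one (C (R := ℂ)), hw, map_zero]
    rw [← hf, Finset.prod_congr rfl fun j _ => e j, prod_linear_eq hC] at hN
    apply twist_injective
    rw [hf] at hN
    have hac' := congrArg (twist 1) hac
    simp only [map_mul, map_pow, map_sub, map_add, map_neg, map_ofNat] at hN hac' ⊢
    rw [← hN]
    linear_combination -(twist 1 (expand 25 (by norm_num) (pentagonalSeries ℤ))) *
      (5 * twist 1 y ^ 3 - 5 * twist 1 y * (twist 1 a * twist 1 c - twist 1 y ^ 2)) * hac'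
  · rw [hfd]
    grind
  · rw [hf, hy]; exact residuePart_one_pentagonalSeries
  · have e : f ^ 2 = a ^ 2 * y ^ 0 * c ^ 0 + a ^ 0 * y ^ 2 * c ^ 0 + a ^ 0 * y ^ 0 * c ^ 2
      - 2 • (a ^ 1 * y ^ 1 * c ^ 0) - 2 • (a ^ 0 * y ^ 1 * c ^ 1)
      + 2 • (a ^ 1 * y ^ 0 * c ^ 1) := by
      rw [hfd]; simp only [nsmul_eq_mul]; push_cast; ring
    rw [e]
    simp +decide only [map_add, map_sub, map_nsmul, m, if_true, if_false]
    simp only [nsmul_eq_mul]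
    push_cast
    linear_combination 2 * hac
  · have e : f ^ 3 = a ^ 3 * y ^ 0 * c ^ 0 - a ^ 0 * y ^ 3 * c ^ 0 + a ^ 0 * y ^ 0 * c ^ 3
      - 3 • (a ^ 2 * y ^ 1 * c ^ 0) + 3 • (a ^ 2 * y ^ 0 * c ^ 1) + 3 • (a ^ 1 * y ^ 2 * c ^ 0)
      + 3 • (a ^ 0 * y ^ 2 * c ^ 1) + 3 • (a ^ 1 * y ^ 0 * c ^ 2) - 3 • (a ^ 0 * y ^ 1 * c ^ 2)
      - 6 • (a ^ 1 * y ^ 1 * c ^ 1) := by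
      rw [hfd]; simp only [nsmul_eq_mul]; push_cast; ring
    rw [e]
    simp +decide only [map_add, map_sub, map_nsmul, m, if_true, if_false]
    simp only [nsmul_eq_mul]
    push_cast
    linear_combination -6 * y * hac
  · have e : f ^ 4 = a ^ 4 * y ^ 0 * c ^ 0 + a ^ 0 * y ^ 4 * c ^ 0 + a ^ 0 * y ^ 0 * c ^ 4
      - 4 • (a ^ 3 * y ^ 1 * c ^ 0) + 4 • (a ^ 3 * y ^ 0 * c ^ 1)
      - 4 • (a ^ 1 * y ^ 3 * c ^ 0) - 4 • (a ^ 0 * y ^ 3 * c ^ 1)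
      + 4 • (a ^ 1 * y ^ 0 * c ^ 3) - 4 • (a ^ 0 * y ^ 1 * c ^ 3)
      + 6 • (a ^ 2 * y ^ 2 * c ^ 0) + 6 • (a ^ 2 * y ^ 0 * c ^ 2) + 6 • (a ^ 0 * y ^ 2 * c ^ 2)
      - 12 • (a ^ 2 * y ^ 1 * c ^ 1) + 12 • (a ^ 1 * y ^ 2 * c ^ 1)
      - 12 • (a ^ 1 * y ^ 1 * c ^ 2) := by
      rw [hfd]; simp only [nsmul_eq_mul]; push_cast; ring
    rw [e]
    simp +decide only [map_add, map_sub, map_nsmul, m, if_true, if_false]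
    simp only [nsmul_eq_mul]
    push_cast
    linear_combination (12 * y ^ 2 + 6 * (a * c - y ^ 2)) * hac

/-- Residue parts of a solution of the degree five linear recurrence. -/
theorem residuePart_recurrence {y τ : ℤ⟦X⟧} (hy : residuePart 1 y = y) (hτ : residuePart 0 τ = τ)
    {u0 u1 u2 u3 u4 u5 : ℤ⟦X⟧}
    (h : u5 + 5 * y * u4 + 15 * y ^ 2 * u3 + 25 * y ^ 3 * u2 + 25 * y ^ 4 * u1 = τ * u0)
    (r : ZMod 5) : residuePart r u5 + 5 * y * residuePart (r + 4) u4 +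
      15 * y ^ 2 * residuePart (r + 3) u3 + 25 * y ^ 3 * residuePart (r + 2) u2 +
      25 * y ^ 4 * residuePart (r + 1) u1 = τ * residuePart r u0 := by
  have p (j : ℕ) (s : ZMod 5) (hs : (j : ZMod 5) + s = r) (u : ℤ⟦X⟧) (n : ℕ) :
      residuePart r (n • (y ^ j * u)) = n • (y ^ j * residuePart s u) := by
    rw [map_nsmul, residuePart_mul (residuePart_pow_self hy j rfl) (by rw [mul_one, hs])]
  have e : τ * u0 = u5 + 5 • (y ^ 1 * u4) + 15 • (y ^ 2 * u3) + 25 • (y ^ 3 * u2) +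
      25 • (y ^ 4 * u1) := by
    rw [← h]; simp only [nsmul_eq_mul]; push_cast; ring
  have hr : ∀ (r : ZMod 5), ((1 : ℕ) : ZMod 5) + (r + 4) = r ∧ ((2 : ℕ) : ZMod 5) + (r + 3) = r ∧
    ((3 : ℕ) : ZMod 5) + (r + 2) = r ∧ ((4 : ℕ) : ZMod 5) + (r + 1) = r := by decide
  obtain ⟨h1, h2, h3, h4⟩ := hr r
  rw [← residuePart_mul hτ (zero_add r), e]
  simp only [map_add, p 1 (r + 4) h1, p 2 (r + 3) h2, p 3 (r + 2) h3, p 4 (r + 1) h4]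
  simp only [nsmul_eq_mul]
  push_cast
  ring

theorem residuePart_one : residuePart 0 (1 : ℤ⟦X⟧) = 1 := by
  rw [residuePart_eq_self_iff]
  intro n hn
  rw [coeff_one, if_neg]
  rintro rfl
  simp at hn

theorem residuePart_pow_pentagonalSeries {f y : ℤ⟦X⟧} (hf : f = pentagonalSeries ℤ)
    (hy : y = X * expand 25 (by norm_num) (pentagonalSeries ℤ)) :
    residuePart 3 (f ^ 8) = -125 * y ^ 8 ∧ residuePart 4 (f ^ 14) = -15625 * y ^ 14 := by
  obtain ⟨τ, hτ, hy1, -, hrec, v1, v2, v3, v4⟩ := exists_norm hf hy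
  have v0 : residuePart 0 (f ^ 0) = 1 := by rw [pow_zero, residuePart_one]
  rw [← pow_one f] at v1
  have step (k : ℕ) := residuePart_recurrence hy1 hτ (u0 := f ^ k) (u1 := f ^ (k + 1))
    (u2 := f ^ (k + 2)) (u3 := f ^ (k + 3)) (u4 := f ^ (k + 4)) (u5 := f ^ (k + 5))
    (by rw [← hrec]; ring) (k : ZMod 5)
  have e : ((0 : ℕ) : ZMod 5) = 0 ∧ ((1 : ℕ) : ZMod 5) = 1 ∧ ((2 : ℕ) : ZMod 5) = 2 ∧
    ((3 : ℕ) : ZMod 5) = 3 ∧ ((4 : ℕ) : ZMod 5) = 4 ∧ ((5 : ℕ) : ZMod 5) = 0 ∧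
    ((6 : ℕ) : ZMod 5) = 1 ∧ ((7 : ℕ) : ZMod 5) = 2 ∧ ((8 : ℕ) : ZMod 5) = 3 ∧
    ((9 : ℕ) : ZMod 5) = 4 := by decide
  have a : (1 + 4 = (0 : ZMod 5) ∧ (1 + 3 : ZMod 5) = 4 ∧ (1 + 2 : ZMod 5) = 3 ∧
    (1 + 1 : ZMod 5) = 2 ∧ (2 + 4 : ZMod 5) = 1 ∧ (2 + 3 : ZMod 5) = 0 ∧ (2 + 2 : ZMod 5) = 4 ∧
    (2 + 1 : ZMod 5) = 3 ∧ (3 + 4 : ZMod 5) = 2 ∧ (3 + 3 : ZMod 5) = 1 ∧ (3 + 2 : ZMod 5) = 0 ∧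
    (3 + 1 : ZMod 5) = 4) ∧ (4 + 4 : ZMod 5) = 3 ∧ (4 + 3 : ZMod 5) = 2 ∧
    (4 + 2 : ZMod 5) = 1 ∧ (4 + 1 : ZMod 5) = 0 := by decide
  have s0 := step 0
  have s1 := step 1
  have s2 := step 2
  have s3 := step 3
  have s4 := step 4
  have s5 := step 5
  have s6 := step 6
  have s7 := step 7
  have s8 := step 8
  have s9 := step 9
  simp only [e, a, zero_add, Nat.reduceAdd] at s0 s1 s2 s3 s4 s5 s6 s7 s8 s9
  rw [v0, v1, v2, v3, v4] at s0
  have v5 : residuePart 0 (f ^ 5) = τ := by linear_combination s0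
  rw [v1, v2, v3, v4, v5] at s1
  have v6 : residuePart 1 (f ^ 6) = -6 * y * τ - 25 * y ^ 6 := by linear_combination s1
  rw [v2, v3, v4, v5, v6] at s2
  have v7 : residuePart 2 (f ^ 7) = 14 * y ^ 2 * τ + 125 * y ^ 7 := by linear_combination s2
  rw [v3, v4, v5, v6, v7] at s3
  have v8 : residuePart 3 (f ^ 8) = -125 * y ^ 8 := by linear_combination s3
  rw [v4, v5, v6, v7, v8] at s4
  have v9 : residuePart 4 (f ^ 9) = -90 * y ^ 4 * τ - 625 * y ^ 9 := by linear_combination s4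
  rw [v5, v6, v7, v8, v9] at s5
  have v10 : residuePart 0 (f ^ 10) = τ ^ 2 + 250 * y ^ 5 * τ + 2500 * y ^ 10 := by
    linear_combination s5
  rw [v6, v7, v8, v9, v10] at s6
  have v11 : residuePart 1 (f ^ 11) = -11 * y * τ ^ 2 - 275 * y ^ 6 * τ - 3125 * y ^ 11 := by
    linear_combination s6
  rw [v7, v8, v9, v10, v11] at s7
  have v12 : residuePart 2 (f ^ 12) = 54 * y ^ 2 * τ ^ 2 - 3125 * y ^ 12 := by
    linear_combination s7
  rw [v8, v9, v10, v11, v12] at s8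
  have v13 : residuePart 3 (f ^ 13) = -130 * y ^ 3 * τ ^ 2 + 15625 * y ^ 13 := by
    linear_combination s8
  rw [v9, v10, v11, v12, v13] at s9
  exact ⟨v8, by linear_combination s9⟩

theorem residuePart_inv_pow_four {f y t : ℤ⟦X⟧} {fi : ℤ⟦X⟧} (hf : f = pentagonalSeries ℤ)
    (hy : y = X * expand 25 (by norm_num) (pentagonalSeries ℤ)) (hfi : f * fi = 1)
    (ht : expand 25 (by norm_num) (pentagonalSeries ℤ) =
      expand 5 (by norm_num) (pentagonalSeries ℤ) ^ 6 * t) :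
    residuePart 1 (fi ^ 4) = 4 * y * t + 550 * y ^ 6 * t ^ 2 + 12500 * y ^ 11 * t ^ 3 +
      78125 * y ^ 16 * t ^ 4 := by
  obtain ⟨τ, hτ, hy1, hτg, hrec, v1, v2, v3, v4⟩ := exists_norm hf hy
  have htτ : t * τ = 1 := by
    have hh : expand 25 (by norm_num) (pentagonalSeries ℤ) ≠ 0 :=
      (isUnit_pentagonalSeries.map (expand 25 (by norm_num) (R := ℤ))).ne_zero
    apply mul_left_cancel₀ hh
    linear_combination t * hτg - ht
  have v0 : residuePart 0 (1 : ℤ⟦X⟧) = 1 := residuePart_one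
  have a : ((4 + 4 : ZMod 5) = 3 ∧ (4 + 3 : ZMod 5) = 2 ∧
    (4 + 2 : ZMod 5) = 1 ∧ (4 + 1 : ZMod 5) = 0) ∧ (3 + 4 : ZMod 5) = 2 ∧ (3 + 3 : ZMod 5) = 1 ∧
    (3 + 2 : ZMod 5) = 0 ∧ (3 + 1 : ZMod 5) = 4 ∧ (2 + 4 : ZMod 5) = 1 ∧ (2 + 3 : ZMod 5) = 0 ∧
    (2 + 2 : ZMod 5) = 4 ∧ (2 + 1 : ZMod 5) = 3 ∧ (1 + 4 = (0 : ZMod 5) ∧ (1 + 3 : ZMod 5) = 4 ∧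
    (1 + 2 : ZMod 5) = 3 ∧ (1 + 1 : ZMod 5) = 2) := by decide
  have s1 := residuePart_recurrence hy1 hτ (u0 := fi) (u1 := 1) (u2 := f) (u3 := f ^ 2)
    (u4 := f ^ 3) (u5 := f ^ 4) (by
      rw [← hrec]; linear_combination -(f ^ 4 + 5 * y * f ^ 3 + 15 * y ^ 2 * f ^ 2 + 25 * y ^ 3 * f
        + 25 * y ^ 4) * hfi) 4
  have s2 := residuePart_recurrence hy1 hτ (u0 := fi ^ 2) (u1 := fi) (u2 := 1) (u3 := f)
    (u4 := f ^ 2) (u5 := f ^ 3) (by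
      rw [← hrec]; linear_combination -((f ^ 4 + 5 * y * f ^ 3 + 15 * y ^ 2 * f ^ 2 + 25 * y ^ 3 * f
        + 25 * y ^ 4) * fi + f ^ 3 + 5 * y * f ^ 2 + 15 * y ^ 2 * f + 25 * y ^ 3) * hfi) 3
  have s3 := residuePart_recurrence hy1 hτ (u0 := fi ^ 3) (u1 := fi ^ 2) (u2 := fi) (u3 := 1)
    (u4 := f) (u5 := f ^ 2) (by
      rw [← hrec]; linear_combination -((f ^ 4 + 5 * y * f ^ 3 + 15 * y ^ 2 * f ^ 2 + 25 * y ^ 3 * f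
        + 25 * y ^ 4) * fi ^ 2 + (f ^ 3 + 5 * y * f ^ 2 + 15 * y ^ 2 * f + 25 * y ^ 3) * fi
        + f ^ 2 + 5 * y * f + 15 * y ^ 2) * hfi) 2
  have s4 := residuePart_recurrence hy1 hτ (u0 := fi ^ 4) (u1 := fi ^ 3) (u2 := fi ^ 2) (u3 := fi)
    (u4 := 1) (u5 := f) (by
      rw [← hrec]; linear_combination -((f ^ 4 + 5 * y * f ^ 3 + 15 * y ^ 2 * f ^ 2 + 25 * y ^ 3 * f
        + 25 * y ^ 4) * fi ^ 3 + (f ^ 3 + 5 * y * f ^ 2 + 15 * y ^ 2 * f + 25 * y ^ 3) * fi ^ 2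
        + (f ^ 2 + 5 * y * f + 15 * y ^ 2) * fi + f + 5 * y) * hfi) 1
  simp only [a] at s1 s2 s3 s4
  rw [v0, v1, v2, v3, v4] at s1
  have w1 : residuePart 4 fi = 5 * y ^ 4 * t := by
    linear_combination -t * s1 - residuePart 4 fi * htτ
  rw [v0, v1, v2, v3, w1] at s2
  have w2 : residuePart 3 (fi ^ 2) = 10 * y ^ 3 * t + 125 * y ^ 8 * t ^ 2 := by
    linear_combination -t * s2 - residuePart 3 (fi ^ 2) * htτ
  rw [v0, v1, v2, w1, w2] at s3
  have w3 : residuePart 2 (fi ^ 3) = 9 * y ^ 2 * t + 375 * y ^ 7 * t ^ 2 + 3125 * y ^ 12 * t ^ 3 := by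
    linear_combination -t * s3 - residuePart 2 (fi ^ 3) * htτ
  rw [v0, v1, w1, w2, w3] at s4
  linear_combination -t * s4 - residuePart 1 (fi ^ 4) * htτ

theorem coeff_eq_coeff_residuePart {n : ℕ} {r : ZMod 5} (h : (n : ZMod 5) = r) (u : ℤ⟦X⟧) :
    coeff n u = coeff n (residuePart r u) := by
  rw [coeff_residuePart, if_pos h]

theorem natCast_five_mul_add (m k : ℕ) : ((5 * m + k : ℕ) : ZMod 5) = k := by
  push_cast
  rw [show (5 : ZMod 5) = 0 by decide]
  ring

theorem dvd_coeff_pow_mul_inv_pow {fi : ℤ⟦X⟧} (hfi : pentagonalSeries ℤ * fi = 1) (m : ℕ) :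
    15625 ∣ coeff (125 * m + 121) (expand 5 (by norm_num) (pentagonalSeries ℤ) ^ 20 * fi ^ 4) := by
  obtain ⟨f, hf⟩ : ∃ f, f = pentagonalSeries ℤ := ⟨_, rfl⟩
  obtain ⟨g, hg⟩ : ∃ g, g = expand 5 (by norm_num) (pentagonalSeries ℤ) := ⟨_, rfl⟩
  obtain ⟨h, hh⟩ : ∃ h, h = expand 25 (by norm_num) (pentagonalSeries ℤ) := ⟨_, rfl⟩
  obtain ⟨y, hy⟩ : ∃ y, y = X * h := ⟨_, rfl⟩
  have hy' := hy
  rw [hh] at hy'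
  have ef : expand 5 (by norm_num) f = g := by rw [hg, hf]
  have eg : expand 5 (by norm_num) g = h := by rw [hg, hh, expand_twentyFive]
  have hgr : residuePart 0 g = g := by rw [hg]; exact residuePart_expand _
  have hgp (k : ℕ) : residuePart 0 (g ^ k) = g ^ k := residuePart_pow_self hgr k (mul_zero _)
  obtain ⟨gi, hgi⟩ : ∃ gi, g * gi = 1 := by
    refine ⟨expand 5 (by norm_num) fi, ?_⟩
    rw [hg, ← map_mul, hfi, map_one]
  have hgi6 : g ^ 6 * gi ^ 6 = 1 := by rw [← mul_pow, hgi, one_pow]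
  have ht : h = g ^ 6 * (h * gi ^ 6) := by linear_combination -h * hgi6
  obtain ⟨t, ht'⟩ : ∃ t, t = h * gi ^ 6 := ⟨_, rfl⟩
  rw [← ht'] at ht
  have hw := residuePart_inv_pow_four hf hy' (by rwa [hf]) (t := t) (by rw [← hh, ← hg, ← ht])
  obtain ⟨-, -, -, -, -, -, v2, -, -⟩ := exists_norm hf hy'
  obtain ⟨v8, v14⟩ := residuePart_pow_pentagonalSeries hf hy'
  have c14 (n : ℕ) : (15625 : ℤ) ∣ coeff (5 * n + 4) (g ^ 2 * f ^ 14) := by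
    rw [coeff_eq_coeff_residuePart (r := 4) (natCast_five_mul_add n 4),
      residuePart_mul (hgp 2) (zero_add _), v14,
      show g ^ 2 * (-15625 * y ^ 14) = C (-15625) * (g ^ 2 * y ^ 14) by
        rw [map_neg, map_ofNat]; ring, coeff_C_mul]
    exact Dvd.intro (-coeff (5 * n + 4) (g ^ 2 * y ^ 14)) (by ring)
  have c8 (n : ℕ) : (125 : ℤ) ∣ coeff (5 * n + 3) (g ^ 8 * f ^ 8) := by
    rw [coeff_eq_coeff_residuePart (r := 3) (natCast_five_mul_add n 3),
      residuePart_mul (hgp 8) (zero_add _), v8,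
      show g ^ 8 * (-125 * y ^ 8) = C (-125) * (g ^ 8 * y ^ 8) by
        rw [map_neg, map_ofNat]; ring, coeff_C_mul]
    exact Dvd.intro (-coeff (5 * n + 3) (g ^ 8 * y ^ 8)) (by ring)
  have d8 : (68750 * 125 : ℤ) ∣ 550 * coeff (25 * m + 24) (X * (g ^ 8 * f ^ 8)) := by
    rw [coeff_eq_coeff_residuePart (r := 4)
      (by rw [show 25 * m + 24 = 5 * (5 * m + 4) + 4 by ring]; exact natCast_five_mul_add _ 4),
      residuePart_mul residuePart_X (show (1 : ZMod 5) + 3 = 4 by decide),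
      residuePart_mul (hgp 8) (zero_add _), v8,
      show X * (g ^ 8 * (-125 * y ^ 8)) = C (-125) * (X ^ 9 * expand 5 (by norm_num) (g ^ 8 * f ^ 8)) by
        rw [map_neg, map_ofNat, map_mul, map_pow, map_pow, ef, eg, hy]; ring, coeff_C_mul,
      show 25 * m + 24 = 5 * (5 * m + 3) + 9 by ring, coeff_X_pow_mul, coeff_expand_mul]
    obtain ⟨z, hz⟩ := c8 m
    rw [hz]
    exact Dvd.intro (-z) (by ring)
  have d2 : (15625 : ℤ) ∣ coeff (25 * m + 24) (X ^ 2 * (g ^ 14 * f ^ 2)) := by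
    rw [coeff_eq_coeff_residuePart (r := 4)
      (by rw [show 25 * m + 24 = 5 * (5 * m + 4) + 4 by ring]; exact natCast_five_mul_add _ 4),
      residuePart_mul (residuePart_pow_self residuePart_X 2 rfl)
        (show ((2 : ℕ) : ZMod 5) * 1 + 2 = 4 by decide),
      residuePart_mul (hgp 14) (zero_add _), v2,
      show X ^ 2 * (g ^ 14 * -y ^ 2) = C (-1) * (X ^ 4 * expand 5 (by norm_num) (g ^ 2 * f ^ 14)) by
        rw [map_neg, map_one, map_mul, map_pow, map_pow, ef, eg, hy]; ring, coeff_C_mul,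
      show 25 * m + 24 = 5 * (5 * m + 4) + 4 by ring, coeff_X_pow_mul, coeff_expand_mul]
    exact (c14 m).mul_left _
  have main : residuePart 1 (g ^ 20 * fi ^ 4) = X * expand 5 (by norm_num)
      (C 4 * (g ^ 2 * f ^ 14) + C 550 * (X * (g ^ 8 * f ^ 8)) + C 12500 * (X ^ 2 * (g ^ 14 * f ^ 2)))
      + C 78125 * (g ^ 20 * y ^ 16 * t ^ 4) := by
    rw [residuePart_mul (hgp 20) (zero_add _), hw]
    simp only [map_add, map_mul, map_pow, ef, eg, expand_X, map_ofNat, hy]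
    have h2 : h ^ 2 = (g ^ 6 * t) ^ 2 := by rw [← ht]
    have h3 : h ^ 3 = (g ^ 6 * t) ^ 3 := by rw [← ht]
    linear_combination -(4 * X * h * g ^ 14) * ht - 550 * X ^ 6 * h ^ 6 * g ^ 8 * h2 -
      12500 * X ^ 11 * h ^ 11 * g ^ 2 * h3
  rw [← hg, coeff_eq_coeff_residuePart (r := 1)
    (by rw [show 125 * m + 121 = 5 * (25 * m + 24) + 1 by ring]; exact natCast_five_mul_add _ 1),
    main, map_add, coeff_C_mul, show 125 * m + 121 = 5 * (25 * m + 24) + 1 by ring,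
    coeff_succ_X_mul, coeff_expand_mul]
  simp only [map_add, coeff_C_mul]
  have d14 := c14 (5 * m + 4)
  rw [show 5 * (5 * m + 4) + 4 = 25 * m + 24 by ring] at d14
  exact dvd_add (dvd_add (dvd_add (d14.mul_left _) (dvd_trans (by norm_num) d8)) (d2.mul_left _))
    (Dvd.dvd.mul_right (by norm_num) _)

theorem coeff_prod_one_add_mul_pow {R : Type*} [CommRing R] (b v : R) (L n : ℕ) :
    coeff n (∏ s ∈ Finset.range L, (1 + C v * X * C b ^ s)) =
      b ^ (n.choose 2) * gaussBinom b L n * v ^ n := by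
  rw [prod_add_mul_pow (C b) (C v * X) 1 L, map_sum]
  have e (N : ℕ) : coeff n (C b ^ (N.choose 2) * gaussBinom (C b) L N * (C v * X) ^ N * 1 ^ (L - N)) =
      if n = N then b ^ (n.choose 2) * gaussBinom b L n * v ^ n else 0 := by
    rw [one_pow, mul_one, mul_pow, ← map_pow, ← map_pow, ← map_gaussBinom, ← mul_assoc, ← map_mul,
      ← map_mul, coeff_C_mul, coeff_X_pow]
    split_ifs with h
    · rw [h, mul_one]
    · rw [mul_zero]
  simp only [e]
  rw [Finset.sum_ite_eq]
  split_ifs with h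
  · rfl
  · rw [gaussBinom_of_lt b (by simpa using h), mul_zero, zero_mul]

/-- Size of the first-column hook set with `l i` elements in the residue class `i`. -/
def beadWeight (l : Fin 5 → ℕ) : ℕ := ∑ i : Fin 5, (5 * (l i).choose 2 + i * l i)

theorem prod_range_five_mul {R : Type*} [CommMonoid R] (F : ℕ → R) (L : ℕ) :
    ∏ s ∈ Finset.range (5 * L), F s = ∏ i : Fin 5, ∏ s ∈ Finset.range L, F (i + 5 * s) := by
  simp only [Fin.prod_univ_five]
  induction L with
  | zero => simp
  | succ L ih =>
    rw [show 5 * (L + 1) = 5 * L + 4 + 1 by ring]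
    simp only [Finset.prod_range_succ, ih]
    simp only [Fin.coe_ofNat_eq_mod, Nat.reduceMod,
      zero_add, add_comm (5 * L)]
    ac_rfl

theorem gaussBinom_dissection (M : ℕ) :
    (X : ℤ⟦X⟧) ^ ((5 * M).choose 2) * gaussBinom X (5 * (2 * M)) (5 * M) =
      ∑ l ∈ Finset.finsuppAntidiag (Finset.univ : Finset (Fin 5)) (5 * M),
        X ^ beadWeight l * ∏ i, gaussBinom (X ^ 5) (2 * M) (l i) := by
  have h := coeff_prod_one_add_mul_pow (X : ℤ⟦X⟧) 1 (5 * (2 * M)) (5 * M)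
  rw [one_pow, mul_one, prod_range_five_mul] at h
  rw [← h]
  have e (i : Fin 5) : ∏ s ∈ Finset.range (2 * M), (1 + C (1 : ℤ⟦X⟧) * X * C (X : ℤ⟦X⟧) ^ ((i : ℕ) + 5 * s)) =
      ∏ s ∈ Finset.range (2 * M), (1 + C ((X : ℤ⟦X⟧) ^ (i : ℕ)) * X * C ((X : ℤ⟦X⟧) ^ 5) ^ s) := by
    refine Finset.prod_congr rfl fun s _ => ?_
    rw [map_one, map_pow, map_pow, pow_add, pow_mul]
    ring
  simp only [e]
  rw [coeff_prod]
  refine Finset.sum_congr rfl fun l _ => ?_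
  simp only [coeff_prod_one_add_mul_pow]
  rw [beadWeight, ← Finset.prod_pow_eq_pow_sum, ← Finset.prod_mul_distrib]
  refine Finset.prod_congr rfl fun i _ => ?_
  rw [pow_add, pow_mul, pow_mul]
  ring

theorem abs_sub_le_beadWeight {l : Fin 5 → ℕ} {M : ℕ} (hl : ∑ i, l i = 5 * M) (i : Fin 5) :
    |(l i : ℤ) - M| ≤ 2 * ((beadWeight l : ℤ) - (5 * M).choose 2) := by
  obtain ⟨d, hd⟩ : ∃ d : Fin 5 → ℤ, ∀ i, (l i : ℤ) = M + d i := ⟨fun i => l i - M, fun i => by ring⟩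
  have hd0 : d 0 + d 1 + d 2 + d 3 + d 4 = 0 := by
    have := congrArg (Nat.cast : ℕ → ℤ) hl
    simp only [Fin.sum_univ_five, Nat.cast_add, hd, Nat.cast_mul] at this
    push_cast at this
    linarith
  have hw : 2 * ((beadWeight l : ℤ) - (5 * M).choose 2) = (5 * d 0 ^ 2 - 4 * d 0) +
      (5 * d 1 ^ 2 - 2 * d 1) + 5 * d 2 ^ 2 + (5 * d 3 ^ 2 + 2 * d 3) + (5 * d 4 ^ 2 + 4 * d 4) := by
    have h0 := two_mul_choose_two (5 * M)
    have h1 (i : Fin 5) := two_mul_choose_two (l i)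
    simp only [hd] at h1
    simp only [beadWeight, Fin.sum_univ_five]
    push_cast at h0 ⊢
    simp only [Fin.coe_ofNat_eq_mod, Nat.reduceMod, hd]
    push_cast
    linear_combination 5 * h1 0 + 5 * h1 1 + 5 * h1 2 + 5 * h1 3 + 5 * h1 4 - h0
      + (10 * M - 5 + 4) * hd0
  have hs (x c : ℤ) (hc : |c| ≤ 4) : |x| ≤ 5 * x ^ 2 + c * x := by
    have h1 : |x| ≤ x ^ 2 := by
      rw [← sq_abs]
      exact Int.le_self_sq |x|
    have h2 : -(c * x) ≤ 4 * |x| := by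
      refine (neg_le_abs _).trans ?_
      rw [abs_mul]
      exact mul_le_mul_of_nonneg_right hc (abs_nonneg x)
    linarith
  rw [hw, hd, add_sub_cancel_left]
  have a0 := hs (d 0) (-4) (by norm_num)
  have a1 := hs (d 1) (-2) (by norm_num)
  have a2 := hs (d 2) 0 (by norm_num)
  have a3 := hs (d 3) 2 (by norm_num)
  have a4 := hs (d 4) 4 (by norm_num)
  have b (j : Fin 5) := abs_nonneg (d j)
  have := b 0
  have := b 1
  have := b 2
  have := b 3
  have := b 4
  have hi : i = 0 ∨ i = 1 ∨ i = 2 ∨ i = 3 ∨ i = 4 := by revert i; decide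
  rcases hi with rfl | rfl | rfl | rfl | rfl <;> linarith

theorem choose_two_le_beadWeight {l : Fin 5 → ℕ} {M : ℕ} (hl : ∑ i, l i = 5 * M) :
    (5 * M).choose 2 ≤ beadWeight l := by
  have := (abs_nonneg _).trans (abs_sub_le_beadWeight hl 0)
  omega

theorem X_pow_dvd_beadWeight_sum (K : ℕ) :
    (X : ℤ⟦X⟧) ^ K ∣ expand 5 (by norm_num) (pentagonalSeries ℤ) ^ 5 -
      (∑ l ∈ Finset.finsuppAntidiag (Finset.univ : Finset (Fin 5)) (5 * (3 * K)),
        X ^ (beadWeight l - (5 * (3 * K)).choose 2)) * pentagonalSeries ℤ := by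
  obtain ⟨M, hM⟩ : ∃ M, M = 3 * K := ⟨_, rfl⟩
  rw [← hM]
  have hsum {l : Fin 5 →₀ ℕ} (hl : l ∈ Finset.finsuppAntidiag (Finset.univ : Finset (Fin 5)) (5 * M)) :
      ∑ i, l i = 5 * M := (Finset.mem_finsuppAntidiag.1 hl).1
  have h1 : gaussBinom (X : ℤ⟦X⟧) (5 * (2 * M)) (5 * M) =
      ∑ l ∈ Finset.finsuppAntidiag (Finset.univ : Finset (Fin 5)) (5 * M),
        X ^ (beadWeight l - (5 * M).choose 2) * ∏ i, gaussBinom (X ^ 5) (2 * M) (l i) := by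
    apply mul_left_cancel₀ (pow_ne_zero ((5 * M).choose 2) (X_ne_zero (R := ℤ)))
    rw [gaussBinom_dissection, Finset.mul_sum]
    refine Finset.sum_congr rfl fun l hl => ?_
    rw [← mul_assoc, ← pow_add, Nat.add_sub_cancel' (choose_two_le_beadWeight (hsum hl))]
  obtain ⟨g, hg⟩ : ∃ g, g = expand 5 (by norm_num) (pentagonalSeries ℤ) := ⟨_, rfl⟩
  rw [← hg]
  set π := Ideal.Quotient.mk (Ideal.span {(X : ℤ⟦X⟧) ^ K}) with hπ
  have h2 : π (gaussBinom X (5 * (2 * M)) (5 * M)) * π (pentagonalSeries ℤ) = 1 := by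
    rw [← map_mul, ← map_one π, Ideal.Quotient.eq, Ideal.mem_span_singleton]
    exact X_pow_dvd_gaussBinom_mul_sub_one (by omega) (by omega)
  have h3 {N : ℕ} (h1 : K ≤ N) (h2 : N + K ≤ 2 * M) :
      π (gaussBinom (X ^ 5) (2 * M) N) * π g = 1 := by
    have e : gaussBinom (X ^ 5) (2 * M) N = expand 5 (by norm_num) (gaussBinom (X : ℤ⟦X⟧) (2 * M) N) := by
      have := map_gaussBinom (expand 5 (by norm_num) (R := ℤ)).toRingHom X (2 * M) N
      simpa using this.symm
    rw [e, hg, ← map_mul, ← map_mul, ← map_one π, Ideal.Quotient.eq, Ideal.mem_span_singleton]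
    have := X_pow_dvd_expand (m := 5) (by norm_num) (X_pow_dvd_gaussBinom_mul_sub_one h1 h2)
    rwa [map_sub, map_one] at this
  have h4 : ∀ l ∈ Finset.finsuppAntidiag (Finset.univ : Finset (Fin 5)) (5 * M),
      π (X ^ (beadWeight l - (5 * M).choose 2)) * (∏ i, π (gaussBinom (X ^ 5) (2 * M) (l i))) * π g ^ 5 =
      π (X ^ (beadWeight l - (5 * M).choose 2)) := by
    intro l hl
    have hs := hsum hl
    rcases le_or_gt K (beadWeight l - (5 * M).choose 2) with h | h
    · have : π (X ^ (beadWeight l - (5 * M).choose 2)) = 0 := by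
        rw [Ideal.Quotient.eq_zero_iff_mem, Ideal.mem_span_singleton]
        exact pow_dvd_pow _ h
      rw [this, zero_mul, zero_mul]
    · have hc : π g ^ 5 = ∏ i : Fin 5, π g := by simp
      rw [mul_assoc, hc, ← Finset.prod_mul_distrib, Finset.prod_eq_one, mul_one]
      intro i _
      have h5 := abs_le.1 (abs_sub_le_beadWeight hs i)
      have h6 := choose_two_le_beadWeight hs
      exact h3 (by omega) (by omega)
  rw [← Ideal.mem_span_singleton, ← Ideal.Quotient.eq, map_mul, map_sum, map_pow]
  rw [← Finset.sum_congr rfl h4, ← Finset.sum_mul]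
  have h5 := congrArg π h1
  simp only [map_sum, map_mul, map_prod] at h5
  rw [← h5]
  linear_combination -π g ^ 5 * h2

theorem coeff_beadWeight_sum (M m : ℕ) :
    coeff m (∑ l ∈ Finset.finsuppAntidiag (Finset.univ : Finset (Fin 5)) (5 * M),
      (X : ℤ⟦X⟧) ^ (beadWeight l - (5 * M).choose 2)) =
    ((Finset.finsuppAntidiag (Finset.univ : Finset (Fin 5)) (5 * M)).filter
      (fun l : Fin 5 →₀ ℕ => beadWeight l = m + (5 * M).choose 2)).card := by
  rw [map_sum, Finset.card_filter, Nat.cast_sum]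
  refine Finset.sum_congr rfl fun l hl => ?_
  have := choose_two_le_beadWeight (Finset.mem_finsuppAntidiag.1 hl).1
  rw [coeff_X_pow]
  have h : m = beadWeight l - (5 * M).choose 2 ↔ beadWeight l = m + (5 * M).choose 2 := by omega
  simp only [h]
  split_ifs <;> simp

theorem exists_forall_lt_iff {P : ℕ → Prop} (hP : ∀ k, P (k + 1) → P k) (N : ℕ) :
    ∃ r ≤ N, ∀ k < N, k < r ↔ P k := by
  induction N with
  | zero => exact ⟨0, le_rfl, by simp⟩
  | succ N ih =>
    obtain ⟨r, hr, h⟩ := ih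
    by_cases hN : P N
    · refine ⟨N + 1, le_rfl, fun k hk => ⟨fun _ => ?_, fun _ => hk⟩⟩
      have : ∀ d k, k + d = N → P k := by
        intro d
        induction d with
        | zero => rintro k rfl; exact hN
        | succ d ih => intro k hk; exact hP k (ih (k + 1) (by omega))
      exact this (N - k) k (by omega)
    · refine ⟨r, by omega, fun k hk => ?_⟩
      rcases Nat.lt_succ_iff_lt_or_eq.1 hk with h1 | rfl
      · exact h k h1
      · exact ⟨fun h2 => by omega, fun h2 => absurd h2 hN⟩

theorem List.lt_getD_iff_of_pairwise {l : List ℕ} (hl : l.Pairwise (· ≥ ·)) (i j : ℕ) :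
    j < l.getD i 0 ↔ i < (l.filter (fun x => j < x)).length := by
  induction l generalizing i with
  | nil => simp
  | cons a t ih =>
    rw [List.pairwise_cons] at hl
    by_cases h : j < a
    · rw [List.filter_cons_of_pos (by simpa using h)]
      cases i with
      | zero => simpa using h
      | succ i => simpa using ih hl.2 i
    · rw [List.filter_cons_of_neg (by simpa using h),
        List.filter_eq_nil_iff.2 (fun x hx => by have := hl.1 x hx; simp; omega)]
      cases i with
      | zero => simpa using h
      | succ i =>
        simp only [List.getD_cons_succ, List.length_nil, Nat.not_lt_zero, iff_false, not_lt]
        rcases lt_or_ge i t.length with h1 | h1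
        · rw [List.getD_eq_getElem _ _ h1]
          have := hl.1 _ (List.getElem_mem h1)
          omega
        · rw [List.getD_eq_default _ _ h1]
          exact Nat.zero_le _

theorem List.sum_range_getD (l : List ℕ) {N : ℕ} (h : l.length ≤ N) :
    ∑ i ∈ Finset.range N, l.getD i 0 = l.sum := by
  induction l generalizing N with
  | nil => simp
  | cons a t ih =>
    obtain ⟨N, rfl⟩ := Nat.exists_eq_succ_of_ne_zero (by simp at h; omega : N ≠ 0)
    rw [Finset.sum_range_succ']
    simp only [List.getD_cons_succ, List.getD_cons_zero, List.sum_cons]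
    rw [ih (by simpa using h), add_comm]

namespace Nat.Partition

variable {n : ℕ}

/-- The length of row `i` of the Ferrers–Young diagram of `p`. -/
def row (p : n.Partition) (i : ℕ) : ℕ := (p.parts.sort (· ≤ ·)).reverse.getD i 0

/-- The length of column `j` of the Ferrers–Young diagram of `p`. -/
def col (p : n.Partition) (j : ℕ) : ℕ := (p.parts.filter (fun x => j < x)).card

theorem lt_row_iff (p : n.Partition) (i j : ℕ) : j < p.row i ↔ i < p.col j := by
  have h : (p.parts.sort (· ≤ ·)).reverse.Pairwise (· ≥ ·) := by
    rw [List.pairwise_reverse]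
    exact Multiset.pairwise_sort _ _
  rw [row, List.lt_getD_iff_of_pairwise h, List.filter_reverse, List.length_reverse, col]
  conv_rhs => rw [← Multiset.sort_eq p.parts (· ≤ ·), Multiset.filter_coe, Multiset.coe_card]

theorem row_succ_le (p : n.Partition) (i : ℕ) : p.row (i + 1) ≤ p.row i := by
  by_contra h
  have h1 := (p.lt_row_iff (i + 1) (p.row i)).1 (by omega)
  have h2 := (p.lt_row_iff i (p.row i)).2 (by omega)
  omega

theorem row_antitone (p : n.Partition) : Antitone p.row :=
  antitone_nat_of_succ_le p.row_succ_le

theorem card_parts_le (p : n.Partition) : p.parts.card ≤ n := by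
  have h := Multiset.card_nsmul_le_sum (s := p.parts) (a := 1) (fun x hx => p.parts_pos hx)
  rw [p.parts_sum] at h
  simpa using h

theorem row_eq_zero (p : n.Partition) {i : ℕ} (h : n ≤ i) : p.row i = 0 := by
  rw [row, List.getD_eq_default]
  have := p.card_parts_le
  simp
  omega

theorem sum_row (p : n.Partition) {N : ℕ} (h : n ≤ N) : ∑ i ∈ Finset.range N, p.row i = n := by
  have := p.card_parts_le
  unfold row
  rw [List.sum_range_getD _ (by simp; omega), List.sum_reverse, ← Multiset.sum_coe,
    Multiset.sort_eq, p.parts_sum]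

theorem col_zero (p : n.Partition) : p.col 0 = p.parts.card := by
  rw [col, Multiset.filter_eq_self.2 (fun x hx => p.parts_pos hx)]

theorem row_injective : Function.Injective (row : n.Partition → ℕ → ℕ) := by
  intro p q h
  have hc : p.parts.card = q.parts.card := by
    rw [← col_zero, ← col_zero]
    refine le_antisymm ?_ ?_ <;> refine le_of_not_gt fun hlt => ?_
    · have := (p.lt_row_iff _ _).2 hlt
      rw [h, q.lt_row_iff] at this
      omega
    · have := (q.lt_row_iff _ _).2 hlt
      rw [← h, p.lt_row_iff] at this
      omega
  have hl : (p.parts.sort (· ≤ ·)).reverse = (q.parts.sort (· ≤ ·)).reverse := by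
    refine List.ext_getElem (by simpa using hc) fun i h1 h2 => ?_
    have := congrFun h i
    rwa [row, row, List.getD_eq_getElem _ _ h1, List.getD_eq_getElem _ _ h2] at this
  ext1
  rw [← Multiset.sort_eq p.parts (· ≤ ·), ← Multiset.sort_eq q.parts (· ≤ ·),
    List.reverse_injective hl]

theorem exists_row_eq {f : ℕ → ℕ} (hf : Antitone f) {N : ℕ} (h0 : ∀ i, N ≤ i → f i = 0)
    (hn : ∑ i ∈ Finset.range N, f i = n) : ∃ p : n.Partition, p.row = f := by
  refine ⟨ofSums n ((Multiset.range N).map f) hn, ?_⟩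
  set p := ofSums n ((Multiset.range N).map f) hn with hp
  have hcol : ∀ j, p.col j = ((Finset.range N).filter (fun i => j < f i)).card := by
    intro j
    have : p.parts = ((Multiset.range N).map f).filter (· ≠ 0) := rfl
    rw [col, this, Multiset.filter_filter, Multiset.filter_congr (q := fun x => j < x)
      (fun x _ => ⟨fun h => h.1, fun h => ⟨h, by omega⟩⟩), Multiset.filter_map, Multiset.card_map]
    rfl
  have hlt : ∀ i j, i < p.col j ↔ j < f i := by
    intro i j
    obtain ⟨r, hr, h⟩ := exists_forall_lt_iff (P := fun i => j < f i)
      (fun k hk => hk.trans_le (hf (Nat.le_succ k))) N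
    have e : (Finset.range N).filter (fun i => j < f i) = Finset.range r := by
      ext k
      simp only [Finset.mem_filter, Finset.mem_range]
      exact ⟨fun hk => (h k hk.1).2 hk.2, fun hk => ⟨by omega, (h k (by omega)).1 hk⟩⟩
    rw [hcol, e, Finset.card_range]
    rcases lt_or_ge i N with hi | hi
    · exact h i hi
    · rw [h0 i hi]
      omega
  ext i
  refine le_antisymm ?_ ?_ <;> refine le_of_not_gt fun h => ?_
  · have := (hlt _ _).1 ((p.lt_row_iff _ _).1 h)
    omega
  · have := (p.lt_row_iff _ _).2 ((hlt _ _).2 h)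
    omega

/-- The first-column hook numbers of `p`, for `p` padded to `N` rows. -/
def bead (p : n.Partition) (N i : ℕ) : ℕ := p.row i + (N - 1 - i)

/-- The set of the first-column hook numbers of `p`, for `p` padded to `N` rows. -/
def beadSet (p : n.Partition) (N : ℕ) : Finset ℕ := (Finset.range N).image (p.bead N)

theorem bead_lt_bead (p : n.Partition) {N i j : ℕ} (hij : i < j) (hj : j < N) :
    p.bead N j < p.bead N i := by
  have := p.row_antitone hij.le
  unfold bead
  omega

theorem bead_injOn (p : n.Partition) (N : ℕ) : Set.InjOn (p.bead N) (Finset.range N) := by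
  intro i hi j hj h
  simp only [Finset.coe_range, Set.mem_Iio] at hi hj
  rcases lt_trichotomy i j with hij | hij | hij
  · have := p.bead_lt_bead hij hj; omega
  · exact hij
  · have := p.bead_lt_bead hij hi; omega

theorem card_beadSet (p : n.Partition) (N : ℕ) : (p.beadSet N).card = N := by
  rw [beadSet, Finset.card_image_of_injOn (p.bead_injOn N), Finset.card_range]

theorem sum_beadSet (p : n.Partition) {N : ℕ} (h : n ≤ N) :
    ∑ s ∈ p.beadSet N, s = n + N.choose 2 := by
  rw [beadSet, Finset.sum_image (p.bead_injOn N)]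
  simp only [bead]
  rw [Finset.sum_add_distrib, p.sum_row h, Finset.sum_range_reflect (fun i => i) N,
    Finset.sum_range_id, Nat.choose_two_right]

theorem isTCore_iff_beadSet (p : n.Partition) {N t : ℕ} (hN : n ≤ N) (ht : 0 < t) :
    IsTCore t p ↔ ∀ s ∈ p.beadSet N, t ≤ s → s - t ∈ p.beadSet N := by
  have hmem (s : ℕ) : s ∈ p.beadSet N ↔ ∃ i < N, p.row i + (N - 1 - i) = s := by
    simp [beadSet, bead]
  have hcolN (j : ℕ) : p.col j ≤ N := by
    by_contra h
    have := (p.lt_row_iff N j).2 (by omega)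
    rw [p.row_eq_zero hN] at this
    omega
  constructor
  · intro h s hs hts
    by_contra hy
    obtain ⟨y, hys⟩ : ∃ y, y = s - t := ⟨_, rfl⟩
    rw [← hys] at hy
    obtain ⟨i, hi, his⟩ := (hmem s).1 hs
    obtain ⟨r, hr, hlt⟩ := exists_forall_lt_iff (P := fun k => y < p.row k + (N - 1 - k))
      (fun k hk => by have := p.row_succ_le k; omega) N
    have hir : i < r := (hlt i hi).2 (by omega)
    have hr1 : p.row (r - 1) + (N - 1 - (r - 1)) > y := (hlt (r - 1) (by omega)).1 (by omega)
    have hrr : N ≤ y + r ∧ p.row r + N ≤ y + r := by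
      rcases lt_or_ge r N with h1 | h1
      · have h2 := mt (hlt r h1).2 (lt_irrefl r)
        have h3 : p.row r + (N - 1 - r) ≠ y := fun h3 => hy ((hmem y).2 ⟨r, h1, h3⟩)
        omega
      · rw [p.row_eq_zero (hN.trans h1)]
        omega
    obtain ⟨j, hj⟩ : ∃ j, y + r = N + j := Nat.exists_eq_add_of_le hrr.1
    have hiff : ∀ k, k < p.col j ↔ k < r := by
      intro k
      rw [← p.lt_row_iff]
      constructor
      · intro h1
        by_contra h2
        have := p.row_antitone (by omega : r ≤ k)
        omega
      · intro h1
        have := p.row_antitone (by omega : k ≤ r - 1)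
        omega
    have hcol : p.col j = r := by
      have h1 := hiff r
      have h2 := hiff (p.col j)
      omega
    have hrow : j < p.row i := (p.lt_row_iff i j).2 (by omega)
    refine h i j hrow ⟨1, ?_⟩
    change p.row i - j + (p.col j - i) - 1 = t * 1
    omega
  · intro h i j hj hd
    change j < p.row i at hj
    change t ∣ p.row i - j + (p.col j - i) - 1 at hd
    obtain ⟨q, hq⟩ := hd
    have hij := (p.lt_row_iff i j).1 hj
    have hc := hcolN j
    have key : ∀ q, t * q ≤ p.row i + (N - 1 - i) →
        p.row i + (N - 1 - i) - t * q ∈ p.beadSet N := by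
      intro q
      induction q with
      | zero => intro _; exact (hmem _).2 ⟨i, by omega, by simp⟩
      | succ q ih =>
        intro hle
        rw [Nat.mul_succ] at hle ⊢
        have := h _ (ih (by omega)) (by omega)
        rwa [Nat.sub_sub] at this
    obtain ⟨k, hk, hks⟩ := (hmem _).1 (key q (by omega))
    have h1 := p.lt_row_iff k j
    omega

theorem beadSet_injective {N : ℕ} (hN : n ≤ N) :
    Function.Injective (fun p : n.Partition => p.beadSet N) := by
  intro p q h
  have hmono (p : n.Partition) : StrictMono (fun i : Fin N => p.bead N i.rev) := by
    intro i j hij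
    exact p.bead_lt_bead (Fin.rev_lt_rev.2 hij) i.rev.2
  have hrange (p : n.Partition) :
      Set.range (fun i : Fin N => p.bead N i.rev) = (p.beadSet N : Set ℕ) := by
    ext s
    simp only [Set.mem_range, beadSet, Finset.coe_image, Set.mem_image, Finset.coe_range,
      Set.mem_Iio]
    constructor
    · rintro ⟨i, rfl⟩
      exact ⟨_, i.rev.2, rfl⟩
    · rintro ⟨i, hi, rfl⟩
      exact ⟨Fin.rev ⟨i, hi⟩, by rw [Fin.rev_rev]⟩
  have heq := ((hmono p).range_inj (hmono q)).1 (by rw [hrange, hrange]; exact congrArg _ h)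
  apply row_injective
  ext i
  rcases lt_or_ge i N with hi | hi
  · have := congrFun heq (Fin.rev ⟨i, hi⟩)
    simp only [Fin.rev_rev, bead] at this
    omega
  · rw [p.row_eq_zero (hN.trans hi), q.row_eq_zero (hN.trans hi)]

theorem exists_beadSet_eq {S : Finset ℕ} {N : ℕ} (hc : S.card = N)
    (hs : ∑ s ∈ S, s = n + N.choose 2) : ∃ p : n.Partition, p.beadSet N = S := by
  set e := S.orderEmbOfFin hc with he
  obtain ⟨b, hb⟩ : ∃ b : ℕ → ℕ, ∀ i (hi : i < N), b i = e (Fin.rev ⟨i, hi⟩) :=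
    ⟨fun i => if hi : i < N then e (Fin.rev ⟨i, hi⟩) else 0, fun i hi => dif_pos hi⟩
  have hanti : ∀ i, i + 1 < N → b (i + 1) < b i := by
    intro i hi
    rw [hb _ hi, hb i (by omega)]
    apply e.strictMono
    rw [Fin.rev_lt_rev]
    simp
  have hlow : ∀ d i, i + d + 1 = N → d ≤ b i := by
    intro d
    induction d with
    | zero => intro i _; exact Nat.zero_le _
    | succ d ih =>
      intro i hi
      have := ih (i + 1) (by omega)
      have := hanti i (by omega)
      omega
  have himage : (Finset.range N).image b = S := by
    ext s
    rw [← Finset.mem_coe (s := S), ← Finset.range_orderEmbOfFin S hc, ← he]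
    simp only [Finset.mem_image, Finset.mem_range, Set.mem_range]
    constructor
    · rintro ⟨i, hi, rfl⟩
      exact ⟨_, (hb i hi).symm⟩
    · rintro ⟨i, rfl⟩
      exact ⟨i.rev, i.rev.2, by rw [hb _ i.rev.2]; exact congrArg e (Fin.rev_rev i)⟩
  have hinj : Set.InjOn b (Finset.range N) := by
    apply Finset.injOn_of_card_image_eq
    rw [himage, hc, Finset.card_range]
  obtain ⟨f, hf⟩ : ∃ f : ℕ → ℕ, ∀ i, f i = if i < N then b i - (N - 1 - i) else 0 :=
    ⟨_, fun i => rfl⟩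
  have hfb : ∀ i < N, f i + (N - 1 - i) = b i := by
    intro i hi
    have := hlow (N - 1 - i) i (by omega)
    rw [hf, if_pos hi]
    omega
  have hfanti : Antitone f := by
    apply antitone_nat_of_succ_le
    intro i
    rcases lt_or_ge (i + 1) N with hi | hi
    · have := hfb i (by omega)
      have := hfb _ hi
      have := hanti i hi
      omega
    · rw [hf (i + 1), if_neg (by omega)]
      exact Nat.zero_le _
  have hsum : ∑ i ∈ Finset.range N, f i = n := by
    have h1 : ∑ i ∈ Finset.range N, (f i + (N - 1 - i)) = n + N.choose 2 := by
      rw [Finset.sum_congr rfl fun i hi => hfb i (Finset.mem_range.1 hi), ← hs, ← himage,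
        Finset.sum_image hinj]
    rw [Finset.sum_add_distrib, Finset.sum_range_reflect (fun i => i) N, Finset.sum_range_id,
      Nat.choose_two_right] at h1
    omega
  obtain ⟨p, hp⟩ := exists_row_eq hfanti (fun i hi => by rw [hf, if_neg (by omega)]) hsum
  refine ⟨p, ?_⟩
  rw [beadSet, ← himage]
  refine Finset.image_congr fun i hi => ?_
  rw [bead, hp]
  exact hfb i (by simpa using hi)

end Nat.Partition

/-- The set with `l i` elements in the residue class of `i` modulo `5`, filled from the bottom. -/
def abacus (l : Fin 5 → ℕ) : Finset ℕ :=
  Finset.univ.biUnion fun i : Fin 5 => (Finset.range (l i)).image fun k => 5 * k + i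

theorem mem_abacus {l : Fin 5 → ℕ} (i : Fin 5) (k : ℕ) : 5 * k + (i : ℕ) ∈ abacus l ↔ k < l i := by
  simp only [abacus, Finset.mem_biUnion, Finset.mem_univ, true_and, Finset.mem_image,
    Finset.mem_range]
  constructor
  · rintro ⟨j, a, ha, h⟩
    obtain rfl : j = i := by ext; omega
    obtain rfl : a = k := by omega
    exact ha
  · intro h
    exact ⟨i, k, h, rfl⟩

theorem exists_eq_five_mul_add (s : ℕ) : ∃ (i : Fin 5) (k : ℕ), s = 5 * k + i :=
  ⟨⟨s % 5, by omega⟩, s / 5, by simp; omega⟩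

theorem abacus_injective : Function.Injective abacus := by
  intro l l' h
  ext i
  have h1 := mem_abacus (l := l) i (l' i)
  have h2 := mem_abacus (l := l') i (l i)
  rw [h] at h1
  rw [mem_abacus] at h1
  rw [← h, mem_abacus] at h2
  omega

theorem sum_abacus (l : Fin 5 → ℕ) (F : ℕ → ℕ) :
    ∑ s ∈ abacus l, F s = ∑ i, ∑ k ∈ Finset.range (l i), F (5 * k + i) := by
  rw [abacus, Finset.sum_biUnion]
  · refine Finset.sum_congr rfl fun i _ => ?_
    rw [Finset.sum_image]
    intro a _ b _ h
    dsimp only at h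
    omega
  · intro i _ j _ hij
    rw [Function.onFun, Finset.disjoint_left]
    intro s h1 h2
    simp only [Finset.mem_image, Finset.mem_range] at h1 h2
    obtain ⟨a, _, rfl⟩ := h1
    obtain ⟨b, _, h⟩ := h2
    apply hij
    ext
    omega

theorem card_abacus (l : Fin 5 → ℕ) : (abacus l).card = ∑ i, l i := by
  rw [Finset.card_eq_sum_ones, sum_abacus]
  simp

theorem sum_abacus_id (l : Fin 5 → ℕ) : ∑ s ∈ abacus l, s = beadWeight l := by
  rw [sum_abacus l fun s => s, beadWeight]
  refine Finset.sum_congr rfl fun i _ => ?_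
  rw [Finset.sum_add_distrib, ← Finset.mul_sum, Finset.sum_range_id, Nat.choose_two_right]
  simp [mul_comm]

theorem exists_abacus_eq_iff {S : Finset ℕ} :
    (∃ l, abacus l = S) ↔ ∀ s ∈ S, 5 ≤ s → s - 5 ∈ S := by
  constructor
  · rintro ⟨l, rfl⟩ s hs h5
    obtain ⟨i, k, rfl⟩ := exists_eq_five_mul_add s
    rw [mem_abacus] at hs
    rw [show 5 * k + (i : ℕ) - 5 = 5 * (k - 1) + i by omega, mem_abacus]
    omega
  · intro h
    have hex (i : Fin 5) : ∃ r, ∀ k, k < r ↔ 5 * k + (i : ℕ) ∈ S := by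
      obtain ⟨r, hr, hlt⟩ := exists_forall_lt_iff (P := fun k => 5 * k + (i : ℕ) ∈ S)
        (fun k hk => by
          have := h _ hk (by omega)
          rwa [show 5 * (k + 1) + (i : ℕ) - 5 = 5 * k + i by omega] at this) (S.sup id + 1)
      refine ⟨r, fun k => ?_⟩
      rcases lt_or_ge k (S.sup id + 1) with hk | hk
      · exact hlt k hk
      · refine ⟨fun h1 => by omega, fun h1 => ?_⟩
        have : 5 * k + (i : ℕ) ≤ S.sup id := Finset.le_sup (f := id) h1
        omega
    choose l hl using hex
    refine ⟨l, ?_⟩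
    ext s
    obtain ⟨i, k, rfl⟩ := exists_eq_five_mul_add s
    rw [mem_abacus, hl]

theorem card_core_eq {n M : ℕ} (h : n ≤ 5 * M) :
    Nat.card {p : n.Partition // IsTCore 5 p} =
      ((Finset.finsuppAntidiag (Finset.univ : Finset (Fin 5)) (5 * M)).filter
        (fun l : Fin 5 →₀ ℕ => beadWeight l = n + (5 * M).choose 2)).card := by
  have e1 : Nat.card {p : n.Partition // IsTCore 5 p} = Nat.card {S : Finset ℕ //
      (S.card = 5 * M ∧ ∑ s ∈ S, s = n + (5 * M).choose 2) ∧ ∀ s ∈ S, 5 ≤ s → s - 5 ∈ S} := by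
    refine Nat.card_congr (Equiv.ofBijective (fun p => ⟨p.1.beadSet (5 * M),
      ⟨p.1.card_beadSet _, p.1.sum_beadSet h⟩,
      (p.1.isTCore_iff_beadSet h (by norm_num)).1 p.2⟩) ⟨?_, ?_⟩)
    · intro p q hpq
      exact Subtype.ext (Nat.Partition.beadSet_injective h (congrArg Subtype.val hpq))
    · rintro ⟨S, ⟨hc, hs⟩, hS⟩
      obtain ⟨p, rfl⟩ := Nat.Partition.exists_beadSet_eq hc hs
      exact ⟨⟨p, (p.isTCore_iff_beadSet h (by norm_num)).2 hS⟩, rfl⟩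
  rw [e1, ← Nat.card_eq_finsetCard]
  have hmem (l : Fin 5 →₀ ℕ) : l ∈ (Finset.finsuppAntidiag (Finset.univ : Finset (Fin 5))
      (5 * M)).filter (fun l : Fin 5 →₀ ℕ => beadWeight l = n + (5 * M).choose 2) ↔
      (abacus l).card = 5 * M ∧ ∑ s ∈ abacus l, s = n + (5 * M).choose 2 := by
    simp [Finset.mem_finsuppAntidiag, card_abacus, sum_abacus_id]
  refine (Nat.card_congr (Equiv.ofBijective (fun l => ⟨abacus l.1, (hmem l.1).1 l.2,
    exists_abacus_eq_iff.1 ⟨l.1, rfl⟩⟩) ⟨?_, ?_⟩)).symm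
  · intro l l' hl
    exact Subtype.ext (DFunLike.coe_injective (abacus_injective (congrArg Subtype.val hl)))
  · rintro ⟨S, hc, hS⟩
    obtain ⟨l, rfl⟩ := exists_abacus_eq_iff.2 hS
    exact ⟨⟨Finsupp.equivFunOnFinite.symm l, (hmem _).2 hc⟩, rfl⟩

/-- The generating function of `t`-core partitions. -/
noncomputable def coreSeries (t : ℕ) : ℤ⟦X⟧ :=
  PowerSeries.mk fun n => (Nat.card {p : n.Partition // IsTCore t p} : ℤ)

theorem coreSeries_five_mul_pentagonalSeries :
    coreSeries 5 * pentagonalSeries ℤ = expand 5 (by norm_num) (pentagonalSeries ℤ) ^ 5 := by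
  rw [eq_comm, ← sub_eq_zero]
  ext K
  rw [map_zero]
  refine X_pow_dvd_iff.1 (?_ : X ^ (K + 1) ∣ _) K (Nat.lt_succ_self K)
  obtain ⟨S, hS⟩ : ∃ S : ℤ⟦X⟧, S = ∑ l ∈ Finset.finsuppAntidiag (Finset.univ : Finset (Fin 5))
    (5 * (3 * (K + 1))), X ^ (beadWeight l - (5 * (3 * (K + 1))).choose 2) := ⟨_, rfl⟩
  have h1 := X_pow_dvd_beadWeight_sum (K + 1)
  rw [← hS] at h1
  have h2 : X ^ (K + 1) ∣ S - coreSeries 5 := by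
    rw [X_pow_dvd_iff]
    intro m hm
    rw [map_sub, hS, coeff_beadWeight_sum, coreSeries, coeff_mk,
      card_core_eq (show m ≤ 5 * (3 * (K + 1)) by omega), sub_self]
  have h3 := dvd_add h1 (h2.mul_right (pentagonalSeries ℤ))
  convert h3 using 1
  ring

theorem numA_eq_coeff (t k n : ℕ) : (numA t k n : ℤ) = coeff n (coreSeries t ^ k) := by
  have hp : coreSeries t ^ k = ∏ _i : Fin k, coreSeries t := by simp
  rw [hp, coeff_prod]
  simp only [coreSeries, coeff_mk]
  have e : {f : Fin k → Σ m : Fin (n + 1), Nat.Partition (m : ℕ) //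
      (∑ i, ((f i).1 : ℕ)) = n ∧ ∀ i, IsTCore t (f i).2} ≃
      Σ l : {l : Fin k → ℕ // l ∈ Finset.piAntidiag Finset.univ n},
        ∀ i, {p : (l.1 i).Partition // IsTCore t p} :=
    { toFun := fun f => ⟨⟨fun i => (f.1 i).1, by simpa using f.2.1⟩,
        fun i => ⟨(f.1 i).2, f.2.2 i⟩⟩
      invFun := fun s => ⟨fun i => ⟨⟨s.1.1 i, by
          have h : ∑ i, s.1.1 i = n := (Finset.mem_piAntidiag.1 s.1.2).1
          have h' : s.1.1 i ≤ ∑ j, s.1.1 j :=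
            Finset.single_le_sum (fun _ _ => Nat.zero_le _) (Finset.mem_univ i)
          omega⟩, (s.2 i).1⟩,
        (Finset.mem_piAntidiag.1 s.1.2).1, fun i => (s.2 i).2⟩
      left_inv := fun f => rfl
      right_inv := fun s => rfl }
  rw [numA, Nat.card_congr e, Nat.card_sigma]
  simp only [Nat.card_pi]
  rw [Finset.sum_coe_sort (Finset.piAntidiag Finset.univ n)
    (fun l : Fin k → ℕ => ∏ i, Nat.card {p : (l i).Partition // IsTCore t p})]
  push_cast
  refine (Finset.sum_nbij (fun l : Fin k →₀ ℕ => ⇑l) (fun l hl => ?_)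
    DFunLike.coe_injective.injOn (fun l hl => ?_) fun l _ => rfl).symm
  · simpa [Finset.mem_piAntidiag, Finset.mem_finsuppAntidiag] using hl
  · exact ⟨Finsupp.equivFunOnFinite.symm l,
      by simpa [Finset.mem_piAntidiag, Finset.mem_finsuppAntidiag] using hl, by simp⟩

theorem stmt_8 : ∀ n : ℕ, 15625 ∣ numA 5 4 (125 * n + 121) := by
  intro n
  obtain ⟨fi, hfi⟩ := isUnit_pentagonalSeries.exists_right_inv
  have h := dvd_coeff_pow_mul_inv_pow hfi n
  have hc : coreSeries 5 ^ 4 = expand 5 (by norm_num) (pentagonalSeries ℤ) ^ 20 * fi ^ 4 := by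
    have h1 : coreSeries 5 = expand 5 (by norm_num) (pentagonalSeries ℤ) ^ 5 * fi := by
      linear_combination fi * coreSeries_five_mul_pentagonalSeries - coreSeries 5 * hfi
    rw [h1]
    ring
  rw [← hc, ← numA_eq_coeff] at h
  exact_mod_cast h
end

section
/- Let p be a prime, and let k ≥ 1, N ≥ 1, M ≥ 1, and r be integers with 1 ≤ r ≤ p^M − 1. If A_{p,k}(p^M n + r) ≡ 0 (mod p^N) for all integers n ≥ 0, then for every integer i ≥ 0 and all integers n ≥ 0, A_{p, p^{M+N−1} i + k}(p^M n + r) ≡ 0 (mod p^N). -/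
/-- The generating function of the number of `t`-core partitions. -/
noncomputable def tCoreSeries (t : ℕ) : PowerSeries ℤ :=
  PowerSeries.mk fun m => (Nat.card { P : Nat.Partition m // IsTCore t P } : ℤ)

/-- A tuple of `t`-cores of total size `n` is a tuple of sizes together with a `t`-core of each
of these sizes. -/
def tCoreTupleEquiv (t k n : ℕ) :
    { f : Fin k → Σ m : Fin (n + 1), Nat.Partition (m : ℕ) //
      (∑ i, ((f i).1 : ℕ)) = n ∧ ∀ i, IsTCore t (f i).2 } ≃
    Σ l : { l : Fin k → Fin (n + 1) // (∑ i, (l i : ℕ)) = n },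
      ∀ i, { P : Nat.Partition (l.1 i : ℕ) // IsTCore t P } where
  toFun f := ⟨⟨fun i => (f.1 i).1, f.2.1⟩, fun i => ⟨(f.1 i).2, f.2.2 i⟩⟩
  invFun g := ⟨fun i => ⟨g.1.1 i, (g.2 i).1⟩, g.1.2, fun i => (g.2 i).2⟩
  left_inv _ := rfl
  right_inv _ := rfl

theorem coeff_tCoreSeries_pow (t k n : ℕ) :
    PowerSeries.coeff n (tCoreSeries t ^ k) = (numA t k n : ℤ) := by
  have hpow : tCoreSeries t ^ k = ∏ _i : Fin k, tCoreSeries t := by simp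
  rw [hpow, PowerSeries.coeff_prod, numA, Nat.card_congr (tCoreTupleEquiv t k n), Nat.card_sigma]
  push_cast [Nat.card_pi]
  symm
  refine Finset.sum_bij (fun l _ => Finsupp.equivFunOnFinite.symm fun i => (l.1 i : ℕ))
    ?_ ?_ ?_ ?_
  · intro l _
    simpa [Finset.mem_finsuppAntidiag] using l.2
  · intro a _ b _ hab
    ext i
    simpa using DFunLike.congr_fun hab i
  · intro b hb
    have hsum := (Finset.mem_finsuppAntidiag.1 hb).1
    refine ⟨⟨fun i => ⟨b i, Nat.lt_succ_of_le ?_⟩, hsum⟩, Finset.mem_univ _, ?_⟩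
    · rw [← hsum]
      exact Finset.single_le_sum (f := b) (fun _ _ => Nat.zero_le _) (Finset.mem_univ i)
    · ext i
      simp
  · intro l _
    simp [tCoreSeries]

theorem PowerSeries.natCast_dvd_of_map_zmod_eq_zero {m : ℕ} {F : PowerSeries ℤ}
    (h : PowerSeries.map (Int.castRingHom (ZMod m)) F = 0) : (m : PowerSeries ℤ) ∣ F := by
  have hc : ∀ d, (m : ℤ) ∣ PowerSeries.coeff d F := fun d => by
    simpa [ZMod.intCast_zmod_eq_zero_iff_dvd] using
      congrArg (PowerSeries.coeff d) h
  choose g hg using hc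
  refine ⟨PowerSeries.mk g, ?_⟩
  ext d
  rw [← map_natCast (PowerSeries.C (R := ℤ)) m, PowerSeries.coeff_C_mul, PowerSeries.coeff_mk]
  exact hg d

theorem PowerSeries.prime_dvd_pow_sub_expand {p : ℕ} (hp : p.Prime) (M : ℕ) (F : PowerSeries ℤ) :
    (p : PowerSeries ℤ) ∣
      F ^ p ^ M - PowerSeries.expand (p ^ M) (pow_ne_zero M hp.ne_zero) F := by
  have := Fact.mk hp
  apply PowerSeries.natCast_dvd_of_map_zmod_eq_zero
  have key := MvPowerSeries.map_iterateFrobenius_expand p hp.ne_zero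
    (PowerSeries.map (Int.castRingHom (ZMod p)) F) M
  have hid : iterateFrobenius (ZMod p) p M = RingHom.id _ := Subsingleton.elim _ _
  rw [hid, MvPowerSeries.map_id] at key
  rw [map_sub, map_pow, PowerSeries.map_expand, sub_eq_zero]
  exact key.symm

/-- Modulo `p ^ N`, the `p ^ (M + N - 1)`-th power of an integral power series is a power series
in `X ^ (p ^ M)`. -/
theorem PowerSeries.prime_pow_dvd_pow_sub_expand {p : ℕ} (hp : p.Prime) {M N : ℕ} (hN : 1 ≤ N)
    (F : PowerSeries ℤ) :
    ((p ^ N : ℕ) : PowerSeries ℤ) ∣ F ^ p ^ (M + N - 1) -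
      PowerSeries.expand (p ^ M) (pow_ne_zero M hp.ne_zero) (F ^ p ^ (N - 1)) := by
  have h := dvd_sub_pow_of_dvd_sub (PowerSeries.prime_dvd_pow_sub_expand hp M F) (N - 1)
  rw [← pow_mul, ← pow_add, ← map_pow, Nat.sub_add_cancel hN, ← Nat.add_sub_assoc hN] at h
  exact_mod_cast h

theorem PowerSeries.dvd_coeff_of_natCast_dvd {m : ℕ} {F : PowerSeries ℤ}
    (h : (m : PowerSeries ℤ) ∣ F) (d : ℕ) : (m : ℤ) ∣ PowerSeries.coeff d F := by
  obtain ⟨G, rfl⟩ := h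
  rw [← map_natCast (PowerSeries.C (R := ℤ)) m, PowerSeries.coeff_C_mul]
  exact dvd_mul_right _ _

/-- Multiplication by a power series in `X ^ q` preserves divisibility of all coefficients in a
residue class modulo `q`. -/
theorem PowerSeries.dvd_coeff_expand_mul {q r : ℕ} (hq : q ≠ 0) (hr : r < q) {m : ℤ}
    (G : PowerSeries ℤ) {F : PowerSeries ℤ}
    (h : ∀ n, m ∣ PowerSeries.coeff (q * n + r) F) (n : ℕ) :
    m ∣ PowerSeries.coeff (q * n + r) (PowerSeries.expand q hq G * F) := by
  rw [PowerSeries.coeff_mul]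
  refine Finset.dvd_sum fun x hx => ?_
  rw [Finset.HasAntidiagonal.mem_antidiagonal] at hx
  by_cases hd : q ∣ x.1
  · obtain ⟨a, ha⟩ := hd
    have hmod : x.2 % q = r := by
      have := congrArg (· % q) hx
      simpa [ha, Nat.mod_eq_of_lt hr] using this
    have hx2 : x.2 = q * (x.2 / q) + r := by
      rw [← hmod, Nat.div_add_mod]
    rw [hx2]
    exact (h _).mul_left _
  · rw [PowerSeries.coeff_expand_of_not_dvd q hq _ hd, zero_mul]
    exact dvd_zero m

theorem stmt_9 (p : ℕ) (hp : p.Prime) (k N M r : ℕ) (hk : 1 ≤ k) (hN : 1 ≤ N) (hM : 1 ≤ M)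
    (hr1 : 1 ≤ r) (hr2 : r ≤ p ^ M - 1)
    (h : ∀ n : ℕ, p ^ N ∣ numA p k (p ^ M * n + r)) :
    ∀ i n : ℕ, p ^ N ∣ numA p (p ^ (M + N - 1) * i + k) (p ^ M * n + r) := by
  intro i n
  have hr : r < p ^ M := by
    have := pow_pos hp.pos M
    omega
  have hq : p ^ M ≠ 0 := pow_ne_zero M hp.ne_zero
  rw [← Int.natCast_dvd_natCast, ← coeff_tCoreSeries_pow, pow_add, pow_mul]
  set F := tCoreSeries p
  have hdvd := ((PowerSeries.prime_pow_dvd_pow_sub_expand hp (M := M) hN F).trans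
    (sub_dvd_pow_sub_pow _ _ i)).mul_right (F ^ k)
  have hcoeff := PowerSeries.dvd_coeff_of_natCast_dvd hdvd (p ^ M * n + r)
  rw [sub_mul, map_sub, ← map_pow (PowerSeries.expand (p ^ M) hq)] at hcoeff
  refine (dvd_iff_dvd_of_dvd_sub hcoeff).2 (PowerSeries.dvd_coeff_expand_mul hq hr _ ?_ n)
  intro n
  rw [coeff_tCoreSeries_pow]
  exact_mod_cast h n
end

section
/- For all integers i ≥ 0 and n ≥ 0, A_{5, 3125 i + 2}(125 n + 123) ≡ 0 (mod 125). -/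
namespace FiveCore

open PowerSeries Finset

/-- The partial product `∏_{1 ≤ i ≤ n} (1 - X ^ i)`. -/
noncomputable def eulerProd (n : ℕ) : ℤ⟦X⟧ := ∏ i ∈ range n, (1 - X ^ (i + 1))

/-- Euler's product `∏_{i ≥ 1} (1 - X ^ i)`, through the pentagonal number theorem. -/
noncomputable def euler : ℤ⟦X⟧ := pentagonalSeries ℤ

lemma eulerProd_zero : eulerProd 0 = 1 := rfl

lemma eulerProd_succ (n : ℕ) : eulerProd (n + 1) = eulerProd n * (1 - X ^ (n + 1)) :=
  prod_range_succ _ _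

lemma X_pow_dvd_eulerProd_sub {n m : ℕ} (h : n ≤ m) :
    (X : ℤ⟦X⟧) ^ (n + 1) ∣ eulerProd m - eulerProd n := by
  induction m, h using Nat.le_induction with
  | base => simp
  | succ m hm ih =>
    have : eulerProd (m + 1) - eulerProd n
        = (eulerProd m - eulerProd n) - X ^ (m + 1) * eulerProd m := by
      rw [eulerProd_succ]; ring
    rw [this]
    exact dvd_sub ih (dvd_mul_of_dvd_left (pow_dvd_pow _ (by omega)) _)

lemma X_pow_dvd_euler_sub {n m : ℕ} (h : n ≤ m) :
    (X : ℤ⟦X⟧) ^ (n + 1) ∣ euler - eulerProd m := by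
  rw [X_pow_dvd_iff]
  intro k hk
  obtain ⟨s, hs⟩ := Filter.eventually_atTop.1 (coeff_prod_one_sub_X_pow_eventually_eq ℤ k)
  obtain ⟨M, hM⟩ := s.exists_nat_subset_range
  have h1 := hs (range (max M m)) (hM.trans (range_subset_range.2 (le_max_left _ _)))
  have h2 := X_pow_dvd_iff.1 (X_pow_dvd_eulerProd_sub (le_max_right M m)) k (by omega)
  rw [map_sub, sub_eq_zero] at h2 ⊢
  rw [← h2, euler, ← h1, eulerProd]

lemma constantCoeff_eulerProd (n : ℕ) : constantCoeff (eulerProd n) = 1 := by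
  simp [eulerProd, map_prod]

lemma constantCoeff_euler : constantCoeff euler = 1 := by
  have h := X_pow_dvd_iff.1 (X_pow_dvd_euler_sub le_rfl : X ^ (0 + 1) ∣ euler - eulerProd 0) 0
    (by simp)
  simpa [sub_eq_zero, constantCoeff_eulerProd] using h

lemma isUnit_euler : IsUnit euler := by
  simp [PowerSeries.isUnit_iff_constantCoeff, constantCoeff_euler]

/-- The Gaussian binomial coefficient, as a power series. -/
noncomputable def qBinom : ℕ → ℕ → ℤ⟦X⟧
  | _, 0 => 1
  | 0, _ + 1 => 0
  | n + 1, k + 1 => qBinom n (k + 1) + X ^ (n - k) * qBinom n k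

lemma qBinom_zero_right (n : ℕ) : qBinom n 0 = 1 := by
  cases n <;> rfl

lemma qBinom_succ_succ (n k : ℕ) :
    qBinom (n + 1) (k + 1) = qBinom n (k + 1) + X ^ (n - k) * qBinom n k := rfl

lemma qBinom_eq_zero {n k : ℕ} (h : n < k) : qBinom n k = 0 := by
  induction n generalizing k with
  | zero => obtain ⟨k, rfl⟩ := Nat.exists_eq_add_of_lt h; simp [qBinom]
  | succ n ih =>
    obtain ⟨k, rfl⟩ := Nat.exists_eq_succ_of_ne_zero (by omega : k ≠ 0)
    rw [Nat.succ_eq_add_one, qBinom_succ_succ, ih (by omega), ih (by omega)]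
    simp

lemma qBinom_mul_eulerProd (k l : ℕ) :
    qBinom (k + l) k * eulerProd k * eulerProd l = eulerProd (k + l) := by
  induction hn : k + l generalizing k l with
  | zero =>
    obtain ⟨rfl, rfl⟩ : k = 0 ∧ l = 0 := by omega
    simp [qBinom, eulerProd_zero]
  | succ n ih =>
    obtain _ | k := k
    · obtain rfl : l = n + 1 := by omega
      simp [qBinom_zero_right, eulerProd_zero]
    rw [qBinom_succ_succ, eulerProd_succ n]
    have h1 := ih k l (by omega)
    obtain _ | l := l
    · rw [qBinom_eq_zero (by omega : n < k + 1), ← h1, eulerProd_succ k]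
      obtain rfl : n = k := by omega
      simp; ring
    · have h2 := ih (k + 1) l (by omega)
      rw [show n - k = l + 1 by omega]
      have e1 := eulerProd_succ k
      have e2 := eulerProd_succ l
      have e3 : (X : ℤ⟦X⟧) ^ (n + 1) = X ^ (k + 1) * X ^ (l + 1) := by
        rw [← pow_add]; congr 1; omega
      rw [e3]
      rw [e2] at h1 ⊢
      rw [e1] at h2 ⊢
      linear_combination (1 - X ^ (l + 1)) * h2 + X ^ (l + 1) * (1 - X ^ (k + 1)) * h1

lemma X_pow_dvd_euler_mul_qBinom_sub {r k l : ℕ} (hk : r ≤ k) (hl : r ≤ l) :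
    (X : ℤ⟦X⟧) ^ (r + 1) ∣ euler * qBinom (k + l) k - 1 := by
  obtain ⟨a, ha⟩ := X_pow_dvd_euler_sub hk
  obtain ⟨b, hb⟩ := X_pow_dvd_euler_sub hl
  obtain ⟨c, hc⟩ := X_pow_dvd_euler_sub (by omega : r ≤ k + l)
  have h := qBinom_mul_eulerProd k l
  rw [← isUnit_euler.dvd_mul_left]
  have e1 : eulerProd k = euler - X ^ (r + 1) * a := by rw [← ha]; ring
  have e2 : eulerProd l = euler - X ^ (r + 1) * b := by rw [← hb]; ring
  have e3 : eulerProd (k + l) = euler - X ^ (r + 1) * c := by rw [← hc]; ring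
  rw [e1, e2, e3] at h
  exact ⟨-c + qBinom (k + l) k * (a * euler + b * euler - X ^ (r + 1) * a * b),
    by linear_combination h⟩


/-- The `q`-binomial theorem. -/
lemma coeff_prod_C_add_C_mul_X (w : ℤ⟦X⟧) (n k : ℕ) :
    (∏ i ∈ range n, (Polynomial.C w + Polynomial.C ((PowerSeries.X : ℤ⟦X⟧) ^ i) * Polynomial.X)).coeff k
      = PowerSeries.X ^ (k.choose 2) * qBinom n k * w ^ (n - k) := by
  induction n generalizing k with
  | zero =>
    obtain _ | k := k
    · simp [qBinom]
    · simp [qBinom, Polynomial.coeff_one]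
  | succ n ih =>
    rw [prod_range_succ, mul_add, Polynomial.coeff_add, Polynomial.coeff_mul_C, ih]
    obtain _ | k := k
    · rw [← mul_assoc, Polynomial.mul_coeff_zero]
      simp [qBinom_zero_right, pow_succ]
    · rw [← mul_assoc, Polynomial.coeff_mul_X, Polynomial.coeff_mul_C, ih, qBinom_succ_succ,
        Nat.choose_succ_succ' k 1, Nat.choose_one_right]
      rcases lt_trichotomy n k with h | h | h
      · simp [qBinom_eq_zero h, qBinom_eq_zero (h.trans (Nat.lt_succ_self k))]
      · subst h
        rw [qBinom_eq_zero (Nat.lt_succ_self n)]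
        simp; ring
      · obtain ⟨d, rfl⟩ := Nat.exists_eq_add_of_lt h
        rw [show k + d + 1 - (k + 1) = d by omega, show k + d + 1 - k = d + 1 by omega,
          show k + d + 1 + 1 - (k + 1) = d + 1 by omega]
        ring

lemma sum_qBinom_eq_eulerProd (N : ℕ) :
    ∑ k ∈ range (2 * (N + 1) + 1), (X : ℤ⟦X⟧) ^ (k.choose 2) * qBinom (2 * (N + 1)) k *
        (X ^ (N + 1)) ^ (2 * (N + 1) - k) * (k : ℤ⟦X⟧) * (-1) ^ (k - 1)
      = (-1) ^ (N + 1) * X ^ ((N + 1) * (N + 1) + (N + 1).choose 2) *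
        (eulerProd (N + 1) * eulerProd N) := by
  set x : ℕ → Polynomial ℤ⟦X⟧ := fun i =>
    Polynomial.C ((X : ℤ⟦X⟧) ^ (N + 1)) + Polynomial.C ((X : ℤ⟦X⟧) ^ i) * Polynomial.X with hx
  have hdeg : (∏ i ∈ range (2 * (N + 1)), x i).natDegree < 2 * (N + 1) + 1 := by
    refine Nat.lt_succ_of_le ((Polynomial.natDegree_prod_le _ _).trans ?_)
    refine (sum_le_card_nsmul _ _ 1 fun i _ => ?_).trans (by simp)
    simp only [hx]
    compute_degree
  have h1 : (∏ i ∈ range (2 * (N + 1)), x i).derivative.eval (-1)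
      = ∑ k ∈ range (2 * (N + 1) + 1), (X : ℤ⟦X⟧) ^ (k.choose 2) * qBinom (2 * (N + 1)) k *
        (X ^ (N + 1)) ^ (2 * (N + 1) - k) * (k : ℤ⟦X⟧) * (-1) ^ (k - 1) := by
    rw [Polynomial.derivative_eval, Polynomial.sum_over_range' _ (by simp) _ hdeg]
    simp_rw [hx, coeff_prod_C_add_C_mul_X]
  have h2 : ∏ i ∈ range (2 * (N + 1)), x i
      = (∏ i ∈ range (N + 1), x i) * (∏ i ∈ range N, x (N + 2 + i)) * x (N + 1) := by
    rw [show 2 * (N + 1) = (N + 1) + (N + 1) by ring, prod_range_add,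
      prod_range_succ' (fun i => x (N + 1 + i)) N, ← mul_assoc]
    congr 2
    refine prod_congr rfl fun i _ => ?_
    congr 1; ring
  have h3 : (x (N + 1)).eval (-1) = 0 := by simp [hx]
  have h4 : (x (N + 1)).derivative.eval (-1) = X ^ (N + 1) := by simp [hx]
  have h5 : (∏ i ∈ range (N + 1), x i).eval (-1)
      = (-1) ^ (N + 1) * X ^ ((N + 1).choose 2) * eulerProd (N + 1) := by
    rw [Polynomial.eval_prod, eulerProd, ← prod_range_reflect (fun i => (1 - (X : ℤ⟦X⟧) ^ (i + 1))),
      Nat.choose_two_right, ← Finset.sum_range_id, ← prod_pow_eq_pow_sum]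
    have hsign : (-1 : ℤ⟦X⟧) ^ (N + 1) = ∏ _i ∈ range (N + 1), (-1) := by simp
    rw [hsign, ← prod_mul_distrib, ← prod_mul_distrib]
    refine prod_congr rfl fun i hi => ?_
    rw [mem_range] at hi
    obtain ⟨d, hd⟩ := Nat.exists_eq_add_of_lt hi
    rw [show N + 1 - 1 - i + 1 = d + 1 by omega]
    simp only [hx, hd]
    simp
    ring
  have h6 : (∏ i ∈ range N, x (N + 2 + i)).eval (-1) = X ^ (N * (N + 1)) * eulerProd N := by
    rw [Polynomial.eval_prod, eulerProd, mul_comm N, pow_mul]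
    conv_rhs => rw [← card_range N, ← prod_const, card_range, ← prod_mul_distrib]
    refine prod_congr rfl fun i hi => ?_
    simp only [hx]
    simp
    ring
  rw [← h1, h2, Polynomial.derivative_mul, Polynomial.eval_add, Polynomial.eval_mul,
    Polynomial.eval_mul, h3, h4, Polynomial.eval_mul, h5, h6]
  ring

lemma choose_two_add_mul_eq {N k : ℕ} (hk : k ≤ 2 * N) :
    ∃ j d, k.choose 2 + N * (2 * N - k) = N * N + N.choose 2 + (j + 1).choose 2 ∧
      d ≤ k ∧ d + k ≤ 2 * N ∧ N ≤ d + (j + 1).choose 2 + 1 := by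
  have key : ∀ a : ℕ, a ≤ (a + 1).choose 2 := fun a => by
    rw [Nat.choose_succ_succ' a 1]; simp
  have two : ∀ a : ℕ, (2 : ℤ) * (a + 1).choose 2 = (a + 1) * a := fun a => by
    have := Nat.triangle_succ a
    have h := Nat.choose_two_right (a + 1)
    have h2 := Nat.div_mul_cancel (even_iff_two_dvd.1 (Nat.even_mul_pred_self (a + 1)))
    rw [← h] at h2
    simp at h2
    push_cast [← h2, mul_comm]
    zify at h2
    linarith
  have two' : ∀ a : ℕ, (2 : ℤ) * a.choose 2 = a * (a - 1) := fun a => by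
    obtain _ | a := a
    · simp
    · rw [two]; push_cast; ring
  rcases Nat.lt_or_ge N k with h | h
  · obtain ⟨j, rfl⟩ := Nat.exists_eq_add_of_lt h
    obtain ⟨e, he⟩ : ∃ e, N = j + 1 + e := Nat.exists_eq_add_of_le (by omega)
    refine ⟨j, e, ?_, by omega, by omega, by have := key j; omega⟩
    rw [show 2 * N - (N + j + 1) = e by omega]
    have h1 := two' (N + j + 1)
    have h2 := two' N
    have h3 := two' (j + 1)
    subst he
    zify
    push_cast at h1 h2 h3 ⊢
    refine mul_left_cancel₀ (two_ne_zero (α := ℤ)) ?_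
    linear_combination h1 - h2 - h3
  · obtain ⟨j, rfl⟩ := Nat.exists_eq_add_of_le h
    refine ⟨j, k, ?_, by omega, by omega, by have := key j; omega⟩
    rw [show 2 * (k + j) - k = k + 2 * j by omega]
    have h1 := two' k
    have h2 := two' (k + j)
    have h3 := two' (j + 1)
    zify
    push_cast at h1 h2 h3 ⊢
    refine mul_left_cancel₀ (two_ne_zero (α := ℤ)) ?_
    linear_combination h1 - h2 - h3

lemma coeff_X_pow_eq_of_dvd_sub {f g : ℤ⟦X⟧} {n m : ℕ} (h : (X : ℤ⟦X⟧) ^ m ∣ f - g)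
    (hn : n < m) : coeff n f = coeff n g := by
  have := X_pow_dvd_iff.1 h n hn
  rwa [map_sub, sub_eq_zero] at this

/-- The coefficients of the cube of Euler's product are supported on triangular numbers. -/
lemma coeff_euler_pow_three_eq_zero {n : ℕ} (hn : ∀ j, n ≠ (j + 1).choose 2) :
    coeff n (euler ^ 3) = 0 := by
  set T := (n + 1) * (n + 1) + (n + 1).choose 2 with hT
  have h1 : coeff n (euler ^ 3) = coeff n (euler * (eulerProd (n + 1) * eulerProd n)) := by
    obtain ⟨a, ha⟩ := X_pow_dvd_euler_sub n.le_succ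
    obtain ⟨b, hb⟩ := X_pow_dvd_euler_sub (le_refl n)
    refine coeff_X_pow_eq_of_dvd_sub (m := n + 1) ?_ (by omega)
    exact ⟨euler * (a * euler + b * eulerProd (n + 1)),
      by linear_combination euler * euler * ha + euler * eulerProd (n + 1) * hb⟩
  have h2 := congrArg (fun f => coeff (T + n) (euler * f)) (sum_qBinom_eq_eulerProd n)
  simp only [mul_sum, map_sum] at h2
  rw [sum_eq_zero] at h2
  · rw [h1]
    have h3 : euler * ((-1) ^ (n + 1) * X ^ ((n + 1) * (n + 1) + (n + 1).choose 2) *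
        (eulerProd (n + 1) * eulerProd n))
        = X ^ T * (C ((-1) ^ (n + 1)) * (euler * (eulerProd (n + 1) * eulerProd n))) := by
      simp only [map_pow, map_neg, map_one]; ring
    rw [h3, add_comm T n, coeff_X_pow_mul, coeff_C_mul] at h2
    exact (mul_eq_zero.1 h2.symm).resolve_left (by simp)
  · intro k hk
    rw [mem_range] at hk
    obtain ⟨j, d, h3, h4, h5, h6⟩ := choose_two_add_mul_eq (N := n + 1) (k := k) (by omega)
    obtain ⟨l, hl⟩ := Nat.exists_eq_add_of_le (by omega : k ≤ 2 * (n + 1))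
    obtain ⟨c, hc⟩ := X_pow_dvd_euler_mul_qBinom_sub h4 (by omega : d ≤ l)
    have h7 : euler * ((X : ℤ⟦X⟧) ^ (k.choose 2) * qBinom (2 * (n + 1)) k *
        (X ^ (n + 1)) ^ (2 * (n + 1) - k) * (k : ℤ⟦X⟧) * (-1) ^ (k - 1))
        = X ^ (T + (j + 1).choose 2) * (C ((k : ℤ) * (-1) ^ (k - 1)) * (1 + X ^ (d + 1) * c)) := by
      rw [← h3, ← hc, hl]
      simp only [map_pow, map_neg, map_one, map_mul, map_natCast]; ring
    rw [h7, coeff_X_pow_mul', ]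
    split_ifs with h8
    · rw [coeff_C_mul, map_add, coeff_one, if_neg (by have := hn j; omega), coeff_X_pow_mul',
        if_neg (by omega)]
      simp
    · rfl

/-- The substitution `X ↦ X ^ 5`. -/
noncomputable def dil : ℤ⟦X⟧ →ₐ[ℤ] ℤ⟦X⟧ := PowerSeries.expand 5 (by norm_num)

/-- The series of the coefficients in degrees congruent to `r` modulo `5`. -/
noncomputable def sect (r : ℕ) : ℤ⟦X⟧ →+ ℤ⟦X⟧ where
  toFun f := .mk fun n => coeff (5 * n + r) f
  map_add' f g := by ext; simp
  map_zero' := by ext; simp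

@[simp] lemma coeff_sect (r n : ℕ) (f : ℤ⟦X⟧) : coeff n (sect r f) = coeff (5 * n + r) f := by
  simp [sect]

lemma coeff_dil (n : ℕ) (f : ℤ⟦X⟧) :
    coeff n (dil f) = if 5 ∣ n then coeff (n / 5) f else 0 := by
  rw [dil, coeff_expand]

lemma dil_X : dil X = X ^ 5 := expand_X _ _

lemma sect_X_pow_mul_dil {r s : ℕ} (hr : r < 5) (hs : s < 5) (f : ℤ⟦X⟧) :
    sect r (X ^ s * dil f) = if r = s then f else 0 := by
  ext n
  rw [coeff_sect, coeff_X_pow_mul', coeff_dil]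
  split_ifs with h1 h2 h3 h3 h3
  · congr 2; omega
  · omega
  · omega
  · simp
  · omega
  · simp

lemma sect_sum {r : ℕ} (hr : r < 5) (h : ℕ → ℤ⟦X⟧) :
    sect r (∑ s ∈ range 5, X ^ s * dil (h s)) = h r := by
  rw [map_sum, sum_eq_single r]
  · rw [sect_X_pow_mul_dil hr hr, if_pos rfl]
  · intro s hs hsr
    rw [sect_X_pow_mul_dil hr (mem_range.1 hs), if_neg (Ne.symm hsr)]
  · intro h; exact absurd (mem_range.2 hr) h

lemma sum_X_pow_mul_dil_sect (f : ℤ⟦X⟧) : ∑ s ∈ range 5, X ^ s * dil (sect s f) = f := by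
  ext n
  rw [map_sum, sum_eq_single (n % 5)]
  · rw [coeff_X_pow_mul', if_pos (Nat.mod_le _ _), coeff_dil, if_pos (by omega), coeff_sect]
    congr 2; omega
  · intro s hs hsr
    rw [mem_range] at hs
    rw [coeff_X_pow_mul', coeff_dil]
    split_ifs with h1 h2
    · omega
    · rfl
    · rfl
  · intro h; exact absurd (mem_range.2 (Nat.mod_lt _ (by norm_num))) h

lemma sect_dil_mul {r : ℕ} (hr : r < 5) (g f : ℤ⟦X⟧) : sect r (dil g * f) = g * sect r f := by
  conv_lhs => rw [← sum_X_pow_mul_dil_sect f, mul_sum]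
  rw [← sect_sum hr fun s => g * sect s f]
  congr 1
  refine sum_congr rfl fun s _ => ?_
  rw [map_mul]; ring

lemma dil_injective : Function.Injective dil := by
  intro f g h
  ext n
  have h1 := congrArg (coeff (5 * n)) h
  simpa [coeff_dil] using h1

/-- The part of Euler's product in degrees divisible by `5`, with `X ^ 5` replaced by `X`. -/
noncomputable def eulerA : ℤ⟦X⟧ := sect 0 euler

/-- The negated part of Euler's product in degrees congruent to `2` modulo `5`,
divided by `X ^ 2`, with `X ^ 5` replaced by `X`. -/
noncomputable def eulerB : ℤ⟦X⟧ := - sect 2 euler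

lemma coeff_euler_pentagonal (k : ℤ) : coeff (pentagonal k) euler = Int.negOnePow k :=
  (coeff_pentagonalSeries_pentagonal ℤ k).trans Int.cast_id

lemma coeff_euler_eq_zero {n : ℕ} (h : ∀ k, pentagonal k ≠ n) : coeff n euler = 0 :=
  coeff_pentagonalSeries_eq_zero ℤ (by simpa using h)

lemma five_mul_add_one_eq_pentagonal {n : ℕ} {k : ℤ} (h : pentagonal k = 5 * n + 1) :
    ∃ l, k = 1 - 5 * l ∧ n = 5 * pentagonal l := by
  have h1 := two_mul_natCast_pentagonal k
  rw [h] at h1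
  push_cast at h1
  obtain ⟨l, r, hr0, hr5, hk⟩ : ∃ l r : ℤ, 0 ≤ r ∧ r < 5 ∧ k = 1 - 5 * l + r :=
    ⟨-((k - 1) / 5), (k - 1) % 5, by omega, by omega, by omega⟩
  obtain rfl : r = 0 := by
    subst hk
    have : (5 : ℤ) ∣ r * (3 * r + 5) := by
      have e : r * (3 * r + 5) = 5 * (2 * n - 15 * l ^ 2 + 5 * l + 6 * l * r) := by
        linear_combination -h1
      exact ⟨_, e⟩
    interval_cases r <;> omega
  refine ⟨l, by omega, ?_⟩
  have h2 := two_mul_natCast_pentagonal l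
  zify
  subst hk
  linarith

lemma pentagonal_one_sub_five_mul (l : ℤ) :
    pentagonal (1 - 5 * l) = 5 * (5 * pentagonal l) + 1 := by
  have h1 := two_mul_natCast_pentagonal (1 - 5 * l)
  have h2 := two_mul_natCast_pentagonal l
  zify
  linarith

lemma sect_one_euler : sect 1 euler = - dil euler := by
  ext n
  rw [coeff_sect, map_neg, coeff_dil]
  by_cases h : ∃ k, pentagonal k = 5 * n + 1
  · obtain ⟨k, hk⟩ := h
    obtain ⟨l, rfl, rfl⟩ := five_mul_add_one_eq_pentagonal hk
    rw [if_pos (dvd_mul_right _ _), Nat.mul_div_cancel_left _ (by norm_num), ← hk,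
      coeff_euler_pentagonal, coeff_euler_pentagonal]
    rw [show (1 - 5 * l : ℤ) = l + (2 * (-3 * l) + 1) by ring, Int.negOnePow_add,
      Int.negOnePow_two_mul_add_one]
    simp
  · push Not at h
    rw [coeff_euler_eq_zero h]
    split_ifs with h5
    · obtain ⟨m, rfl⟩ := h5
      rw [Nat.mul_div_cancel_left _ (by norm_num), coeff_euler_eq_zero, neg_zero]
      intro l hl
      exact h _ (by rw [pentagonal_one_sub_five_mul, hl])
    · simp

lemma sect_euler_eq_zero {r : ℕ} (h : r = 3 ∨ r = 4) : sect r euler = 0 := by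
  ext n
  rw [coeff_sect, map_zero, coeff_euler_eq_zero]
  intro k hk
  have h1 := two_mul_natCast_pentagonal k
  rw [hk] at h1
  push_cast at h1
  obtain ⟨l, s, hs0, hs5, rfl⟩ : ∃ l s : ℤ, 0 ≤ s ∧ s < 5 ∧ k = 5 * l + s :=
    ⟨k / 5, k % 5, by omega, by omega, by omega⟩
  have e : s * (3 * s - 1) - 2 * r = 5 * (2 * n - 15 * l ^ 2 + l - 6 * l * s) := by
    linear_combination -h1
  generalize (2 * n - 15 * l ^ 2 + l - 6 * l * s : ℤ) = t at e
  rcases h with rfl | rfl <;> interval_cases s <;> omega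

lemma euler_eq : euler = dil eulerA - X * dil (dil euler) - X ^ 2 * dil eulerB := by
  conv_lhs => rw [← sum_X_pow_mul_dil_sect euler]
  simp only [sum_range_succ, sum_range_zero, sect_one_euler, sect_euler_eq_zero (Or.inl rfl),
    sect_euler_eq_zero (Or.inr rfl), eulerA, eulerB, map_neg, map_zero]
  ring

lemma eulerA_mul_eulerB : eulerA * eulerB = dil euler ^ 2 := by
  have h1 : sect 2 (euler ^ 3) = 0 := by
    ext n
    rw [coeff_sect, map_zero]
    refine coeff_euler_pow_three_eq_zero fun j hj => ?_
    have h2 := Nat.div_mul_cancel (even_iff_two_dvd.1 (Nat.even_mul_pred_self (j + 1)))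
    rw [← Nat.choose_two_right, ← hj, Nat.add_sub_cancel] at h2
    have h3 : (j + 1) * j % 5 = (j % 5 + 1) * (j % 5) % 5 := by simp [Nat.mul_mod, Nat.add_mod]
    have h4 : j % 5 < 5 := Nat.mod_lt _ (by norm_num)
    generalize (j + 1) * j = t at h2 h3
    interval_cases h : j % 5 <;> omega
  have h2 : euler ^ 3 = ∑ s ∈ range 5, X ^ s * dil ((fun s => match s with
      | 0 => eulerA ^ 3 - 3 * X * dil euler * eulerB ^ 2
      | 1 => -3 * eulerA ^ 2 * dil euler - X * eulerB ^ 3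
      | 2 => 3 * eulerA * (dil euler ^ 2 - eulerA * eulerB)
      | 3 => 6 * eulerA * dil euler * eulerB - dil euler ^ 3
      | _ => 3 * eulerB * (eulerA * eulerB - dil euler ^ 2)) s) := by
    conv_lhs => rw [euler_eq]
    simp only [sum_range_succ, sum_range_zero, map_sub, map_mul, map_pow, map_neg,
      map_ofNat, dil_X]
    ring
  rw [h2, sect_sum (by norm_num)] at h1
  have h3 : eulerA ≠ 0 := by
    intro h
    have := congrArg (coeff 0) h
    simp [eulerA, constantCoeff_euler] at this
  rcases mul_eq_zero.1 h1 with h | h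
  · rcases mul_eq_zero.1 h with h | h
    · have := congrArg constantCoeff h
      simp [map_ofNat] at this
    · exact absurd h h3
  · linear_combination -h

section FifthRoot

variable {R : Type*} [CommRing R]

lemma prod_one_sub_fifth_root_mul {z : R} (hz : 1 + z + z ^ 2 + z ^ 3 + z ^ 4 = 0) (x : R) :
    ∏ k ∈ range 5, (1 - z ^ k * x) = 1 - x ^ 5 := by
  have hz5 : z ^ 5 = 1 := by linear_combination (z - 1) * hz
  have h1 : (1 - z * x) * (1 - z ^ 4 * x) = 1 - (z + z ^ 4) * x + x ^ 2 := by
    linear_combination x ^ 2 * hz5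
  have h2 : (1 - z ^ 2 * x) * (1 - z ^ 3 * x) = 1 - (z ^ 2 + z ^ 3) * x + x ^ 2 := by
    linear_combination x ^ 2 * hz5
  have h3 : (z + z ^ 4) * (z ^ 2 + z ^ 3) = -1 := by
    linear_combination hz + (z + z ^ 2) * hz5
  have h4 : z ^ 2 + z ^ 3 = -1 - (z + z ^ 4) := by linear_combination hz
  simp only [prod_range_succ, prod_range_zero, pow_zero, pow_one, one_mul]
  have h5 : (1 - x) * (1 - z * x) * (1 - z ^ 2 * x) * (1 - z ^ 3 * x) * (1 - z ^ 4 * x)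
      = (1 - x) * ((1 - z * x) * (1 - z ^ 4 * x)) * ((1 - z ^ 2 * x) * (1 - z ^ 3 * x)) := by ring
  rw [h5, h1, h2, h4]
  rw [h4] at h3
  generalize z + z ^ 4 = s at h3
  linear_combination (1 - x) * x ^ 2 * h3

lemma prod_fifth_root_norm {z : R} (hz : 1 + z + z ^ 2 + z ^ 3 + z ^ 4 = 0) (a u v : R) :
    ∏ k ∈ range 5, (a - z ^ k * u - (z ^ k) ^ 2 * v)
      = a ^ 5 - u ^ 5 - v ^ 5 - 5 * a * u ^ 3 * v - 5 * a ^ 2 * u * v ^ 2 := by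
  have hz5 : z ^ 5 = 1 := by linear_combination (z - 1) * hz
  have h1 : (a - z * u - z ^ 2 * v) * (a - z ^ 4 * u - (z ^ 4) ^ 2 * v)
      = a ^ 2 + u ^ 2 + v ^ 2 - (z + z ^ 4) * a * u - (z ^ 2 + z ^ 3) * a * v
        + (z + z ^ 4) * u * v := by
    linear_combination (u ^ 2 - z ^ 3 * a * v + z ^ 4 * u * v + z * u * v
      + (1 + z ^ 5) * v ^ 2) * hz5
  have h2 : (a - z ^ 2 * u - (z ^ 2) ^ 2 * v) * (a - z ^ 3 * u - (z ^ 3) ^ 2 * v)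
      = a ^ 2 + u ^ 2 + v ^ 2 - (z ^ 2 + z ^ 3) * a * u - (z + z ^ 4) * a * v
        + (z ^ 2 + z ^ 3) * u * v := by
    linear_combination (u ^ 2 - z * a * v + z ^ 3 * u * v + z ^ 2 * u * v
      + (1 + z ^ 5) * v ^ 2) * hz5
  have h3 : (z + z ^ 4) * (z ^ 2 + z ^ 3) = -1 := by
    linear_combination hz + (z + z ^ 2) * hz5
  have h4 : z ^ 2 + z ^ 3 = -1 - (z + z ^ 4) := by linear_combination hz
  simp only [prod_range_succ, prod_range_zero, pow_zero, pow_one, one_mul, one_pow]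
  have h5 : (a - u - v) * (a - z * u - z ^ 2 * v) * (a - z ^ 2 * u - (z ^ 2) ^ 2 * v) *
      (a - z ^ 3 * u - (z ^ 3) ^ 2 * v) * (a - z ^ 4 * u - (z ^ 4) ^ 2 * v)
      = (a - u - v) * ((a - z * u - z ^ 2 * v) * (a - z ^ 4 * u - (z ^ 4) ^ 2 * v)) *
        ((a - z ^ 2 * u - (z ^ 2) ^ 2 * v) * (a - z ^ 3 * u - (z ^ 3) ^ 2 * v)) := by ring
  rw [h5, h1, h2, h4]
  rw [h4] at h3
  generalize z + z ^ 4 = s at h3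
  have h6 : s ^ 2 = 1 - s := by linear_combination -h3
  ring_nf
  simp only [h6]
  ring

end FifthRoot

/-- The ring homomorphism `f(X) ↦ f(z X)` into complex power series. -/
noncomputable def twist (z : ℂ) : ℤ⟦X⟧ →+* ℂ⟦X⟧ :=
  (rescale z).comp (PowerSeries.map (Int.castRingHom ℂ))

lemma coeff_twist (z : ℂ) (n : ℕ) (f : ℤ⟦X⟧) : coeff n (twist z f) = z ^ n * (coeff n f : ℤ) := by
  simp [twist, coeff_rescale]

lemma twist_X (z : ℂ) : twist z X = C z * X := by
  simp [twist, rescale_X]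

lemma twist_one_injective : Function.Injective (twist 1) := by
  intro f g h
  ext n
  have := congrArg (coeff n) h
  simpa [coeff_twist] using this

lemma twist_dil {z : ℂ} (hz : z ^ 5 = 1) (f : ℤ⟦X⟧) : twist z (dil f) = twist 1 (dil f) := by
  ext n
  rw [coeff_twist, coeff_twist, coeff_dil]
  split_ifs with h
  · obtain ⟨m, rfl⟩ := h
    rw [pow_mul, hz, one_pow, one_pow]
  · simp

lemma prod_twist_one_sub_X_pow {z : ℂ} (hz : IsPrimitiveRoot z 5) (i : ℕ) :
    ∏ k ∈ range 5, twist (z ^ k) (1 - X ^ i)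
      = if 5 ∣ i then twist 1 (1 - X ^ i) ^ 5 else twist 1 (dil (1 - X ^ i)) := by
  split_ifs with h
  · obtain ⟨m, rfl⟩ := h
    have : ∀ k, twist (z ^ k) (1 - X ^ (5 * m)) = twist 1 (1 - X ^ (5 * m)) := fun k => by
      have := twist_dil (z := z ^ k) (by rw [← pow_mul, mul_comm, pow_mul, hz.pow_eq_one, one_pow])
        (1 - X ^ m)
      simpa [dil_X, pow_mul] using this
    simp [this]
  · have hp : IsPrimitiveRoot (z ^ i) 5 :=
      hz.pow_of_coprime i (((Nat.Prime.coprime_iff_not_dvd Nat.prime_five).2 h).symm)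
    have hg := hp.geom_sum_eq_zero (by norm_num)
    have hg' : (1 : ℂ⟦X⟧) + C (z ^ i) + C (z ^ i) ^ 2 + C (z ^ i) ^ 3 + C (z ^ i) ^ 4 = 0 := by
      simpa [sum_range_succ] using congrArg (C (R := ℂ)) hg
    have := prod_one_sub_fifth_root_mul hg' ((X : ℂ⟦X⟧) ^ i)
    simp only [map_sub, map_one, map_pow, twist_X, dil_X, one_mul]
    rw [← pow_mul, mul_comm 5 i, pow_mul, ← this]
    refine prod_congr rfl fun k _ => ?_
    rw [mul_pow]
    simp only [← map_pow, ← pow_mul, mul_comm i k]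

lemma prod_twist_eulerProd {z : ℂ} (hz : IsPrimitiveRoot z 5) (n : ℕ) :
    (∏ k ∈ range 5, twist (z ^ k) (eulerProd (5 * n))) * twist 1 (dil (dil (eulerProd n)))
      = twist 1 (dil (eulerProd (5 * n))) * twist 1 (dil (eulerProd n)) ^ 5 := by
  induction n with
  | zero => simp [eulerProd_zero]
  | succ n ih =>
    rw [show 5 * (n + 1) = 5 * n + 1 + 1 + 1 + 1 + 1 by ring]
    simp only [eulerProd_succ, map_mul, prod_mul_distrib, prod_twist_one_sub_X_pow hz]
    rw [if_neg (by omega), if_neg (by omega), if_neg (by omega), if_neg (by omega),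
      if_pos (by omega)]
    have h1 : dil (dil (1 - X ^ (n + 1))) = dil (1 - X ^ (5 * n + 1 + 1 + 1 + 1 + 1)) := by
      simp only [map_sub, map_one, map_pow, dil_X, ← pow_mul]
      congr 2
    have h2 : (1 : ℤ⟦X⟧) - X ^ (5 * n + 1 + 1 + 1 + 1 + 1) = dil (1 - X ^ (n + 1)) := by
      simp only [map_sub, map_one, map_pow, dil_X, ← pow_mul]
      congr 2
    rw [h1, h2]
    linear_combination twist 1 (dil (1 - X ^ (5 * n + 1))) *
      twist 1 (dil (1 - X ^ (5 * n + 1 + 1))) * twist 1 (dil (1 - X ^ (5 * n + 1 + 1 + 1))) *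
      twist 1 (dil (1 - X ^ (5 * n + 1 + 1 + 1 + 1))) * twist 1 (dil (dil (1 - X ^ (n + 1)))) *
      twist 1 (dil (1 - X ^ (n + 1))) ^ 5 * ih

lemma prod_twist_euler {z : ℂ} (hz : IsPrimitiveRoot z 5) :
    (∏ k ∈ range 5, twist (z ^ k) euler) * twist 1 (dil (dil euler)) = twist 1 (dil euler) ^ 6 := by
  ext n
  let I : Ideal ℂ⟦X⟧ := Ideal.span {X ^ (n + 1)}
  let π := Ideal.Quotient.mk I
  have hdil : (X : ℤ⟦X⟧) ^ (n + 1) ∣ dil (X ^ (n + 1)) := by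
    rw [map_pow, dil_X, ← pow_mul]; exact pow_dvd_pow _ (by omega)
  have key : ∀ (y : ℂ) (f g : ℤ⟦X⟧), X ^ (n + 1) ∣ f - g → π (twist y f) = π (twist y g) := by
    intro y f g h
    rw [Ideal.Quotient.eq, Ideal.mem_span_singleton, ← map_sub]
    refine Dvd.dvd.trans ?_ (map_dvd (twist y) h)
    rw [map_pow, twist_X, mul_pow]
    exact dvd_mul_left _ _
  have key2 : ∀ f g : ℤ⟦X⟧, X ^ (n + 1) ∣ f - g → X ^ (n + 1) ∣ dil f - dil g := by
    intro f g h
    rw [← map_sub]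
    exact hdil.trans (map_dvd dil h)
  have h1 := X_pow_dvd_euler_sub (le_refl n)
  have h2 := X_pow_dvd_euler_sub (show n ≤ 5 * n by omega)
  have h3 := congrArg π (prod_twist_eulerProd hz n)
  simp only [map_mul, map_prod, map_pow, ← key _ _ _ h2, ← key _ _ _ (key2 _ _ h2),
    ← key _ _ _ (key2 _ _ h1), ← key _ _ _ (key2 _ _ (key2 _ _ h1))] at h3
  rw [← pow_succ', ← map_prod, ← map_mul, ← map_pow, Ideal.Quotient.eq,
    Ideal.mem_span_singleton] at h3
  have := X_pow_dvd_iff.1 h3 n (by omega)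
  rwa [map_sub, sub_eq_zero] at this

/-- Ramanujan's identity for the norm of the `5`-dissection of Euler's product. -/
lemma norm_mul_dil_euler :
    (eulerA ^ 5 - 11 * X * dil euler ^ 5 - X ^ 2 * eulerB ^ 5) * dil euler = euler ^ 6 := by
  obtain ⟨z, hz⟩ : ∃ z : ℂ, IsPrimitiveRoot z 5 :=
    ⟨_, Complex.isPrimitiveRoot_exp 5 (by norm_num)⟩
  refine dil_injective (twist_one_injective ?_)
  rw [map_mul dil, map_mul, map_pow, map_pow (twist 1), ← prod_twist_euler hz]
  congr 1
  have hg := hz.geom_sum_eq_zero (by norm_num)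
  have hg' : (1 : ℂ⟦X⟧) + C z + C z ^ 2 + C z ^ 3 + C z ^ 4 = 0 := by
    simpa [sum_range_succ] using congrArg (C (R := ℂ)) hg
  have h1 : ∀ k, twist (z ^ k) euler = twist 1 (dil eulerA)
      - C z ^ k * (X * twist 1 (dil (dil euler))) -
        (C z ^ k) ^ 2 * (X ^ 2 * twist 1 (dil eulerB)) := by
    intro k
    have hk : (z ^ k) ^ 5 = 1 := by rw [← pow_mul, mul_comm, pow_mul, hz.pow_eq_one, one_pow]
    conv_lhs => rw [euler_eq]
    simp only [map_sub, map_mul, map_pow, twist_X]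
    rw [twist_dil hk, twist_dil hk, twist_dil hk]
    ring
  simp_rw [h1]
  rw [prod_fifth_root_norm hg']
  have h2 := congrArg (fun f => twist 1 (dil f)) eulerA_mul_eulerB
  simp only [map_mul, map_pow] at h2
  simp only [map_sub, map_mul, map_pow, map_ofNat, twist_X, dil_X, map_one, one_mul]
  generalize twist 1 (dil eulerA) = a at *
  generalize twist 1 (dil eulerB) = b at *
  generalize twist 1 (dil (dil euler)) = e at *
  linear_combination (5 * X ^ 5 * e ^ 3 + 5 * X ^ 5 * e * (a * b + e ^ 2)) * h2

lemma sect_four_euler_pow_four : sect 4 (euler ^ 4) = -5 * dil euler ^ 4 := by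
  have h : euler ^ 4 = ∑ s ∈ range 5, X ^ s * dil ((fun s => match s with
      | 0 => eulerA ^ 4 - 12 * X * eulerA * dil euler * eulerB ^ 2
          + 4 * X * dil euler ^ 3 * eulerB
      | 1 => -4 * eulerA ^ 3 * dil euler - 4 * X * eulerA * eulerB ^ 3
          + 6 * X * dil euler ^ 2 * eulerB ^ 2
      | 2 => -4 * eulerA ^ 3 * eulerB + 6 * eulerA ^ 2 * dil euler ^ 2
          + 4 * X * dil euler * eulerB ^ 3
      | 3 => 12 * eulerA ^ 2 * dil euler * eulerB - 4 * eulerA * dil euler ^ 3 + X * eulerB ^ 4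
      | _ => 6 * eulerA ^ 2 * eulerB ^ 2 - 12 * eulerA * dil euler ^ 2 * eulerB
          + dil euler ^ 4) s) := by
    conv_lhs => rw [euler_eq]
    simp only [sum_range_succ, sum_range_zero, map_add, map_sub, map_mul, map_pow, map_neg,
      map_ofNat, dil_X]
    ring
  rw [h, sect_sum (by norm_num)]
  change 6 * eulerA ^ 2 * eulerB ^ 2 - 12 * eulerA * dil euler ^ 2 * eulerB + dil euler ^ 4 = _
  linear_combination (6 * eulerA * eulerB - 6 * dil euler ^ 2) * eulerA_mul_eulerB

/-- The norm of the `5`-dissection of Euler's product. -/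
noncomputable def eulerNorm : ℤ⟦X⟧ := eulerA ^ 5 - 11 * X * dil euler ^ 5 - X ^ 2 * eulerB ^ 5

/-- The product of the four nontrivial conjugates of Euler's product under
`X ↦ z * X` for a fifth root of unity `z`. -/
noncomputable def eulerCofactor : ℤ⟦X⟧ :=
  dil eulerA ^ 4 + X * (dil eulerA ^ 3 * dil (dil euler))
    + 2 * X ^ 2 * (dil eulerA ^ 2 * dil (dil euler) ^ 2)
    + 3 * X ^ 3 * (dil eulerA * dil (dil euler) ^ 3) + 5 * X ^ 4 * dil (dil euler) ^ 4
    - 3 * X ^ 5 * (dil eulerB * dil (dil euler) ^ 3)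
    + 2 * X ^ 6 * (dil eulerB ^ 2 * dil (dil euler) ^ 2)
    - X ^ 7 * (dil eulerB ^ 3 * dil (dil euler)) + X ^ 8 * dil eulerB ^ 4

lemma euler_mul_eulerCofactor : euler * eulerCofactor = dil eulerNorm := by
  have h := congrArg dil eulerA_mul_eulerB
  conv_lhs => rw [euler_eq]
  simp only [eulerCofactor, eulerNorm, map_sub, map_mul, map_pow, map_ofNat, dil_X] at h ⊢
  generalize dil eulerA = a at *
  generalize dil eulerB = b at *
  generalize dil (dil euler) = e at *
  linear_combination (- X ^ 2 * a ^ 3 - X ^ 3 * a ^ 2 * e - 2 * X ^ 4 * a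
    * e ^ 2 - 6 * X ^ 5 * e ^ 3 + 2 * X ^ 6 * b * e ^ 2 - X ^ 7 * b ^ 2 * e
     + X ^ 8 * b ^ 3) * h

lemma sect_three_eulerCofactor_sq :
    sect 3 (eulerCofactor ^ 2) = 10 * dil euler ^ 3 * eulerNorm + 125 * X * dil euler ^ 8 := by
  have h : eulerCofactor ^ 2 = ∑ s ∈ range 5, X ^ s * dil ((fun s => match s with
      | 0 => eulerA ^ 8 + 22 * X * eulerA ^ 3 * dil euler ^ 5 - 6 * X * eulerA ^ 4 * eulerB *
          dil euler ^ 3 + 29 * X ^ 2 * eulerB ^ 2 * dil euler ^ 6 - 6 * X ^ 2 * eulerA * eulerB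
          ^ 3 * dil euler ^ 4 + 4 * X ^ 2 * eulerA ^ 2 * eulerB ^ 4 * dil euler ^ 2 - 2 * X ^ 3
          * eulerB ^ 7 * dil euler
      | 1 => 2 * eulerA ^ 7 * dil euler + 29 * X * eulerA ^ 2 * dil euler ^ 6 - 6 * X * eulerA ^
          3 * eulerB * dil euler ^ 4 + 4 * X * eulerA ^ 4 * eulerB ^ 2 * dil euler ^ 2 - 22 * X
          ^ 2 * eulerB ^ 3 * dil euler ^ 5 + 6 * X ^ 2 * eulerA * eulerB ^ 4 * dil euler ^ 3 + X
          ^ 3 * eulerB ^ 8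
      | 2 => 5 * eulerA ^ 6 * dil euler ^ 2 + 30 * X * eulerA * dil euler ^ 7 - 12 * X * eulerA
          ^ 2 * eulerB * dil euler ^ 5 + 4 * X * eulerA ^ 3 * eulerB ^ 2 * dil euler ^ 3 - 2 * X
          * eulerA ^ 4 * eulerB ^ 3 * dil euler + 20 * X ^ 2 * eulerB ^ 4 * dil euler ^ 4
      | 3 => 10 * eulerA ^ 5 * dil euler ^ 3 + 25 * X * dil euler ^ 8 - 18 * X * eulerA * eulerB
          * dil euler ^ 6 + 8 * X * eulerA ^ 2 * eulerB ^ 2 * dil euler ^ 4 - 2 * X * eulerA ^ 3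
          * eulerB ^ 3 * dil euler ^ 2 + 2 * X * eulerA ^ 4 * eulerB ^ 4 - 10 * X ^ 2 * eulerB ^
          5 * dil euler ^ 3
      | _ => 20 * eulerA ^ 4 * dil euler ^ 4 - 30 * X * eulerB * dil euler ^ 7 + 12 * X * eulerA
          * eulerB ^ 2 * dil euler ^ 5 - 4 * X * eulerA ^ 2 * eulerB ^ 3 * dil euler ^ 3 + 2 * X
          * eulerA ^ 3 * eulerB ^ 4 * dil euler + 5 * X ^ 2 * eulerB ^ 6 * dil euler ^ 2) s) := by
    simp only [eulerCofactor, sum_range_succ, sum_range_zero, map_add, map_sub, map_mul, map_pow,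
      map_ofNat, dil_X]
    ring
  rw [h, sect_sum (by norm_num)]
  simp only [eulerNorm]
  linear_combination (-10 * X * dil euler ^ 6 + 8 * X * eulerA * eulerB * dil euler ^ 4
    + 2 * X * eulerA ^ 3 * eulerB ^ 3) * eulerA_mul_eulerB

/-- The generating function of `5`-core partitions, `∏ (1 - X ^ (5 * i)) ^ 5 / (1 - X ^ i)`. -/
noncomputable def coreSeries : ℤ⟦X⟧ := dil euler ^ 5 * ↑isUnit_euler.unit⁻¹

lemma euler_mul_coreSeries : euler * coreSeries = dil euler ^ 5 := by
  rw [coreSeries, mul_left_comm, IsUnit.mul_val_inv, mul_one]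

lemma euler_ne_zero : euler ≠ 0 := isUnit_euler.ne_zero

lemma sect_three_coreSeries_sq : ∃ f,
    sect 3 (coreSeries ^ 2) = 10 * (euler ^ 4 * dil euler ^ 4) + 125 * f := by
  have h1 : dil (eulerNorm ^ 2) * coreSeries ^ 2 = dil (euler ^ 10) * eulerCofactor ^ 2 := by
    rw [map_pow, ← euler_mul_eulerCofactor, map_pow,
      show dil euler ^ 10 = (dil euler ^ 5) ^ 2 by ring, ← euler_mul_coreSeries]
    ring
  have h2 := congrArg (sect 3) h1
  rw [sect_dil_mul (by norm_num), sect_dil_mul (by norm_num), sect_three_eulerCofactor_sq] at h2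
  have h3 : eulerNorm * dil euler = euler ^ 6 := norm_mul_dil_euler
  have h4 : euler ^ 10 * (euler ^ 2 * sect 3 (coreSeries ^ 2)) =
      euler ^ 10 * (10 * euler ^ 6 * dil euler ^ 4 + 125 * X * dil euler ^ 10) := by
    linear_combination dil euler ^ 2 * h2 + (10 * euler ^ 10 * dil euler ^ 4
      - sect 3 (coreSeries ^ 2) * (eulerNorm * dil euler + euler ^ 6)) * h3
  have h5 := mul_left_cancel₀ (pow_ne_zero _ euler_ne_zero) h4
  obtain ⟨Q, hQ⟩ := isUnit_euler.exists_right_inv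
  refine ⟨X * dil euler ^ 10 * Q ^ 2, ?_⟩
  refine mul_left_cancel₀ (pow_ne_zero 2 euler_ne_zero) (h5.trans ?_)
  linear_combination -125 * X * dil euler ^ 10 * (euler * Q + 1) * hQ

lemma sect_four_sect_four_sect_three_coreSeries_sq :
    ∃ f, sect 4 (sect 4 (sect 3 (coreSeries ^ 2))) = 125 * f := by
  obtain ⟨f, hf⟩ := sect_three_coreSeries_sq
  have hc : ∀ (r : ℕ) (m : ℤ) (g : ℤ⟦X⟧), sect r ((m : ℤ⟦X⟧) * g) = (m : ℤ⟦X⟧) * sect r g := by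
    intro r m g
    rw [← zsmul_eq_mul, map_zsmul, zsmul_eq_mul]
  have h10 := fun r => hc r 10
  have h125 := fun r => hc r 125
  have h5 := fun r => hc r (-5)
  push_cast at h10 h125 h5
  rw [hf, map_add, h10, h125, mul_comm (euler ^ 4), ← map_pow, sect_dil_mul (by norm_num),
    sect_four_euler_pow_four, map_add, h10, h125, mul_left_comm, h5, mul_comm (euler ^ 4), ← map_pow,
    sect_dil_mul (by norm_num), sect_four_euler_pow_four]
  exact ⟨2 * (euler ^ 4 * dil euler ^ 4) + sect 4 (sect 4 f), by ring⟩

lemma natCast_dvd_of_coeff {m : ℕ} {f : ℤ⟦X⟧} (h : ∀ n, (m : ℤ) ∣ coeff n f) :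
    (m : ℤ⟦X⟧) ∣ f := by
  choose g hg using h
  refine ⟨.mk g, ?_⟩
  ext n
  rw [← map_natCast (C (R := ℤ)), coeff_C_mul, coeff_mk, hg]

lemma dvd_coeff_of_natCast_dvd {m : ℕ} {f : ℤ⟦X⟧} (h : (m : ℤ⟦X⟧) ∣ f) (n : ℕ) :
    (m : ℤ) ∣ coeff n f := by
  obtain ⟨g, rfl⟩ := h
  rw [← map_natCast (C (R := ℤ)), coeff_C_mul]
  simp

lemma five_dvd_pow_sub_dil (f : ℤ⟦X⟧) : ((5 : ℕ) : ℤ⟦X⟧) ∣ f ^ 5 - dil f := by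
  refine natCast_dvd_of_coeff fun n => ?_
  have : Fact (Nat.Prime 5) := ⟨by norm_num⟩
  have h1 : (PowerSeries.map (Int.castRingHom (ZMod 5)) f).expand 5 (by norm_num)
      = PowerSeries.map (Int.castRingHom (ZMod 5)) f ^ 5 := by
    have := MvPowerSeries.map_frobenius_expand (σ := Unit) (R := ZMod 5) 5 (by norm_num)
      (f := PowerSeries.map (Int.castRingHom (ZMod 5)) f)
    rw [ZMod.frobenius_zmod, MvPowerSeries.map_id] at this
    exact this
  rw [← map_expand, ← map_pow] at h1
  have h2 := congrArg (coeff n) h1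
  rw [coeff_map, coeff_map] at h2
  rw [map_sub]
  exact (ZMod.intCast_eq_intCast_iff_dvd_sub _ _ 5).1 h2

lemma pow_sub_dil_dvd (f : ℤ⟦X⟧) :
    ((125 : ℕ) : ℤ⟦X⟧) ∣ f ^ 3125 - dil (dil (dil (f ^ 25))) := by
  have h1 : ∀ g : ℤ⟦X⟧, ((125 : ℕ) : ℤ⟦X⟧) ∣ g ^ 125 - dil (g ^ 25) := by
    intro g
    have := dvd_sub_pow_of_dvd_sub (five_dvd_pow_sub_dil g) 2
    rw [map_pow]
    convert this using 1
    · norm_num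
    · ring
  have h2 : ∀ g h : ℤ⟦X⟧, ((125 : ℕ) : ℤ⟦X⟧) ∣ g - h → ((125 : ℕ) : ℤ⟦X⟧) ∣ dil g - dil h := by
    intro g h hgh
    simpa only [map_natCast, map_sub] using map_dvd dil hgh
  have h3 := dvd_add (dvd_add (h1 (f ^ 25)) (h2 _ _ (h1 (f ^ 5)))) (h2 _ _ (h2 _ _ (h1 f)))
  simp only [← pow_mul] at h3
  simpa using h3

theorem dvd_coeff_coreSeries_pow (i n : ℕ) :
    (125 : ℤ) ∣ coeff (125 * n + 123) (coreSeries ^ (3125 * i + 2)) := by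
  obtain ⟨f, hf⟩ := sect_four_sect_four_sect_three_coreSeries_sq
  have h1 : ((125 : ℕ) : ℤ⟦X⟧) ∣ coreSeries ^ (3125 * i + 2)
      - dil (dil (dil ((coreSeries ^ 25) ^ i))) * coreSeries ^ 2 := by
    have := (pow_sub_dil_dvd coreSeries).trans (sub_dvd_pow_sub_pow _ _ i)
    rw [← map_pow, ← map_pow, ← map_pow, ← pow_mul] at this
    rw [pow_add, ← sub_mul]
    exact this.mul_right _
  have h2 := dvd_coeff_of_natCast_dvd h1 (125 * n + 123)
  rw [map_sub] at h2
  refine (dvd_iff_dvd_of_dvd_sub h2).2 ?_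
  rw [show 125 * n + 123 = 5 * (5 * (5 * n + 4) + 4) + 3 by ring, ← coeff_sect, ← coeff_sect,
    ← coeff_sect, sect_dil_mul (by norm_num), sect_dil_mul (by norm_num),
    sect_dil_mul (by norm_num), hf]
  exact dvd_coeff_of_natCast_dvd (Dvd.dvd.mul_left ⟨f, by norm_num⟩ _) n

lemma coeff_prod_univ {ι : Type*} [Fintype ι] [DecidableEq ι] (f : ι → ℤ⟦X⟧) (n : ℕ) :
    coeff n (∏ j, f j) = ∑ l ∈ piAntidiag univ n, ∏ j, coeff (l j) (f j) := by
  rw [coeff_prod]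
  refine sum_nbij' (fun l => ⇑l) (fun l => Finsupp.equivFunOnFinite.symm l) ?_ ?_ ?_ ?_ ?_
  · intro l hl
    rw [mem_finsuppAntidiag] at hl
    simpa using hl.1
  · intro l hl
    rw [mem_piAntidiag] at hl
    simpa [mem_finsuppAntidiag] using hl.1
  · intro l _; ext; simp
  · intro l _; ext; simp
  · intro l _; rfl

lemma coeff_polynomial_prod_univ {R ι : Type*} [CommRing R] [Fintype ι] [DecidableEq ι]
    (f : ι → Polynomial R) (n : ℕ) :
    (∏ j, f j).coeff n = ∑ l ∈ piAntidiag univ n, ∏ j, (f j).coeff (l j) := by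
  rw [← Polynomial.coeff_coe, ← Polynomial.coeToPowerSeries.ringHom_apply, map_prod, coeff_prod]
  refine sum_nbij' (fun l => ⇑l) (fun l => Finsupp.equivFunOnFinite.symm l) ?_ ?_ ?_ ?_ ?_
  · intro l hl
    rw [mem_finsuppAntidiag] at hl
    simpa using hl.1
  · intro l hl
    rw [mem_piAntidiag] at hl
    simpa [mem_finsuppAntidiag] using hl.1
  · intro l _; ext; simp
  · intro l _; ext; simp
  · intro l _
    simp

lemma prod_range_five_mul {R : Type*} [CommMonoid R] (g : ℕ → R) (n : ℕ) :
    ∏ i ∈ range (5 * n), g i = ∏ r : Fin 5, ∏ j ∈ range n, g (r + 5 * j) := by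
  induction n with
  | zero => simp
  | succ n ih =>
    rw [show 5 * (n + 1) = 5 * n + 1 + 1 + 1 + 1 + 1 by ring]
    simp only [prod_range_succ, ih, prod_mul_distrib]
    rw [Fin.prod_univ_five fun r : Fin 5 => g (r + 5 * n)]
    change _ = _ * (g (0 + 5 * n) * g (1 + 5 * n) * g (2 + 5 * n) * g (3 + 5 * n) * g (4 + 5 * n))
    simp only [add_comm _ (5 * n), mul_assoc, add_zero]

/-- The weight of a vector of bead counts on the five runners of an abacus. -/
def weight (m : Fin 5 → ℕ) : ℕ := ∑ r, (5 * (m r).choose 2 + r * m r)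

lemma coeff_prod_runner (r n k : ℕ) :
    (∏ j ∈ range n, (1 + Polynomial.C ((X : ℤ⟦X⟧) ^ (r + 5 * j)) * Polynomial.X)).coeff k
      = X ^ (5 * k.choose 2 + r * k) * dil (qBinom n k) := by
  have h : ∏ j ∈ range n, (1 + Polynomial.C ((X : ℤ⟦X⟧) ^ (r + 5 * j)) * Polynomial.X)
      = ((∏ i ∈ range n, (Polynomial.C 1 + Polynomial.C ((X : ℤ⟦X⟧) ^ i) * Polynomial.X)).map
        dil.toRingHom).comp (Polynomial.C (X ^ r) * Polynomial.X) := by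
    rw [Polynomial.map_prod, Polynomial.prod_comp]
    refine prod_congr rfl fun j _ => ?_
    simp [dil_X, pow_add, pow_mul]
    ring
  rw [h, Polynomial.comp_C_mul_X_coeff, Polynomial.coeff_map, coeff_prod_C_add_C_mul_X]
  simp [dil_X, pow_add, pow_mul]
  ring

lemma X_pow_mul_qBinom_eq_sum (n k : ℕ) :
    X ^ k.choose 2 * qBinom (5 * n) k
      = ∑ m ∈ piAntidiag (univ : Finset (Fin 5)) k,
        X ^ weight m * ∏ r, dil (qBinom n (m r)) := by
  have h := coeff_prod_C_add_C_mul_X 1 (5 * n) k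
  rw [one_pow, mul_one, prod_range_five_mul, coeff_polynomial_prod_univ] at h
  rw [← h]
  refine sum_congr rfl fun m _ => ?_
  simp only [Polynomial.C_1, coeff_prod_runner, prod_mul_distrib, weight, prod_pow_eq_pow_sum]

lemma two_mul_choose_two (n : ℕ) : (2 * n.choose 2 : ℤ) = n * (n - 1) := by
  have := Nat.div_mul_cancel (even_iff_two_dvd.1 (Nat.even_mul_pred_self n))
  rw [← Nat.choose_two_right] at this
  obtain _ | n := n
  · simp
  · rw [Nat.add_sub_cancel] at this
    zify at this
    push_cast
    linarith

lemma weight_bound {m : Fin 5 → ℕ} {M n : ℕ} (hm : ∑ r, m r = 5 * M)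
    (hw : weight m ≤ (5 * M).choose 2 + n) :
    (5 * M).choose 2 ≤ weight m ∧ ∀ r, m r ≤ M + (n + 1) ∧ M ≤ m r + (n + 1) := by
  have key : ∀ (r : Fin 5) (c : ℤ), 0 ≤ 5 * c * (c - 1) + 2 * (r : ℕ) * c ∧
      2 * (|c| - 1) ≤ 5 * c * (c - 1) + 2 * (r : ℕ) * c := by
    intro r c
    have h0 : (0 : ℤ) ≤ (r : ℕ) := by positivity
    have h4 : ((r : ℕ) : ℤ) ≤ 4 := by have := r.2; omega
    generalize ((r : ℕ) : ℤ) = s at *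
    rcases le_or_gt c 0 with hc | hc
    · rw [abs_of_nonpos hc]
      constructor <;> nlinarith [mul_nonneg (neg_nonneg.2 hc) (sub_nonneg.2 h4),
        mul_nonneg (neg_nonneg.2 hc) (neg_nonneg.2 hc), sq_nonneg (2 * c + 1)]
    · rw [abs_of_pos hc]
      have h1 : 0 ≤ c - 1 := by omega
      constructor <;> nlinarith [mul_nonneg hc.le h0, mul_nonneg hc.le h1]
  have hsum : (2 * weight m : ℤ) - 2 * (5 * M).choose 2
      = ∑ r : Fin 5, (5 * (m r - M : ℤ) * (m r - M - 1) + 2 * (r : ℕ) * (m r - M)) := by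
    have h1 : (2 * weight m : ℤ) =
        ∑ r : Fin 5, (5 * (m r * (m r - 1) : ℤ) + 2 * (r : ℕ) * m r) := by
      rw [weight]
      push_cast
      rw [mul_sum]
      refine sum_congr rfl fun r _ => ?_
      rw [← two_mul_choose_two]
      ring
    have h2 : (∑ r, (m r : ℤ)) = 5 * M := by exact_mod_cast hm
    rw [h1, two_mul_choose_two]
    simp only [Fin.sum_univ_five] at h2 ⊢
    push_cast [show ((3 : Fin 5) : ℕ) = 3 from rfl, show ((4 : Fin 5) : ℕ) = 4 from rfl,
      show ((2 : Fin 5) : ℕ) = 2 from rfl, show ((1 : Fin 5) : ℕ) = 1 from rfl,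
      show ((0 : Fin 5) : ℕ) = 0 from rfl]
    linear_combination 10 * (M : ℤ) * h2
  have hnonneg := fun r => (key r (m r - M)).1
  constructor
  · have := sum_nonneg fun r (_ : r ∈ (univ : Finset (Fin 5))) => hnonneg r
    zify
    linarith
  · intro r
    have h1 := single_le_sum (fun r _ => hnonneg r) (mem_univ r)
    have h2 := (key r (m r - M)).2
    have h3 : |(m r - M : ℤ)| ≤ n + 1 := by zify at hw; linarith
    rw [abs_le] at h3
    omega

lemma coeff_coreSeries {M n : ℕ} (hM : 2 * n + 2 ≤ M) :
    coeff n coreSeries = #{m ∈ piAntidiag (univ : Finset (Fin 5)) (5 * M) |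
      weight m = n + (5 * M).choose 2} := by
  have hterm : ∀ m ∈ piAntidiag (univ : Finset (Fin 5)) (5 * M),
      (X : ℤ⟦X⟧) ^ ((5 * M).choose 2 + n + 1) ∣
        X ^ weight m * ∏ r, dil (euler * qBinom (2 * M) (m r)) - X ^ weight m := by
    intro m hm
    rw [mem_piAntidiag] at hm
    by_cases hw : weight m ≤ (5 * M).choose 2 + n
    · obtain ⟨h1, h2⟩ := weight_bound hm.1 hw
      have h3 : ∀ r, (X : ℤ⟦X⟧) ^ (n + 1) ∣ dil (euler * qBinom (2 * M) (m r)) - 1 := by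
        intro r
        have := X_pow_dvd_euler_mul_qBinom_sub (r := n) (k := m r) (l := 2 * M - m r)
          (by have := h2 r; omega) (by have := h2 r; omega)
        rw [Nat.add_sub_cancel' (by have := h2 r; omega)] at this
        have := map_dvd dil this
        rw [map_pow, dil_X, ← pow_mul, map_sub, map_one] at this
        exact (pow_dvd_pow _ (by omega)).trans this
      have h4 : (X : ℤ⟦X⟧) ^ (n + 1) ∣ ∏ r, dil (euler * qBinom (2 * M) (m r)) - 1 := by
        simp only [← Ideal.mem_span_singleton, ← Ideal.Quotient.eq] at h3 ⊢
        rw [map_prod, prod_congr rfl fun r _ => h3 r]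
        simp
      rw [← mul_sub_one]
      refine Dvd.dvd.trans ?_ (mul_dvd_mul (pow_dvd_pow X h1) h4)
      rw [← pow_add, add_assoc]
    · rw [← mul_sub_one]
      exact Dvd.dvd.mul_right (pow_dvd_pow _ (by omega)) _
  have h1 := dvd_sum hterm
  have h3 : (X : ℤ⟦X⟧) ^ ((5 * M).choose 2 + n + 1) ∣
      X ^ (5 * M).choose 2 * coreSeries - dil euler ^ 5 *
        (X ^ (5 * M).choose 2 * qBinom (5 * (2 * M)) (5 * M)) := by
    have h := X_pow_dvd_euler_mul_qBinom_sub (r := n) (k := 5 * M) (l := 5 * M) (by omega)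
      (by omega)
    rw [← euler_mul_coreSeries, show 5 * (2 * M) = 5 * M + 5 * M by ring, add_assoc, pow_add]
    refine (mul_dvd_mul_left _ h).trans ⟨-coreSeries, by ring⟩
  have h4 : dil euler ^ 5 * ∑ m ∈ piAntidiag (univ : Finset (Fin 5)) (5 * M),
      X ^ weight m * ∏ r, dil (qBinom (2 * M) (m r)) =
      ∑ m ∈ piAntidiag (univ : Finset (Fin 5)) (5 * M),
        X ^ weight m * ∏ r, dil (euler * qBinom (2 * M) (m r)) := by
    simp only [mul_sum, map_mul, prod_mul_distrib, prod_const, card_univ, Fintype.card_fin]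
    exact sum_congr rfl fun _ _ => by ring
  rw [X_pow_mul_qBinom_eq_sum, h4] at h3
  have h5 := dvd_add h3 h1
  rw [sum_sub_distrib, sub_add_sub_cancel] at h5
  have h6 := coeff_X_pow_eq_of_dvd_sub h5 (show n + (5 * M).choose 2 < _ by omega)
  rw [coeff_X_pow_mul, map_sum] at h6
  simp only [h6, coeff_X_pow, card_filter, Nat.cast_sum, eq_comm]
  simp

end FiveCore

namespace FiveCore

open Finset

/-- The `i`-th largest part of a partition, or `0` if there are at most `i` parts. -/
def row {n : ℕ} (p : n.Partition) (i : ℕ) : ℕ := (p.parts.sort (· ≤ ·)).reverse.getD i 0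

lemma lt_getD_iff {l : List ℕ} (hl : l.Pairwise (· ≥ ·)) (i j : ℕ) :
    j < l.getD i 0 ↔ i < (l.filter (j < ·)).length := by
  induction l generalizing i with
  | nil => simp
  | cons a l ih =>
    rw [List.pairwise_cons] at hl
    by_cases h : j < a
    · rw [List.filter_cons_of_pos (by simpa using h)]
      cases i with
      | zero => simpa using h
      | succ i => simpa using ih hl.2 i
    · have h1 : ∀ b ∈ a :: l, ¬ j < b := by
        intro b hb
        rcases List.mem_cons.1 hb with rfl | hb
        · exact h
        · have := hl.1 b hb; omega
      have h2 : (a :: l).filter (j < ·) = [] := by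
        rw [List.filter_eq_nil_iff]
        simpa using h1
      rw [h2]
      simp only [List.length_nil, not_lt_zero, iff_false]
      by_cases hi : i < (a :: l).length
      · rw [List.getD_eq_getElem _ _ hi]
        exact h1 _ (List.getElem_mem hi)
      · rw [List.getD_eq_default _ _ (by omega)]
        omega

lemma lt_row_iff {n : ℕ} (p : n.Partition) (i j : ℕ) :
    j < row p i ↔ i < (p.parts.filter (fun x => j < x)).card := by
  rw [row, lt_getD_iff (by rw [List.pairwise_reverse]; exact p.parts.pairwise_sort _)]
  rw [List.filter_reverse, List.length_reverse]
  conv_rhs => rw [← p.parts.sort_eq (· ≤ ·), Multiset.filter_coe, Multiset.coe_card]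

lemma row_antitone {n : ℕ} (p : n.Partition) : Antitone (row p) := by
  intro i i' h
  by_contra! h'
  rw [lt_row_iff] at h'
  have := (lt_row_iff p i (row p i)).2 (by omega)
  omega

lemma map_row_range {n K : ℕ} (p : n.Partition) (hK : n ≤ K) :
    (Multiset.range K).map (row p) = p.parts + Multiset.replicate (K - p.parts.card) 0 := by
  have hc : p.parts.card ≤ n := by
    have := Multiset.card_nsmul_le_sum (s := p.parts) (a := 1) fun x hx => p.parts_pos hx
    simpa [p.parts_sum] using this
  have h : (List.range K).map (row p)
      = (p.parts.sort (· ≤ ·)).reverse ++ List.replicate (K - p.parts.card) 0 := by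
    refine List.ext_getElem (by simp; omega) fun i h1 h2 => ?_
    rw [List.getElem_map, List.getElem_range, row, List.getElem_append]
    split_ifs with h3
    · rw [List.getD_eq_getElem]
    · rw [List.getD_eq_default _ _ (by omega), List.getElem_replicate]
  have := congrArg (fun l : List ℕ => (l : Multiset ℕ)) h
  simp only [← Multiset.coe_add, Multiset.coe_reverse, Multiset.sort_eq] at this
  exact this

lemma sum_row {n K : ℕ} (p : n.Partition) (hK : n ≤ K) : ∑ i ∈ range K, row p i = n := by
  have := congrArg Multiset.sum (map_row_range p hK)
  rw [Multiset.sum_add, p.parts_sum, Multiset.sum_replicate, smul_zero, add_zero] at this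
  exact this

lemma row_eq_zero {n i : ℕ} (p : n.Partition) (hi : n ≤ i) : row p i = 0 := by
  have h1 := sum_row p hi
  have h2 := sum_row p (hi.trans (Nat.le_succ i))
  rw [sum_range_succ, h1] at h2
  omega

lemma row_injective {n : ℕ} {p q : n.Partition} (h : ∀ i < n, row p i = row q i) : p = q := by
  have h1 : ∀ p : n.Partition, p.parts = ((Multiset.range n).map (row p)).filter (· ≠ 0) := by
    intro p
    rw [map_row_range p le_rfl, Multiset.filter_add, Multiset.filter_eq_self.2,
      Multiset.filter_eq_nil.2, add_zero]
    · intro a ha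
      simp [Multiset.eq_of_mem_replicate ha]
    · intro a ha
      exact (p.parts_pos ha).ne'
  ext1
  rw [h1 p, h1 q]
  congr 1
  exact Multiset.map_congr rfl fun i hi => h i (Multiset.mem_range.1 hi)

lemma mem_iff_lt_card {S : Finset ℕ} (hS : ∀ i ∈ S, ∀ j ≤ i, j ∈ S) (i : ℕ) :
    i ∈ S ↔ i < #S := by
  constructor
  · intro hi
    have : range (i + 1) ⊆ S := fun j hj => hS i hi j (by rw [mem_range] at hj; omega)
    simpa using card_le_card this
  · intro hi
    by_contra h
    have : S ⊆ range i := by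
      intro j hj
      rw [mem_range]
      by_contra! hij
      exact h (hS j hj i hij)
    have := card_le_card this
    rw [card_range] at this
    omega

lemma exists_row_eq {n K : ℕ} {a : ℕ → ℕ} (ha : Antitone a) (hK : ∀ i, K ≤ i → a i = 0)
    (hn : ∑ i ∈ range K, a i = n) : ∃ p : n.Partition, ∀ i, row p i = a i := by
  have hn' : ((Multiset.range K).map a).sum = n := hn
  refine ⟨Nat.Partition.ofSums n ((Multiset.range K).map a) hn', fun i => ?_⟩
  refine eq_of_forall_lt_iff fun j => ?_
  have h1 : #{i ∈ range K | j < a i} = (Multiset.filter (fun x => j < x)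
      (Nat.Partition.ofSums n ((Multiset.range K).map a) hn').parts).card := by
    rw [Nat.Partition.ofSums_parts, Multiset.filter_filter, Multiset.filter_map, Multiset.card_map,
      card_def, filter_val, range_val]
    congr 1
    refine Multiset.filter_congr fun i _ => ?_
    simp
    omega
  rw [lt_row_iff, ← h1, ← mem_iff_lt_card, mem_filter, mem_range]
  · refine ⟨fun h => h.2, fun h => ⟨?_, h⟩⟩
    by_contra! hi
    rw [hK i hi] at h
    omega
  · intro i hi i' hi'
    rw [mem_filter, mem_range] at hi ⊢
    exact ⟨by omega, hi.2.trans_le (ha hi')⟩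

/-- The position of the `i`-th smallest bead in the abacus with `K` beads of a partition. -/
def beadPos {n : ℕ} (p : n.Partition) (K i : ℕ) : ℕ := row p (K - 1 - i) + i

/-- The set of bead positions in the abacus with `K` beads of a partition. -/
def beads {n : ℕ} (p : n.Partition) (K : ℕ) : Finset ℕ := (range K).image (beadPos p K)

lemma beadPos_strictMono {n : ℕ} (p : n.Partition) (K : ℕ) : StrictMono (beadPos p K) := by
  intro i j h
  have := row_antitone p (show K - 1 - j ≤ K - 1 - i by omega)
  simp only [beadPos]
  omega

lemma card_beads {n : ℕ} (p : n.Partition) (K : ℕ) : #(beads p K) = K := by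
  rw [beads, card_image_of_injective _ (beadPos_strictMono p K).injective, card_range]

lemma sum_beads {n K : ℕ} (p : n.Partition) (hK : n ≤ K) :
    ∑ x ∈ beads p K, x = n + K.choose 2 := by
  rw [beads, sum_image (beadPos_strictMono p K).injective.injOn]
  simp only [beadPos]
  rw [sum_add_distrib, sum_range_reflect, sum_row p hK, sum_range_id, Nat.choose_two_right]

lemma eq_of_image_range_eq {x y : ℕ → ℕ} (hx : StrictMono x) (hy : StrictMono y) {K : ℕ}
    (h : (range K).image x = (range K).image y) {i : ℕ} (hi : i < K) : x i = y i := by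
  have hc : #((range K).image x) = K := by
    rw [card_image_of_injective _ hx.injective, card_range]
  have h1 := orderEmbOfFin_unique hc (f := fun i : Fin K => x i)
    (fun i => mem_image_of_mem _ (mem_range.2 i.2)) (fun i j h => hx h)
  have h2 := orderEmbOfFin_unique hc (f := fun i : Fin K => y i)
    (fun i => h ▸ mem_image_of_mem _ (mem_range.2 i.2)) (fun i j h => hy h)
  exact congrFun (h1.trans h2.symm) ⟨i, hi⟩

lemma beads_injective {n K : ℕ} (hK : n ≤ K) {p q : n.Partition} (h : beads p K = beads q K) :
    p = q := by
  refine row_injective fun i hi => ?_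
  have := eq_of_image_range_eq (beadPos_strictMono p K) (beadPos_strictMono q K) h
    (show K - 1 - i < K by omega)
  simp only [beadPos, show K - 1 - (K - 1 - i) = i by omega] at this
  omega

lemma exists_strictMono_image_eq (X : Finset ℕ) :
    ∃ x : ℕ → ℕ, StrictMono x ∧ (range #X).image x = X := by
  refine ⟨fun i => if h : i < #X then X.orderEmbOfFin rfl ⟨i, h⟩ else X.sup id + 1 + i, ?_, ?_⟩
  · intro i j hij
    have h1 : ∀ k, X.orderEmbOfFin rfl k ≤ X.sup id := fun k =>
      le_sup (f := id) (orderEmbOfFin_mem X rfl k)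
    dsimp only
    split_ifs with hi hj hj
    · exact (X.orderEmbOfFin rfl).strictMono hij
    · have := h1 ⟨i, hi⟩
      omega
    · omega
    · omega
  · refine eq_of_subset_of_card_le ?_ ?_
    · intro y hy
      obtain ⟨i, hi, rfl⟩ := mem_image.1 hy
      rw [mem_range] at hi
      simp only [hi, dif_pos]
      exact orderEmbOfFin_mem X rfl _
    · rw [card_image_of_injOn, card_range]
      intro i hi j hj hij
      have hi' : i < #X := by simpa using hi
      have hj' : j < #X := by simpa using hj
      simp only [hi', hj', dif_pos] at hij
      simpa using (X.orderEmbOfFin rfl).injective hij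

lemma exists_beads_eq {n K : ℕ} (X : Finset ℕ) (hX : #X = K)
    (hn : ∑ x ∈ X, x = n + K.choose 2) : ∃ p : n.Partition, beads p K = X := by
  obtain ⟨x, hx, hxX⟩ := exists_strictMono_image_eq X
  rw [hX] at hxX
  have hle : ∀ i, i ≤ x i := fun i => hx.le_apply
  have hmono : ∀ i j, i ≤ j → x i + (j - i) ≤ x j := by
    intro i j hij
    have := hx.add_le_nat (j - i) i
    rw [Nat.sub_add_cancel hij] at this
    omega
  let a : ℕ → ℕ := fun i => if i < K then x (K - 1 - i) - (K - 1 - i) else 0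
  have hax : ∀ i < K, a (K - 1 - i) + i = x i := by
    intro i hi
    have := hle i
    simp only [a, show K - 1 - (K - 1 - i) = i by omega, if_pos (show K - 1 - i < K by omega)]
    omega
  obtain ⟨p, hp⟩ := exists_row_eq (n := n) (K := K) (a := a) (by
      intro i j hij
      simp only [a]
      split_ifs with h1 h2 h2
      · have := hmono (K - 1 - j) (K - 1 - i) (by omega)
        omega
      · omega
      · omega
      · omega) (fun i hi => if_neg (by omega)) (by
      rw [← hxX, sum_image hx.injective.injOn, ← sum_congr rfl fun i hi => hax i (mem_range.1 hi),
        sum_add_distrib, sum_range_reflect, sum_range_id, Nat.choose_two_right] at hn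
      omega)
  refine ⟨p, ?_⟩
  rw [beads, ← hxX]
  refine image_congr fun i hi => ?_
  rw [beadPos, hp, hax i (by simpa using hi)]

lemma isTCore_iff_beads {n K t : ℕ} (ht : 0 < t) (p : n.Partition) (hK : n ≤ K) :
    IsTCore t p ↔ ∀ x ∈ beads p K, t ≤ x → x - t ∈ beads p K := by
  have hmem : ∀ y, y ∈ beads p K ↔ ∃ i < K, row p i + (K - 1 - i) = y := by
    intro y
    simp only [beads, mem_image, mem_range, beadPos]
    constructor
    · rintro ⟨i, hi, rfl⟩
      exact ⟨K - 1 - i, by omega, by omega⟩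
    · rintro ⟨i, hi, rfl⟩
      exact ⟨K - 1 - i, by omega, by rw [show K - 1 - (K - 1 - i) = i by omega]⟩
  have hhook : ∀ i j, hookLength p i j
      = (row p i - j) + ((p.parts.filter (fun x => j < x)).card - i) - 1 := fun i j => rfl
  have hcol : ∀ j, (p.parts.filter (fun x => j < x)).card ≤ K := by
    intro j
    by_contra! h
    rw [← lt_row_iff, row_eq_zero p hK] at h
    omega
  have hzero : row p K = 0 := row_eq_zero p hK
  constructor
  · intro hp x hx htx
    by_contra hy
    obtain ⟨i, hi, hix⟩ := (hmem x).1 hx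
    have hy' : ∀ s < K, row p s + (K - 1 - s) ≠ x - t := fun s hs h => hy ((hmem _).2 ⟨s, hs, h⟩)
    have hex : ∃ s, K ≤ s ∨ row p s + (K - 1 - s) < x - t := ⟨K, Or.inl le_rfl⟩
    classical
    obtain ⟨s, hs, hmin⟩ : ∃ s, (K ≤ s ∨ row p s + (K - 1 - s) < x - t) ∧
        ∀ s' < s, s' < K ∧ x - t < row p s' + (K - 1 - s') := by
      refine ⟨Nat.find hex, Nat.find_spec hex, fun s' hs' => ?_⟩
      have := Nat.find_min hex hs'
      push Not at this
      exact ⟨this.1, lt_of_le_of_ne this.2 (hy' s' this.1).symm⟩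
    have hsK : s ≤ K := by
      by_contra! h
      exact absurd (hmin K h).1 (lt_irrefl _)
    have his : i < s := by
      by_contra! h
      have := row_antitone p h
      rcases hs with hs | hs <;> omega
    have hys : K - s ≤ x - t := by
      rcases hs with hs | hs <;> omega
    have hc : (p.parts.filter (fun z => x - t - (K - s) < z)).card = s := by
      refine le_antisymm ?_ ?_
      · by_contra! h
        rw [← lt_row_iff] at h
        rcases hs with hs | hs
        · rw [le_antisymm hsK hs, hzero] at h
          omega
        · omega
      · have h1 := (hmin (s - 1) (by omega)).2
        have h2 := (lt_row_iff p (s - 1) (x - t - (K - s))).1 (by omega)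
        omega
    have hrow : x - t - (K - s) < row p i := by rw [lt_row_iff, hc]; exact his
    refine hp i _ hrow ⟨1, ?_⟩
    rw [hhook, hc]
    omega
  · intro hX i j hj hdvd
    change j < row p i at hj
    have hic := (lt_row_iff p i j).1 hj
    have hcK := hcol j
    rw [hhook] at hdvd
    obtain ⟨d, hd⟩ := hdvd
    set c := (p.parts.filter (fun x => j < x)).card with hc
    have hall : ∀ e ≤ d, row p i + (K - 1 - i) - t * e ∈ beads p K := by
      intro e he
      induction e with
      | zero => exact (hmem _).2 ⟨i, by omega, by simp⟩
      | succ e ih =>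
        have h1 := Nat.mul_le_mul_left t he
        rw [mul_add_one] at h1 ⊢
        have h2 := hX _ (ih (by omega)) (by omega)
        rwa [Nat.sub_sub] at h2
    obtain ⟨s, hs, hsy⟩ := (hmem _).1 (hall d le_rfl)
    rcases lt_or_ge s c with h | h
    · have := (lt_row_iff p s j).2 h
      omega
    · have : ¬ j < row p s := by rw [lt_row_iff]; omega
      omega

/-- The bead set with `m r` flush beads on runner `r`. -/
def flushBeads (m : Fin 5 → ℕ) : Finset ℕ :=
  univ.biUnion fun r => (range (m r)).image fun j => (r : ℕ) + 5 * j

lemma sum_flushBeads (m : Fin 5 → ℕ) (f : ℕ → ℕ) :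
    ∑ x ∈ flushBeads m, f x = ∑ r, ∑ j ∈ range (m r), f ((r : ℕ) + 5 * j) := by
  rw [flushBeads, sum_biUnion]
  · refine sum_congr rfl fun r _ => sum_image fun i _ j _ h => ?_
    change (r : ℕ) + 5 * i = r + 5 * j at h
    omega
  · intro r _ s _ hrs
    rw [Function.onFun, disjoint_left]
    intro x hx hx'
    obtain ⟨i, -, rfl⟩ := mem_image.1 hx
    obtain ⟨j, -, h⟩ := mem_image.1 hx'
    exact hrs (Fin.ext (by omega))

lemma card_flushBeads (m : Fin 5 → ℕ) : #(flushBeads m) = ∑ r, m r := by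
  rw [card_eq_sum_ones, sum_flushBeads m fun _ => 1]
  simp

lemma sum_id_flushBeads (m : Fin 5 → ℕ) : ∑ x ∈ flushBeads m, x = weight m := by
  rw [sum_flushBeads m fun x => x, weight]
  refine sum_congr rfl fun r _ => ?_
  rw [sum_add_distrib, ← mul_sum, sum_range_id, ← Nat.choose_two_right, sum_const, card_range,
    smul_eq_mul]
  ring

lemma mem_flushBeads {m : Fin 5 → ℕ} (r : Fin 5) (j : ℕ) :
    (r : ℕ) + 5 * j ∈ flushBeads m ↔ j < m r := by
  simp only [flushBeads, mem_biUnion, mem_univ, true_and, mem_image, mem_range]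
  constructor
  · rintro ⟨s, i, hi, h⟩
    obtain rfl : s = r := Fin.ext (by omega)
    rwa [show j = i by omega]
  · intro h
    exact ⟨r, j, h, rfl⟩

lemma flushBeads_injective : Function.Injective flushBeads := by
  intro m m' h
  ext r
  refine eq_of_forall_lt_iff fun j => ?_
  rw [← mem_flushBeads, h, mem_flushBeads]

lemma exists_eq_add_five_mul (x : ℕ) : ∃ (r : Fin 5) (j : ℕ), x = r + 5 * j :=
  ⟨⟨x % 5, Nat.mod_lt _ (by norm_num)⟩, x / 5, (Nat.mod_add_div x 5).symm⟩

lemma sub_five_mem_flushBeads {m : Fin 5 → ℕ} {x : ℕ} (hx : x ∈ flushBeads m) (h : 5 ≤ x) :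
    x - 5 ∈ flushBeads m := by
  obtain ⟨r, j, rfl⟩ := exists_eq_add_five_mul x
  have hr := r.2
  rw [mem_flushBeads] at hx
  rw [show (r : ℕ) + 5 * j - 5 = r + 5 * (j - 1) by omega, mem_flushBeads]
  omega

lemma exists_flushBeads_eq {X : Finset ℕ} (hX : ∀ x ∈ X, 5 ≤ x → x - 5 ∈ X) :
    ∃ m, flushBeads m = X := by
  refine ⟨fun r => #{j ∈ range (X.sup id + 1) | (r : ℕ) + 5 * j ∈ X}, ?_⟩
  ext x
  obtain ⟨r, j, rfl⟩ := exists_eq_add_five_mul x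
  have hsup : ∀ j, (r : ℕ) + 5 * j ∈ X → j < X.sup id + 1 := by
    intro j hj
    have := le_sup (f := id) hj
    simp only [id] at this
    omega
  have hdown : ∀ d i, (r : ℕ) + 5 * (i + d) ∈ X → (r : ℕ) + 5 * i ∈ X := by
    intro d i h
    induction d with
    | zero => exact h
    | succ d ih =>
      have := hX _ h (by omega)
      rw [show (r : ℕ) + 5 * (i + (d + 1)) - 5 = r + 5 * (i + d) by omega] at this
      exact ih this
  rw [mem_flushBeads, ← mem_iff_lt_card]
  · rw [mem_filter, mem_range]
    exact ⟨fun h => h.2, fun h => ⟨hsup j h, h⟩⟩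
  · intro i hi i' hi'
    rw [mem_filter, mem_range] at hi ⊢
    exact ⟨by omega, hdown (i - i') i' (by rw [Nat.add_sub_cancel' hi']; exact hi.2)⟩

lemma card_isTCore_five {n K : ℕ} (hK : n ≤ K) :
    Nat.card {p : n.Partition // IsTCore 5 p} =
      #{m ∈ piAntidiag (univ : Finset (Fin 5)) K | weight m = n + K.choose 2} := by
  rw [← Nat.card_eq_finsetCard]
  choose g hg using fun p : {p : n.Partition // IsTCore 5 p} =>
    exists_flushBeads_eq ((isTCore_iff_beads (by norm_num) p.1 hK).1 p.2)
  refine Nat.card_eq_of_bijective (fun p => ⟨g p, ?_⟩) ⟨?_, ?_⟩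
  · rw [mem_filter, mem_piAntidiag, ← card_flushBeads, ← sum_id_flushBeads, hg, card_beads,
      sum_beads _ hK]
    simp
  · intro p q h
    have h' : g p = g q := congrArg Subtype.val h
    refine Subtype.ext (beads_injective hK ?_)
    rw [← hg, ← hg, h']
  · rintro ⟨m, hm⟩
    rw [mem_filter, mem_piAntidiag, ← card_flushBeads, ← sum_id_flushBeads] at hm
    obtain ⟨p, hp⟩ := exists_beads_eq _ hm.1.1 hm.2
    have hcore : IsTCore 5 p := by
      rw [isTCore_iff_beads (by norm_num) p hK, hp]
      exact fun x => sub_five_mem_flushBeads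
    refine ⟨⟨p, hcore⟩, Subtype.ext (flushBeads_injective ?_)⟩
    rw [hg, hp]

theorem coeff_coreSeries_eq_card (n : ℕ) :
    PowerSeries.coeff n coreSeries = Nat.card {p : n.Partition // IsTCore 5 p} := by
  rw [coeff_coreSeries le_rfl, card_isTCore_five (K := 5 * (2 * n + 2)) (by omega)]

lemma numA_eq_coeff (k n : ℕ) : (numA 5 k n : ℤ) = PowerSeries.coeff n (coreSeries ^ k) := by
  have e : numA 5 k n = Nat.card (Σ l : piAntidiag (univ : Finset (Fin k)) n,
      ∀ i, {p : (l.1 i).Partition // IsTCore 5 p}) := by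
    refine Nat.card_congr
      { toFun := fun f => ⟨⟨fun i => (f.1 i).1, by simpa using f.2.1⟩,
          fun i => ⟨(f.1 i).2, f.2.2 i⟩⟩
        invFun := fun f => ⟨fun i => ⟨⟨f.1.1 i, ?_⟩, (f.2 i).1⟩, ?_, fun i => (f.2 i).2⟩
        left_inv := fun f => rfl
        right_inv := fun f => rfl }
    · have h := (mem_piAntidiag.1 f.1.2).1
      exact Nat.lt_succ_of_le
        ((single_le_sum (f := f.1.1) (fun i _ => Nat.zero_le _) (mem_univ i)).trans_eq h)
    · exact (mem_piAntidiag.1 f.1.2).1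
  have h : coreSeries ^ k = ∏ _i : Fin k, coreSeries := by simp
  rw [e, Nat.card_sigma, h, coeff_prod_univ]
  simp only [Nat.card_pi, coeff_coreSeries_eq_card]
  push_cast
  exact sum_coe_sort (piAntidiag (univ : Finset (Fin k)) n)
    fun l => ∏ i, (Nat.card {p : (l i).Partition // IsTCore 5 p} : ℤ)

end FiveCore

theorem stmt_16 : ∀ i n : ℕ, 125 ∣ numA 5 (3125 * i + 2) (125 * n + 123) := by
  intro i n
  have h := FiveCore.dvd_coeff_coreSeries_pow i n
  rw [← FiveCore.numA_eq_coeff] at h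
  exact_mod_cast h
end
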